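/- Let μ, ν be finite Borel measures on ℝⁿ with compact supports, both with total mass, and with I_s(μ) < ∞ and I_t(ν) < ∞ where 0 < s, t < n and u := s + t - n > 0. Let θ be a finite Borel measure on O(n) with θ(O(n)) ≤ 1 satisfying θ({g : |x - g(z)| < r}) ≤ (r/|z|)^β for all nonzero x, z and r > 0, where β > n - u. Then for every ε > 0, ∬ I_u(ν_{g,z,ε} μ) dz dθ(g) ≤ C(n, s, t) I_s(μ) I_t(ν), where ν_{g,z,ε}(x) = ν_ε(g⁻¹(x) - z), ν_ε = ψ_ε * ν is a mollification, and ν_{g,z,ε} μ denotes the measure with density ν_{g,z,ε} with respect to μ. -/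

import Mathlib

open MeasureTheory Metric Set
open scoped ENNReal
namespace S17
open FourierTransform in
theorem plancherel {E : Type*} [NormedAddCommGroup E] [InnerProductSpace ℝ E]
    [FiniteDimensional ℝ E] [MeasurableSpace E] [BorelSpace E] (f : E → ℂ)
    (hf : Integrable f) (hf2 : MemLp f 2) :
    ∫⁻ x, ‖𝓕 f x‖ₑ ^ 2 = ∫⁻ x, ‖f x‖ₑ ^ 2 := by
  set f2 : Lp ℂ 2 (volume : Measure E) := hf2.toLp f with hf2def
  have hcont : Continuous (𝓕 f) :=
    VectorFourier.fourierIntegral_continuous Real.continuous_fourierChar continuous_inner hf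
  have hae : ∀ᵐ x, 𝓕 f x = (𝓕 f2 : Lp ℂ 2 (volume : Measure E)) x := by
    apply ae_eq_of_integral_contDiff_smul_eq
    · exact hcont.locallyIntegrable
    · exact (Lp.memLp _).locallyIntegrable (by norm_num)
    · intro g hg hgc
      have hgc' : HasCompactSupport (fun x => (g x : ℂ)) := hgc.comp_left (g := Complex.ofReal) rfl
      have hgs : ContDiff ℝ (⊤ : ℕ∞) (fun x => (g x : ℂ)) := Complex.ofRealCLM.contDiff.comp hg
      set G : SchwartzMap E ℂ := hgc'.toSchwartzMap hgs with hG
      have hGa : ∀ x, G x = (g x : ℂ) := fun x => rfl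
      have h1 := congrArg (fun T => T G) (Lp.fourier_toTemperedDistribution_eq f2)
      simp only [TemperedDistribution.fourier_apply, Lp.toTemperedDistribution_apply] at h1
      have h2 : ∫ ξ, 𝓕 (G : E → ℂ) ξ • f ξ = ∫ x, G x • 𝓕 f x := by
        have := VectorFourier.integral_fourierIntegral_smul_eq_flip (e := Real.fourierChar)
          (μ := (volume : Measure E)) (ν := volume) (L := innerₗ E) (f := (G : E → ℂ)) (g := f)
          Real.continuous_fourierChar continuous_inner G.integrable hf
        rw [flip_innerₗ] at this
        exact this
      have h3 : ∫ x, (𝓕 G) x • f2 x = ∫ ξ, 𝓕 (G : E → ℂ) ξ • f ξ := by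
        apply integral_congr_ae
        filter_upwards [hf2.coeFn_toLp] with x hx
        rw [SchwartzMap.fourier_coe, hx]
      rw [h3, h2] at h1
      simpa [hGa] using h1
  have hn : ‖𝓕 f2‖ = ‖f2‖ := Lp.norm_fourier_eq f2
  have key : ∀ h : Lp ℂ 2 (volume : Measure E), ∫⁻ x, ‖h x‖ₑ ^ 2 = ENNReal.ofReal ‖h‖ ^ 2 := by
    intro h
    have : ENNReal.ofReal ‖h‖ = eLpNorm h 2 volume := by
      rw [Lp.norm_def, ENNReal.ofReal_toReal (Lp.eLpNorm_ne_top h)]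
    rw [this, eLpNorm_eq_lintegral_rpow_enorm_toReal (by norm_num) (by norm_num),
      ← ENNReal.rpow_natCast, ← ENNReal.rpow_mul]
    simp
  have a1 : ∫⁻ x, ‖𝓕 f x‖ₑ ^ 2 = ∫⁻ x, ‖(𝓕 f2 : Lp ℂ 2 (volume : Measure E)) x‖ₑ ^ 2 := by
    apply lintegral_congr_ae
    filter_upwards [hae] with x hx
    rw [hx]
  have a2 : ∫⁻ x, ‖f x‖ₑ ^ 2 = ∫⁻ x, ‖f2 x‖ₑ ^ 2 := by
    apply lintegral_congr_ae
    filter_upwards [hf2.coeFn_toLp] with x hx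
    rw [hx]
  rw [a1, a2, key, key, hn]
end S17

open MeasureTheory Metric Set
open scoped ENNReal
namespace S17

noncomputable def ee (x : ℝ) : ℂ := Complex.exp (2 * Real.pi * x * Complex.I)

theorem ee_add (x y : ℝ) : ee (x + y) = ee x * ee y := by
  unfold ee; rw [← Complex.exp_add]; congr 1; push_cast; ring

@[simp] theorem ee_zero : ee 0 = 1 := by simp [ee]

@[simp] theorem norm_ee (x : ℝ) : ‖ee x‖ = 1 := by
  unfold ee
  have : (2 * Real.pi * x * Complex.I : ℂ) = ((2 * Real.pi * x : ℝ) : ℂ) * Complex.I := by push_cast; ring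
  rw [this, Complex.norm_exp_ofReal_mul_I]

@[simp] theorem enorm_ee (x : ℝ) : ‖ee x‖ₑ = 1 := by
  rw [← ofReal_norm, norm_ee]; simp

theorem ee_continuous : Continuous ee := by unfold ee; fun_prop

theorem conj_ee (x : ℝ) : (starRingEnd ℂ) (ee x) = ee (-x) := by
  unfold ee; rw [← Complex.exp_conj]; congr 1; simp; left; exact Complex.conj_ofNat 2

theorem fourierChar_smul (x : ℝ) (z : ℂ) : Real.fourierChar x • z = ee x * z := by
  rw [Circle.smul_def, Real.fourierChar_apply, smul_eq_mul]; unfold ee; congr 2; push_cast; ring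

noncomputable def SS (a x : ℝ) : ℝ := 2 * a * Real.sinc (2 * Real.pi * a * x)

noncomputable def trap (a b x : ℝ) : ℝ := max 0 (min a (x + b) - max (-a) (x - b))

noncomputable def pp (x : ℝ) : ℝ := 1 / (1 + x ^ 2)

theorem pp_pos (x : ℝ) : 0 < pp x := by unfold pp; positivity

theorem trap_continuous (a b : ℝ) : Continuous (trap a b) := by unfold trap; fun_prop

open FourierTransform in
theorem fourier_ind (a : ℝ) (ha : 0 < a) (x : ℝ) :
    𝓕 (indicator (Icc (-a) a) (fun _ : ℝ => (1 : ℂ))) x = (SS a x : ℂ) := by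
  rw [Real.fourier_real_eq]
  have h1 : ∀ v : ℝ, Real.fourierChar (-(v * x)) • indicator (Icc (-a) a) (fun _ : ℝ => (1 : ℂ)) v
      = indicator (Icc (-a) a) (fun v => Complex.exp ((-(2 * Real.pi * x) * Complex.I) * v)) v := by
    intro v
    by_cases hv : v ∈ Icc (-a) a
    · simp only [indicator_of_mem hv]
      rw [Circle.smul_def, Real.fourierChar_apply]
      simp only [smul_eq_mul, mul_one]
      congr 1; push_cast; ring
    · simp [indicator_of_notMem hv]
  simp_rw [h1]
  rw [integral_indicator measurableSet_Icc, integral_Icc_eq_integral_Ioc,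
    ← intervalIntegral.integral_of_le (by linarith)]
  unfold SS
  by_cases hx : x = 0
  · simp [hx]; ring
  · have hc : (-(2 * Real.pi * x) * Complex.I : ℂ) ≠ 0 := by
      simp [hx, Real.pi_ne_zero]
    rw [integral_exp_mul_complex hc, Real.sinc_of_ne_zero (by positivity)]
    have hx' : (x : ℂ) ≠ 0 := by exact_mod_cast hx
    have hpi : (Real.pi : ℂ) ≠ 0 := by exact_mod_cast Real.pi_ne_zero
    have ha' : (a : ℂ) ≠ 0 := by exact_mod_cast ha.ne'
    push_cast
    rw [Complex.sin]
    field_simp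
    ring_nf
    rw [Complex.I_sq]
    ring

theorem conv_ind (a b : ℝ) (ha : 0 < a) (hb : 0 < b) :
    convolution (indicator (Icc (-a) a) (fun _ : ℝ => (1 : ℂ)))
      (indicator (Icc (-b) b) (fun _ : ℝ => (1 : ℂ))) (ContinuousLinearMap.mul ℂ ℂ) volume
      = fun x => (trap a b x : ℂ) := by
  ext x
  rw [convolution_def]
  have : ∀ t : ℝ, (ContinuousLinearMap.mul ℂ ℂ) (indicator (Icc (-a) a) (fun _ : ℝ => (1 : ℂ)) t)
      (indicator (Icc (-b) b) (fun _ : ℝ => (1 : ℂ)) (x - t)) =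
      indicator (Icc (max (-a) (x - b)) (min a (x + b))) (fun _ => (1 : ℂ)) t := by
    intro t
    simp only [ContinuousLinearMap.mul_apply', indicator_apply, mem_Icc]
    have : (max (-a) (x - b) ≤ t ∧ t ≤ min a (x + b)) ↔ ((-a ≤ t ∧ t ≤ a) ∧ (-b ≤ x - t ∧ x - t ≤ b)) := by
      rw [max_le_iff, le_min_iff]
      constructor
      · rintro ⟨⟨h1, h2⟩, h3, h4⟩; refine ⟨⟨h1, h3⟩, ?_, ?_⟩ <;> linarith
      · rintro ⟨⟨h1, h2⟩, h3, h4⟩; refine ⟨⟨h1, ?_⟩, h2, ?_⟩ <;> linarith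
    simp only [this]
    split_ifs <;> simp_all
  simp_rw [this]
  rw [integral_indicator measurableSet_Icc]
  simp [trap, Measure.real, Real.volume_Icc, max_comm, ENNReal.toReal_ofReal']

theorem ind_integrable (a : ℝ) : Integrable (indicator (Icc (-a) a) (fun _ : ℝ => (1 : ℂ))) := by
  rw [integrable_indicator_iff measurableSet_Icc]
  exact integrableOn_const (by simp)

open FourierTransform in
theorem fourier_trap (a b : ℝ) (ha : 0 < a) (hb : 0 < b) (x : ℝ) :
    𝓕 (fun x => (trap a b x : ℂ)) x = ((SS a x * SS b x : ℝ) : ℂ) := by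
  rw [← conv_ind a b ha hb,
    Real.fourier_mul_convolution_eq (ind_integrable a) (ind_integrable b), fourier_ind a ha, fourier_ind b hb]
  push_cast; rfl

theorem trap_integrable (a b : ℝ) (ha : 0 < a) (hb : 0 < b) :
    Integrable (fun x => (trap a b x : ℂ)) := by
  rw [← conv_ind a b ha hb]
  exact (ind_integrable a).integrable_convolution _ (ind_integrable b)

theorem sinc_bd (y : ℝ) : Real.sinc y ^ 2 * (1 + y ^ 2) ≤ 2 := by
  by_cases h : y = 0
  · simp [h]
  · rw [Real.sinc_of_ne_zero h]
    have h1 : (Real.sin y / y) ^ 2 ≤ 1 := by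
      rw [div_pow, div_le_one (by positivity)]
      exact sq_le_sq.mpr (Real.abs_sin_le_abs)
    have h2 : (Real.sin y / y) ^ 2 * y ^ 2 ≤ 1 := by
      rw [div_pow, div_mul_cancel₀ _ (by positivity)]
      exact Real.sin_sq_le_one y
    nlinarith

theorem SS_sq_le (a : ℝ) (ha : 0 < a) : ∃ C, 0 < C ∧ ∀ x, SS a x ^ 2 ≤ C * pp x := by
  refine ⟨2 * (2 * a) ^ 2 * (1 + 1 / a ^ 2), by positivity, fun x => ?_⟩
  have h := sinc_bd (2 * Real.pi * a * x)
  have h3 : 1 ≤ Real.pi := by linarith [Real.pi_gt_three]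
  have h4 : a ^ 2 * x ^ 2 ≤ (2 * Real.pi * a * x) ^ 2 := by
    have : (1:ℝ) ≤ (2 * Real.pi) ^ 2 := by nlinarith
    calc a ^ 2 * x ^ 2 = 1 * (a ^ 2 * x ^ 2) := by ring
      _ ≤ (2 * Real.pi) ^ 2 * (a ^ 2 * x ^ 2) := by gcongr
      _ = _ := by ring
  unfold SS pp
  rw [mul_one_div, le_div_iff₀ (by positivity)]
  set S := Real.sinc (2 * Real.pi * a * x)
  have hS : S ^ 2 * (1 + a ^ 2 * x ^ 2) ≤ 2 := le_trans (by gcongr) h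
  have : (1 + x ^ 2) ≤ (1 + 1 / a ^ 2) * (1 + a ^ 2 * x ^ 2) := by
    have : (1 + 1 / a ^ 2) * (1 + a ^ 2 * x ^ 2) = 1 + x ^ 2 + 1 / a ^ 2 + a ^ 2 * x ^ 2 := by
      field_simp; ring
    rw [this]
    have : 0 ≤ 1 / a ^ 2 := by positivity
    nlinarith [sq_nonneg (a * x)]
  calc (2 * a * S) ^ 2 * (1 + x ^ 2) ≤ (2 * a * S) ^ 2 * ((1 + 1 / a ^ 2) * (1 + a ^ 2 * x ^ 2)) := by gcongr
    _ = (2 * a) ^ 2 * (1 + 1 / a ^ 2) * (S ^ 2 * (1 + a ^ 2 * x ^ 2)) := by ring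
    _ ≤ (2 * a) ^ 2 * (1 + 1 / a ^ 2) * 2 := by gcongr
    _ = _ := by ring

theorem SS_mul_le (a b : ℝ) (ha : 0 < a) (hb : 0 < b) :
    ∃ C, 0 < C ∧ ∀ x, |SS a x * SS b x| ≤ C * pp x := by
  obtain ⟨C1, h1, H1⟩ := SS_sq_le a ha
  obtain ⟨C2, h2, H2⟩ := SS_sq_le b hb
  refine ⟨C1 + C2, by positivity, fun x => ?_⟩
  have := H1 x
  have := H2 x
  rw [abs_mul]
  nlinarith [sq_abs (SS a x), sq_abs (SS b x), two_mul_le_add_sq |SS a x| |SS b x|, sq_nonneg (SS a x),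
    sq_nonneg (SS b x)]

theorem pp_integrable : Integrable pp := by
  unfold pp
  simpa using integrable_inv_one_add_sq

theorem SS_continuous (a : ℝ) : Continuous (SS a) := by
  unfold SS
  have := Real.continuous_sinc
  fun_prop

theorem SS_mul_integrable (a b : ℝ) (ha : 0 < a) (hb : 0 < b) :
    Integrable (fun x => SS a x * SS b x) := by
  obtain ⟨C, hC, H⟩ := SS_mul_le a b ha hb
  exact (pp_integrable.const_mul C).mono' ((SS_continuous a).mul (SS_continuous b)).aestronglyMeasurable
    (Filter.Eventually.of_forall H)

open FourierTransform in
theorem integral_SS (a b : ℝ) (ha : 0 < a) (hb : 0 < b) (l : ℝ) :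
    ∫ x, ee (x * l) * ((SS a x * SS b x : ℝ) : ℂ) = (trap a b l : ℂ) := by
  have hc : Continuous (fun x => (trap a b x : ℂ)) :=
    Complex.continuous_ofReal.comp (trap_continuous a b)
  have hF : 𝓕 (fun x => (trap a b x : ℂ)) = fun x => ((SS a x * SS b x : ℝ) : ℂ) := by
    ext x; exact fourier_trap a b ha hb x
  have := hc.fourierInv_fourier_eq (trap_integrable a b ha hb)
    (by rw [hF]; exact (SS_mul_integrable a b ha hb).ofReal)
  have := congrFun this l
  rw [hF, Real.fourierInv_eq] at this
  rw [← this]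
  apply integral_congr_ae
  filter_upwards with x
  rw [fourierChar_smul]
  simp [mul_comm]

/-- positive weight with compact spectrum -/
noncomputable def ww (x : ℝ) : ℝ := SS (1/2) x * SS (1/2) x + SS (1/2) (x + 1/2) * SS (1/2) (x + 1/2)

theorem ww_continuous : Continuous ww := by
  have := SS_continuous (1/2)
  unfold ww; fun_prop

theorem ww_integrable : Integrable ww :=
  (SS_mul_integrable _ _ (by norm_num) (by norm_num)).add
    ((SS_mul_integrable (1/2) (1/2) (by norm_num) (by norm_num)).comp_add_right (1/2))

theorem ww_lower (x : ℝ) : pp x ≤ 20 * ww x := by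
  have key : ∀ y, Real.sin (Real.pi * y) ^ 2 ≤ Real.pi ^ 2 * (1 + y ^ 2) * (SS (1/2) y) ^ 2 := by
    intro y
    unfold SS
    have e : 2 * Real.pi * (1 / 2) * y = Real.pi * y := by ring
    rw [e]
    by_cases h : y = 0
    · simp [h]; positivity
    · rw [Real.sinc_of_ne_zero (by positivity)]
      have : Real.pi ^ 2 * (1 + y ^ 2) * (2 * (1/2) * (Real.sin (Real.pi * y) / (Real.pi * y))) ^ 2
        = Real.sin (Real.pi * y) ^ 2 * ((1 + y ^ 2) / y ^ 2) := by
        field_simp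
      rw [this]
      have : 1 ≤ (1 + y ^ 2) / y ^ 2 := by
        rw [le_div_iff₀ (by positivity)]; linarith
      nlinarith [sq_nonneg (Real.sin (Real.pi * y))]
  have k1 := key x
  have k2 := key (x + 1/2)
  have : Real.sin (Real.pi * (x + 1/2)) = Real.cos (Real.pi * x) := by
    rw [← Real.sin_add_pi_div_two]; congr 1; ring
  rw [this] at k2
  have k3 := Real.sin_sq_add_cos_sq (Real.pi * x)
  have hpi : Real.pi ^ 2 ≤ 10 := by nlinarith [Real.pi_lt_d2, Real.pi_pos]
  unfold pp ww
  rw [div_le_iff₀ (by positivity)]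
  have k4 : 1 + (x + 1/2) ^ 2 ≤ 2 * (1 + x ^ 2) := by nlinarith [sq_nonneg (x - 1/2)]
  set A := SS (1/2) x
  set B := SS (1/2) (x + 1/2)
  have k5 : Real.pi ^ 2 * (1 + x ^ 2) * A ^ 2 ≤ 10 * (2 * (1 + x ^ 2)) * A ^ 2 := by gcongr; nlinarith [sq_nonneg x]
  have k6 : Real.pi ^ 2 * (1 + (x + 1/2) ^ 2) * B ^ 2 ≤ 10 * (2 * (1 + x ^ 2)) * B ^ 2 := by gcongr
  nlinarith

theorem ww_nonneg (x : ℝ) : 0 ≤ ww x := by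
  have := ww_lower x; have := pp_pos x; linarith

theorem ww_upper : ∃ C, 0 < C ∧ ∀ x, ww x ≤ C * pp x := by
  obtain ⟨C, hC, H⟩ := SS_sq_le (1/2) (by norm_num)
  refine ⟨C * 3, by positivity, fun x => ?_⟩
  have h1 := H x
  have h2 := H (x + 1/2)
  have h3 : pp (x + 1/2) ≤ 2 * pp x := by
    unfold pp
    rw [mul_one_div, div_le_div_iff₀ (by positivity) (by positivity)]
    nlinarith [sq_nonneg (x + 1)]
  have h4 : C * pp (x + 1/2) ≤ C * (2 * pp x) := by gcongr
  unfold ww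
  nlinarith

theorem trap_zero (a b x : ℝ) (h : a + b ≤ |x|) : trap a b x = 0 := by
  unfold trap
  apply max_eq_left
  rcases le_abs'.1 h with h | h
  · have := min_le_right a (x + b); have := le_max_left (-a) (x - b); linarith
  · have := min_le_left a (x + b); have := le_max_right (-a) (x - b); linarith

theorem ww_spec (l : ℝ) (hl : 1 ≤ |l|) : ∫ x, ee (x * l) * (ww x : ℂ) = 0 := by
  have h := integral_SS (1/2) (1/2) (by norm_num) (by norm_num) l
  rw [trap_zero _ _ _ (by norm_num; exact hl)] at h
  have hi : Integrable (fun x : ℝ => ee (x * l) * ((SS (1/2) x * SS (1/2) x : ℝ) : ℂ)) := by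
    apply Integrable.bdd_mul (c := 1) ((SS_mul_integrable (1/2) (1/2) (by norm_num) (by norm_num)).ofReal)
    · apply Continuous.aestronglyMeasurable
      have := ee_continuous
      fun_prop
    · filter_upwards with x; simp
  have e : ∀ x : ℝ, ee (x * l) * (ww x : ℂ) =
      ee (x * l) * ((SS (1/2) x * SS (1/2) x : ℝ) : ℂ) +
      ee (-(1/2) * l) * (ee ((x + 1/2) * l) * ((SS (1/2) (x + 1/2) * SS (1/2) (x + 1/2) : ℝ) : ℂ)) := by
    intro x
    have : ee (x * l) = ee (-(1/2) * l) * ee ((x + 1/2) * l) := by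
      rw [← ee_add]; congr 1; ring
    unfold ww
    push_cast
    rw [← mul_assoc (ee (-(1/2) * l)), ← this]
    ring
  simp_rw [e]
  rw [integral_add hi ((hi.comp_add_right (1/2)).const_mul _), integral_const_mul,
    integral_add_right_eq_self (fun x : ℝ => ee (x * l) * ((SS (1/2) x * SS (1/2) x : ℝ) : ℂ)), h]
  simp

/-- reproducing kernel -/
noncomputable def vv (x : ℝ) : ℝ := SS (1/2) x * SS (3/2) x

theorem vv_continuous : Continuous vv := (SS_continuous _).mul (SS_continuous _)

theorem vv_bound : ∃ C, 0 < C ∧ ∀ x, |vv x| ≤ C * pp x := SS_mul_le _ _ (by norm_num) (by norm_num)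

theorem vv_spec (l : ℝ) (hl : |l| ≤ 1) : ∫ x, ee (x * l) * (vv x : ℂ) = 1 := by
  have h := integral_SS (1/2) (3/2) (by norm_num) (by norm_num) l
  unfold vv
  rw [h]
  have := abs_le.1 hl
  have : trap (1/2) (3/2) l = 1 := by
    unfold trap
    have h1 : min (1/2) (l + 3/2) = 1/2 := min_eq_left (by linarith)
    have h2 : max (-(1/2)) (l - 3/2) = -(1/2) := max_eq_left (by linarith)
    rw [h1, h2]; norm_num
  rw [this]; simp

end S17

open MeasureTheory Metric Set
open scoped ENNReal
namespace S17

noncomputable def kr (a x : ℝ) : ℝ := a⁻¹ * pp (x / a)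
noncomputable def kk (a x : ℝ) : ℝ≥0∞ := ENNReal.ofReal (kr a x)

theorem pp_continuous : Continuous pp := by
  unfold pp
  exact continuous_const.div (by fun_prop) (fun x => by positivity)

theorem kr_continuous (a : ℝ) : Continuous (kr a) := by
  unfold kr; have := pp_continuous; fun_prop

theorem kk_measurable (a : ℝ) : Measurable (kk a) :=
  ENNReal.measurable_ofReal.comp (kr_continuous a).measurable

theorem kr_pos {a : ℝ} (ha : 0 < a) (x : ℝ) : 0 < kr a x := by
  unfold kr; have := pp_pos (x / a); positivity

theorem kr_eq {a : ℝ} (ha : 0 < a) (x : ℝ) : kr a x = a / (a ^ 2 + x ^ 2) := by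
  unfold kr pp; field_simp

theorem lintegral_kk {a : ℝ} (ha : 0 < a) : ∫⁻ x, kk a x = ENNReal.ofReal Real.pi := by
  unfold kk
  rw [← ofReal_integral_eq_lintegral_ofReal]
  · congr 1
    unfold kr
    rw [integral_const_mul, Measure.integral_comp_div (fun x => pp x) a]
    unfold pp
    simp only [one_div]
    rw [integral_univ_inv_one_add_sq]
    simp [abs_of_pos ha]; field_simp
  · unfold kr
    exact (pp_integrable.comp_div ha.ne').const_mul _
  · exact Filter.Eventually.of_forall fun x => (kr_pos ha x).le

theorem kr_shift {a : ℝ} (ha : 0 < a) (x h : ℝ) : kr a (x - h) ≤ 2 * (1 + (h / a) ^ 2) * kr a x := by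
  rw [kr_eq ha, kr_eq ha, ← mul_div_assoc, div_le_div_iff₀ (by positivity) (by positivity)]
  have h1 : a ^ 2 + x ^ 2 ≤ 2 * (1 + (h / a) ^ 2) * (a ^ 2 + (x - h) ^ 2) := by
    have e : 2 * (1 + (h / a) ^ 2) * (a ^ 2 + (x - h) ^ 2) =
      2 * a ^ 2 + 2 * (x - h) ^ 2 + 2 * h ^ 2 + 2 * (h / a) ^ 2 * (x - h) ^ 2 := by
      field_simp
      ring
    rw [e]
    have : 0 ≤ 2 * (h / a) ^ 2 * (x - h) ^ 2 := by positivity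
    nlinarith [sq_nonneg (x - 2 * h), sq_nonneg a]
  nlinarith

theorem kk_shift {a : ℝ} (ha : 0 < a) (x h : ℝ) :
    kk a (x - h) ≤ ENNReal.ofReal (2 * (1 + (h / a) ^ 2)) * kk a x := by
  unfold kk
  rw [← ENNReal.ofReal_mul (by positivity)]
  exact ENNReal.ofReal_le_ofReal (kr_shift ha x h)

theorem kr_conv_pt {a b : ℝ} (ha : 0 < a) (hab : a ≤ b) (x r : ℝ) :
    kr a (x - r) * kr b r ≤ 8 * kr b x * (kr a (x - r) + kr b r) := by
  have hb : 0 < b := ha.trans_le hab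
  have p1 := kr_pos ha (x - r)
  have p2 := kr_pos hb r
  have p3 := kr_pos hb x
  have key : kr b r ≤ 8 * kr b x ∨ kr a (x - r) ≤ 8 * kr b x := by
    rw [kr_eq hb, kr_eq hb, kr_eq ha, ← mul_div_assoc]
    by_cases h1 : x ^ 2 ≤ 4 * r ^ 2
    · left
      rw [div_le_div_iff₀ (by positivity) (by positivity)]
      nlinarith [sq_nonneg b, mul_nonneg hb.le (sq_nonneg b), mul_le_mul_of_nonneg_left h1 hb.le, mul_nonneg hb.le (sq_nonneg r)]
    · by_cases h2 : x ^ 2 ≤ b ^ 2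
      · left
        rw [div_le_div_iff₀ (by positivity) (by positivity)]
        nlinarith [mul_le_mul_of_nonneg_left h2 hb.le, mul_nonneg hb.le (sq_nonneg r), mul_nonneg hb.le (sq_nonneg b)]
      · right
        push Not at h1 h2
        have h3 : x ^ 2 ≤ 4 * (x - r) ^ 2 := by
          have h5 := abs_lt_of_sq_lt_sq (a := 2 * r) (b := |x|) (by rw [sq_abs]; nlinarith) (abs_nonneg x)
          have h4 : |x| ≤ 2 * |x - r| := by
            have := abs_sub_abs_le_abs_sub x r
            have : 2 * |r| < |x| := by
              have h6 : |2 * r| < |x| := h5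
              rw [abs_mul] at h6; simpa using h6
            linarith
          have := mul_self_le_mul_self (abs_nonneg x) h4
          nlinarith [sq_abs x, sq_abs (x - r)]
        rw [div_le_div_iff₀ (by positivity) (by positivity)]
        have : a * (b ^ 2 + x ^ 2) ≤ b * (2 * x ^ 2) := by gcongr; linarith
        nlinarith [mul_le_mul_of_nonneg_left h3 hb.le, mul_nonneg hb.le (sq_nonneg a)]
  rcases key with h | h
  · calc kr a (x - r) * kr b r ≤ kr a (x - r) * (8 * kr b x) := by gcongr
      _ ≤ _ := by nlinarith [mul_pos p2 p3]
  · calc kr a (x - r) * kr b r ≤ (8 * kr b x) * kr b r := by gcongr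
      _ ≤ _ := by nlinarith [mul_pos p1 p3]

theorem kk_conv {a b : ℝ} (ha : 0 < a) (hab : a ≤ b) (x : ℝ) :
    ∫⁻ r, kk a (x - r) * kk b r ≤ ENNReal.ofReal (16 * Real.pi) * kk b x := by
  have hb : 0 < b := ha.trans_le hab
  calc ∫⁻ r, kk a (x - r) * kk b r ≤ ∫⁻ r, ENNReal.ofReal 8 * kk b x * (kk a (x - r) + kk b r) := by
        apply lintegral_mono
        intro r
        unfold kk
        dsimp only
        rw [← ENNReal.ofReal_mul (kr_pos ha _).le, ← ENNReal.ofReal_add (kr_pos ha _).le (kr_pos hb _).le,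
          ← ENNReal.ofReal_mul (by norm_num), ← ENNReal.ofReal_mul (by have := kr_pos hb x; positivity)]
        exact ENNReal.ofReal_le_ofReal (kr_conv_pt ha hab x r)
    _ = ENNReal.ofReal 8 * kk b x * ((∫⁻ r, kk a (x - r)) + ∫⁻ r, kk b r) := by
        rw [lintegral_const_mul, lintegral_add_right _ (kk_measurable b)]
        have := kk_measurable a
        have := kk_measurable b
        fun_prop
    _ = ENNReal.ofReal 8 * kk b x * (ENNReal.ofReal Real.pi + ENNReal.ofReal Real.pi) := by
        rw [lintegral_sub_left_eq_self (fun y => kk a y) x, lintegral_kk ha, lintegral_kk hb]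
    _ = _ := by
        rw [← ENNReal.ofReal_add Real.pi_pos.le Real.pi_pos.le, mul_right_comm, ← ENNReal.ofReal_mul (by norm_num)]
        congr 2; ring

variable {n : ℕ}

noncomputable def Am (ρ : Measure ℝ) (i : Fin n) (u : (Fin n → ℝ) → ℝ≥0∞) (t : Fin n → ℝ) : ℝ≥0∞ :=
  ∫⁻ r, u (t + Pi.single i r) ∂ρ

noncomputable def km (a : ℝ) : Measure ℝ := volume.withDensity (kk a)

noncomputable def vm (R : ℝ) : Measure ℝ := ENNReal.ofReal R⁻¹ • volume.restrict (Icc 0 R)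

noncomputable def TT (a : Fin n → ℝ) (u : (Fin n → ℝ) → ℝ≥0∞) (t : Fin n → ℝ) : ℝ≥0∞ :=
  ∫⁻ s, u (t + s) * ∏ i, kk (a i) (s i)

instance (a : ℝ) : SFinite (km a) := by unfold km; infer_instance
instance (a : ℝ) : SFinite (vm a) := by unfold vm; infer_instance

theorem vm_prob {R : ℝ} (hR : 0 < R) : IsProbabilityMeasure (vm R) := by
  constructor
  simp [vm]
  rw [← ENNReal.ofReal_mul (by positivity)]
  simp [hR.ne']

theorem single_measurable (i : Fin n) : Measurable (fun r : ℝ => (Pi.single i r : Fin n → ℝ)) := by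
  exact (continuous_single i).measurable

theorem Am_measurable (ρ : Measure ℝ) [SFinite ρ] (i : Fin n) {u : (Fin n → ℝ) → ℝ≥0∞} (hu : Measurable u) :
    Measurable (Am ρ i u) := by
  unfold Am
  apply Measurable.lintegral_prod_right' (f := fun p : (Fin n → ℝ) × ℝ => u (p.1 + (Pi.single i p.2 : Fin n → ℝ))) (ν := ρ)
  have := single_measurable i
  fun_prop

theorem KK_measurable (a : Fin n → ℝ) : Measurable (fun s : Fin n → ℝ => ∏ i, kk (a i) (s i)) := by
  apply Finset.measurable_fun_prod
  intro i _
  exact (kk_measurable (a i)).comp (measurable_pi_apply i)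

theorem TT_measurable (a : Fin n → ℝ) {u : (Fin n → ℝ) → ℝ≥0∞} (hu : Measurable u) :
    Measurable (TT a u) := by
  unfold TT
  apply Measurable.lintegral_prod_right' (f := fun p : (Fin n → ℝ) × (Fin n → ℝ) => u (p.1 + p.2) * ∏ i, kk (a i) (p.2 i))
  have := KK_measurable a
  have h2 : Measurable (fun p : (Fin n → ℝ) × (Fin n → ℝ) => ∏ i, kk (a i) (p.2 i)) := this.comp measurable_snd
  exact (hu.comp (measurable_fst.add measurable_snd)).mul h2

theorem TT_mono (a : Fin n → ℝ) {u v : (Fin n → ℝ) → ℝ≥0∞} (h : ∀ t, u t ≤ v t) (t : Fin n → ℝ) :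
    TT a u t ≤ TT a v t := by
  unfold TT; gcongr; exact h _

theorem TT_const_mul (a : Fin n → ℝ) {u : (Fin n → ℝ) → ℝ≥0∞} (hu : Measurable u) (c : ℝ≥0∞) (t : Fin n → ℝ) :
    TT a (fun t => c * u t) t = c * TT a u t := by
  unfold TT
  rw [← lintegral_const_mul]
  · simp_rw [mul_assoc]
  · exact (hu.comp (measurable_const.add measurable_id)).mul (KK_measurable a)

theorem TT_tsum {ι : Type*} [Countable ι] (a : Fin n → ℝ) {u : ι → (Fin n → ℝ) → ℝ≥0∞}
    (hu : ∀ α, Measurable (u α)) (t : Fin n → ℝ) :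
    TT a (fun t => ∑' α, u α t) t = ∑' α, TT a (u α) t := by
  unfold TT
  rw [← lintegral_tsum]
  · simp_rw [ENNReal.tsum_mul_right]
  · intro α
    exact (((hu α).comp (measurable_const.add measurable_id)).mul (KK_measurable a)).aemeasurable

theorem Am_mono (ρ : Measure ℝ) (i : Fin n) {u v : (Fin n → ℝ) → ℝ≥0∞} (h : ∀ t, u t ≤ v t) (t : Fin n → ℝ) :
    Am ρ i u t ≤ Am ρ i v t := by
  unfold Am; gcongr; exact h _

theorem TT_Am (a : Fin n → ℝ) (ρ : Measure ℝ) [SFinite ρ] (i : Fin n) {u : (Fin n → ℝ) → ℝ≥0∞} (hu : Measurable u)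
    (t : Fin n → ℝ) : TT a (Am ρ i u) t = Am ρ i (TT a u) t := by
  unfold TT Am
  have hs := single_measurable i
  have hK := KK_measurable a
  have hK2 : Measurable (fun p : (Fin n → ℝ) × ℝ => ∏ i, kk (a i) (p.1 i)) := hK.comp measurable_fst
  have : ∀ s : Fin n → ℝ, (∫⁻ r, u (t + s + Pi.single i r) ∂ρ) * ∏ i, kk (a i) (s i)
    = ∫⁻ r, u (t + s + Pi.single i r) * ∏ i, kk (a i) (s i) ∂ρ := by
    intro s
    rw [lintegral_mul_const]
    fun_prop
  simp_rw [this]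
  rw [lintegral_lintegral_swap]
  · congr 1; ext r; congr 1; ext s
    rw [add_right_comm]
  · apply Measurable.aemeasurable
    exact (hu.comp ((measurable_const.add measurable_fst).add (hs.comp measurable_snd))).mul hK2

theorem TT_shift_eq (a : Fin n → ℝ) (u : (Fin n → ℝ) → ℝ≥0∞) (t h : Fin n → ℝ) :
    TT a u (t + h) = ∫⁻ s, u (t + s) * ∏ i, kk (a i) (s i - h i) := by
  unfold TT
  rw [← lintegral_add_right_eq_self (fun s => u (t + s) * ∏ i, kk (a i) (s i - h i)) h]
  congr 1; ext s
  simp only [Pi.add_apply, add_sub_cancel_right]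
  rw [add_assoc, add_comm h s]

theorem TT_shift {a : Fin n → ℝ} (ha : ∀ i, 0 < a i) (u : (Fin n → ℝ) → ℝ≥0∞) (t h : Fin n → ℝ) :
    TT a u (t + h) ≤ (∏ i, ENNReal.ofReal (2 * (1 + (h i / a i) ^ 2))) * TT a u t := by
  rw [TT_shift_eq]
  unfold TT
  calc _ ≤ ∫⁻ s, (∏ i, ENNReal.ofReal (2 * (1 + (h i / a i) ^ 2))) * (u (t + s) * ∏ i, kk (a i) (s i)) := by
        apply lintegral_mono
        intro s
        dsimp only
        rw [mul_left_comm, ← Finset.prod_mul_distrib]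
        gcongr with i
        exact kk_shift (ha i) _ _
    _ = _ := by
        rw [lintegral_const_mul']
        exact ENNReal.prod_ne_top (fun i _ => ENNReal.ofReal_ne_top)

theorem Am_TT {a : Fin n → ℝ} (i : Fin n) {b : ℝ} (ha : 0 < a i) (hab : a i ≤ b)
    {u : (Fin n → ℝ) → ℝ≥0∞} (hu : Measurable u) (t : Fin n → ℝ) :
    Am (km b) i (TT a u) t ≤ ENNReal.ofReal (16 * Real.pi) * TT (Function.update a i b) u t := by
  unfold Am
  simp_rw [TT_shift_eq]
  unfold km
  rw [lintegral_withDensity_eq_lintegral_mul₀' (kk_measurable b).aemeasurable]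
  swap
  · apply Measurable.aemeasurable
    apply Measurable.lintegral_prod_right' (f := fun p : ℝ × (Fin n → ℝ) => u (t + p.2) * ∏ j, kk (a j) (p.2 j - (Pi.single i p.1 : Fin n → ℝ) j))
    apply Measurable.mul
    · exact hu.comp (measurable_const.add measurable_snd)
    · apply Finset.measurable_fun_prod
      intro j _
      apply (kk_measurable (a j)).comp
      exact ((measurable_pi_apply j).comp measurable_snd).sub ((measurable_pi_apply j).comp ((single_measurable i).comp measurable_fst))
  have hprod : ∀ (r : ℝ) (s : Fin n → ℝ), ∏ j, kk (a j) (s j - (Pi.single i r : Fin n → ℝ) j) =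
      kk (a i) (s i - r) * ∏ j ∈ Finset.univ.erase i, kk (a j) (s j) := by
    intro r s
    rw [← Finset.mul_prod_erase _ _ (Finset.mem_univ i)]
    congr 1
    · simp
    · apply Finset.prod_congr rfl
      intro j hj
      rw [Pi.single_eq_of_ne (Finset.ne_of_mem_erase hj), sub_zero]
  have hprod2 : ∀ s : Fin n → ℝ, ∏ j, kk (Function.update a i b j) (s j) =
      kk b (s i) * ∏ j ∈ Finset.univ.erase i, kk (a j) (s j) := by
    intro s
    rw [← Finset.mul_prod_erase _ _ (Finset.mem_univ i)]
    congr 1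
    · simp
    · apply Finset.prod_congr rfl
      intro j hj
      rw [Function.update_of_ne (Finset.ne_of_mem_erase hj)]
  simp_rw [Pi.mul_apply, hprod]
  have hE : Measurable (fun s : Fin n → ℝ => ∏ j ∈ Finset.univ.erase i, kk (a j) (s j)) := by
    apply Finset.measurable_fun_prod
    intro j _
    exact (kk_measurable (a j)).comp (measurable_pi_apply j)
  have hu' : Measurable (fun s => u (t + s)) := hu.comp (measurable_const.add measurable_id)
  have hka : Measurable (fun p : ℝ × (Fin n → ℝ) => kk (a i) (p.2 i - p.1)) := by
    apply (kk_measurable (a i)).comp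
    exact ((measurable_pi_apply i).comp measurable_snd).sub measurable_fst
  have hka2 : ∀ r, Measurable (fun s : Fin n → ℝ => kk (a i) (s i - r)) := fun r =>
    (kk_measurable (a i)).comp ((measurable_pi_apply i).sub measurable_const)
  have hkb := kk_measurable b
  have step1 : ∀ r, kk b r * ∫⁻ s, u (t + s) * (kk (a i) (s i - r) * ∏ j ∈ Finset.univ.erase i, kk (a j) (s j))
      = ∫⁻ s, kk b r * (u (t + s) * (kk (a i) (s i - r) * ∏ j ∈ Finset.univ.erase i, kk (a j) (s j))) := by
    intro r
    rw [lintegral_const_mul]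
    exact hu'.mul ((hka2 r).mul hE)
  simp_rw [step1]
  rw [lintegral_lintegral_swap]
  swap
  · apply Measurable.aemeasurable
    exact (hkb.comp measurable_fst).mul ((hu'.comp measurable_snd).mul (hka.mul (hE.comp measurable_snd)))
  unfold TT
  rw [← lintegral_const_mul' _ _ ENNReal.ofReal_ne_top]
  apply lintegral_mono
  intro s
  dsimp only
  rw [hprod2]
  have : ∀ r, kk b r * (u (t + s) * (kk (a i) (s i - r) * ∏ j ∈ Finset.univ.erase i, kk (a j) (s j)))
      = (u (t + s) * ∏ j ∈ Finset.univ.erase i, kk (a j) (s j)) * (kk (a i) (s i - r) * kk b r) := by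
    intro r; ring
  simp_rw [this]
  rw [lintegral_const_mul]
  · calc _ ≤ (u (t + s) * ∏ j ∈ Finset.univ.erase i, kk (a j) (s j)) * (ENNReal.ofReal (16 * Real.pi) * kk b (s i)) := by
          gcongr; exact kk_conv ha hab _
      _ = _ := by ring
  · exact ((kk_measurable (a i)).comp (measurable_const.sub measurable_id)).mul hkb

theorem vm_le {R : ℝ} (hR : 0 < R) : vm R ≤ (2 : ℝ≥0∞) • km R := by
  unfold vm km
  rw [← withDensity_one (μ := volume.restrict (Icc (0:ℝ) R)), ← withDensity_indicator measurableSet_Icc,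
    ← withDensity_smul _ (by exact measurable_const.indicator measurableSet_Icc), ← withDensity_smul _ (kk_measurable R)]
  apply withDensity_mono
  filter_upwards with x
  simp only [Pi.smul_apply, smul_eq_mul, indicator_apply]
  split_ifs with h
  · have : R⁻¹ ≤ 2 * kr R x := by
      rw [kr_eq hR, ← mul_div_assoc, inv_eq_one_div, div_le_div_iff₀ hR (by positivity)]
      nlinarith [h.1, h.2]
    unfold kk
    rw [← ENNReal.ofReal_ofNat 2, ← ENNReal.ofReal_mul (by norm_num)]
    simpa using ENNReal.ofReal_le_ofReal this
  · simp

theorem Am_vm_le {R : ℝ} (hR : 0 < R) (i : Fin n) (u : (Fin n → ℝ) → ℝ≥0∞) (t : Fin n → ℝ) :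
    Am (vm R) i u t ≤ 2 * Am (km R) i u t := by
  unfold Am
  calc _ ≤ ∫⁻ r, u (t + Pi.single i r) ∂((2 : ℝ≥0∞) • km R) := lintegral_mono' (vm_le hR) le_rfl
    _ = _ := by rw [lintegral_smul_measure, smul_eq_mul]

theorem prod_single_shift {a : Fin n → ℝ} (i : Fin n) (r : ℝ) :
    (∏ j, ENNReal.ofReal (2 * (1 + ((Pi.single i r : Fin n → ℝ) j / a j) ^ 2))) =
      ENNReal.ofReal (2 ^ n * (1 + (r / a i) ^ 2)) := by
  rw [← ENNReal.ofReal_prod_of_nonneg (fun j _ => by positivity), Finset.prod_mul_distrib]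
  congr 1
  simp only [Finset.prod_const, Finset.card_univ, Fintype.card_fin]
  congr 1
  rw [Finset.prod_eq_single i]
  · simp
  · intro j _ hj; simp [Pi.single_eq_of_ne hj]
  · simp

theorem TT_shift_single {a : Fin n → ℝ} (ha : ∀ i, 0 < a i) (u : (Fin n → ℝ) → ℝ≥0∞) (t : Fin n → ℝ)
    (i : Fin n) (r : ℝ) (hr : |r| ≤ a i) :
    TT a u (t + Pi.single i r) ≤ ENNReal.ofReal (2 ^ n * 2) * TT a u t := by
  refine (TT_shift ha u t _).trans ?_
  rw [prod_single_shift i r]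
  gcongr
  have : (r / a i) ^ 2 ≤ 1 := by
    rw [div_pow, div_le_one (by have := ha i; positivity)]
    exact sq_le_sq' (by linarith [(abs_le.1 hr).1]) (abs_le.1 hr).2
  linarith

theorem TT_le_Am_vm {a : Fin n → ℝ} (ha : ∀ i, 0 < a i) (u : (Fin n → ℝ) → ℝ≥0∞) (t : Fin n → ℝ)
    (i : Fin n) (R : ℝ) (hR : 0 < R) (hRa : R ≤ a i) :
    TT a u t ≤ ENNReal.ofReal (2 ^ n * 2) * Am (vm R) i (TT a u) t := by
  have := vm_prob hR
  calc TT a u t = ∫⁻ r, TT a u t ∂(vm R) := by simp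
    _ ≤ ∫⁻ r, ENNReal.ofReal (2 ^ n * 2) * TT a u (t + Pi.single i r) ∂(vm R) := by
        apply lintegral_mono_ae
        have h1 : ∀ᵐ r ∂(vm R), r ∈ Icc 0 R := by
          unfold vm
          apply Measure.ae_smul_measure
          exact ae_restrict_mem measurableSet_Icc
        filter_upwards [h1] with r hr
        have := TT_shift_single ha u (t + Pi.single i r) i (-r) (by rw [abs_neg, abs_of_nonneg hr.1]; exact hr.2.trans hRa)
        rw [add_assoc, ← Pi.single_add] at this
        simpa using this
    _ = _ := by rw [lintegral_const_mul' _ _ ENNReal.ofReal_ne_top]; rfl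

theorem TT_le_TT_Am {a : Fin n → ℝ} (ha : ∀ i, 0 < a i) {u : (Fin n → ℝ) → ℝ≥0∞} (hu : Measurable u) (t : Fin n → ℝ)
    (i : Fin n) :
    TT a u t ≤ ENNReal.ofReal (2 ^ n * 4) * TT a (Am (km (a i)) i u) t := by
  rw [TT_Am a _ i hu]
  refine (TT_le_Am_vm ha u t i (a i) (ha i) le_rfl).trans ?_
  refine (mul_le_mul_right (Am_vm_le (ha i) i _ t) _).trans ?_
  rw [← mul_assoc, ← ENNReal.ofReal_ofNat 2, ← ENNReal.ofReal_mul (by positivity)]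
  apply le_of_eq; congr 2; ring

theorem lintegral_KK {a : Fin n → ℝ} (ha : ∀ i, 0 < a i) :
    ∫⁻ s : Fin n → ℝ, ∏ i, kk (a i) (s i) = ENNReal.ofReal Real.pi ^ n := by
  have hintg : ∀ i, Integrable (kr (a i)) := fun i => by
    unfold kr
    exact (pp_integrable.comp_div (ha i).ne').const_mul _
  have h1 : ∀ s : Fin n → ℝ, ∏ i, kk (a i) (s i) = ENNReal.ofReal (∏ i, kr (a i) (s i)) := fun s => by
    unfold kk
    rw [ENNReal.ofReal_prod_of_nonneg (fun j _ => (kr_pos (ha j) _).le)]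
  have h2 : ∀ i, ∫ x, kr (a i) x = Real.pi := fun i => by
    have := lintegral_kk (ha i)
    unfold kk at this
    rw [← ofReal_integral_eq_lintegral_ofReal (hintg i) (Filter.Eventually.of_forall fun x => (kr_pos (ha i) x).le)] at this
    exact (ENNReal.ofReal_eq_ofReal_iff (integral_nonneg fun x => (kr_pos (ha i) x).le) Real.pi_pos.le).1 this
  simp_rw [h1]
  have h3 : Integrable (fun x : Fin n → ℝ => ∏ i, kr (a i) (x i)) volume := Integrable.fintype_prod hintg
  rw [← ofReal_integral_eq_lintegral_ofReal h3
    (Filter.Eventually.of_forall fun x => Finset.prod_nonneg fun i _ => (kr_pos (ha i) _).le),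
    integral_fintype_prod_volume_eq_prod (fun i => kr (a i))]
  simp_rw [h2]
  rw [ENNReal.ofReal_prod_of_nonneg (fun _ _ => Real.pi_pos.le)]
  simp

theorem lintegral_TT {a : Fin n → ℝ} (ha : ∀ i, 0 < a i) {u : (Fin n → ℝ) → ℝ≥0∞} (hu : Measurable u) :
    ∫⁻ t, TT a u t = ENNReal.ofReal Real.pi ^ n * ∫⁻ t, u t := by
  unfold TT
  have hK := KK_measurable a
  rw [lintegral_lintegral_swap]
  · have : ∀ s : Fin n → ℝ, ∫⁻ t, u (t + s) * ∏ i, kk (a i) (s i) = (∫⁻ t, u t) * ∏ i, kk (a i) (s i) := by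
      intro s
      rw [lintegral_mul_const _ (show Measurable (fun t => u (t + s)) from hu.comp (measurable_id.add measurable_const)), lintegral_add_right_eq_self (fun t => u t) s]
    simp_rw [this]
    rw [lintegral_const_mul _ hK, lintegral_KK ha, mul_comm]
  · exact ((hu.comp (measurable_fst.add measurable_snd)).mul (hK.comp measurable_snd)).aemeasurable

end S17

open MeasureTheory Metric Set
open scoped ENNReal
namespace S17

theorem cs_lint {X : Type*} [MeasurableSpace X] (ρ : Measure X) {f g : X → ℝ≥0∞} (hf : Measurable f)
    (hg : Measurable g) : (∫⁻ x, f x * g x ∂ρ) ^ 2 ≤ (∫⁻ x, f x ∂ρ) * ∫⁻ x, f x * g x ^ 2 ∂ρ := by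
  have h := ENNReal.lintegral_mul_le_Lp_mul_Lq ρ (p := 2) (q := 2) ⟨by norm_num, by norm_num, by norm_num⟩
    (f := fun x => f x ^ (1/2 : ℝ)) (g := fun x => f x ^ (1/2 : ℝ) * g x)
    (hf.pow_const _).aemeasurable ((hf.pow_const _).mul hg).aemeasurable
  have e1 : ∀ x, f x ^ (1/2:ℝ) * f x ^ (1/2:ℝ) = f x := fun x => by
    rw [← ENNReal.rpow_add_of_nonneg _ _ (by norm_num) (by norm_num)]; norm_num
  have e2 : ∫⁻ x, ((fun x => f x ^ (1/2 : ℝ)) * (fun x => f x ^ (1/2 : ℝ) * g x)) x ∂ρ = ∫⁻ x, f x * g x ∂ρ := by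
    congr 1; ext x; simp only [Pi.mul_apply]; rw [← mul_assoc, e1]
  have e3 : ∀ x, (f x ^ (1/2:ℝ)) ^ (2:ℝ) = f x := fun x => by
    rw [← ENNReal.rpow_mul]; norm_num
  have e4 : ∀ x, (f x ^ (1/2:ℝ) * g x) ^ (2:ℝ) = f x * g x ^ 2 := fun x => by
    rw [ENNReal.mul_rpow_of_nonneg _ _ (by norm_num), e3]; norm_cast
  rw [e2] at h
  simp_rw [e3, e4] at h
  calc _ ≤ _ := pow_le_pow_left' h 2
    _ = _ := by
      rw [mul_pow, ← ENNReal.rpow_natCast, ← ENNReal.rpow_natCast, ← ENNReal.rpow_mul, ← ENNReal.rpow_mul]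
      norm_num

variable {n : ℕ} {Ω : Type*} [MeasurableSpace Ω]

noncomputable def GG (m : Measure Ω) (Y : Ω → Fin n → ℝ) (F : Ω → ℂ) (t : Fin n → ℝ) : ℂ :=
  ∫ ω, F ω * ee (t ⬝ᵥ Y ω) ∂m

section
variable {m : Measure Ω} {Y : Ω → Fin n → ℝ}

theorem dot_measurable (hY : Measurable Y) (t : Fin n → ℝ) : Measurable (fun ω => t ⬝ᵥ Y ω) := by
  unfold dotProduct
  apply Finset.measurable_fun_sum
  intro i _
  exact measurable_const.mul ((measurable_pi_apply i).comp hY)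

theorem GG_integrable (hY : Measurable Y) {F : Ω → ℂ} (hF : Integrable F m) (t : Fin n → ℝ) :
    Integrable (fun ω => F ω * ee (t ⬝ᵥ Y ω)) m := by
  apply hF.mul_bdd (c := 1)
  · exact (ee_continuous.measurable.comp (dot_measurable hY t)).aestronglyMeasurable
  · exact Filter.Eventually.of_forall fun ω => by simp

theorem GG_continuous (hY : Measurable Y) {F : Ω → ℂ} (hF : Integrable F m) : Continuous (GG m Y F) := by
  unfold GG
  apply continuous_of_dominated (bound := fun ω => ‖F ω‖)
  · intro t; exact (GG_integrable hY hF t).aestronglyMeasurable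
  · intro t; exact Filter.Eventually.of_forall fun ω => by simp
  · exact hF.norm
  · refine Filter.Eventually.of_forall fun ω => ?_
    have := ee_continuous
    unfold dotProduct
    fun_prop

theorem GG_meas (hY : Measurable Y) {F : Ω → ℂ} (hF : Integrable F m) :
    Measurable (fun t => ‖GG m Y F t‖ₑ ^ 2) := by
  have := (GG_continuous hY hF).measurable
  fun_prop

theorem GG_fubini [SFinite m] {X : Type*} [MeasurableSpace X] (ρ : Measure X) [SFinite ρ] {k : X → ℂ}
    (hk : Integrable k ρ) {s : X → Fin n → ℝ} (hs : Measurable s) (hY : Measurable Y) {F : Ω → ℂ}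
    (hF : Integrable F m) (t : Fin n → ℝ) :
    ∫ x, k x * GG m Y F (t + s x) ∂ρ = ∫ ω, F ω * ee (t ⬝ᵥ Y ω) * (∫ x, ee (s x ⬝ᵥ Y ω) * k x ∂ρ) ∂m := by
  unfold GG
  have h1 : ∀ x, k x * ∫ ω, F ω * ee ((t + s x) ⬝ᵥ Y ω) ∂m
      = ∫ ω, k x * F ω * (ee (t ⬝ᵥ Y ω) * ee (s x ⬝ᵥ Y ω)) ∂m := by
    intro x
    rw [← integral_const_mul]
    congr 1; ext ω
    rw [add_dotProduct, ee_add]; ring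
  simp_rw [h1]
  rw [integral_integral_swap]
  · congr 1; ext ω
    rw [← integral_const_mul]
    congr 1; ext x; ring
  · apply (hk.mul_prod hF).mul_bdd (c := 1)
    · apply Measurable.aestronglyMeasurable
      have h2 : Measurable (fun p : X × Ω => s p.1 ⬝ᵥ Y p.2) := by
        unfold dotProduct
        apply Finset.measurable_fun_sum
        intro i _
        exact ((measurable_pi_apply i).comp (hs.comp measurable_fst)).mul ((measurable_pi_apply i).comp (hY.comp measurable_snd))
      exact (ee_continuous.measurable.comp ((dot_measurable hY t).comp measurable_snd)).mul
        (ee_continuous.measurable.comp h2)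
    · exact Filter.Eventually.of_forall fun ω => by simp

end

noncomputable def Cv : ℝ := vv_bound.choose
theorem Cv_pos : 0 < Cv := vv_bound.choose_spec.1
theorem Cv_spec (x : ℝ) : |vv x| ≤ Cv * pp x := vv_bound.choose_spec.2 x

noncomputable def va (a c r : ℝ) : ℂ := ee (-(r * c)) * ((a⁻¹ * vv (r / a) : ℝ) : ℂ)

theorem va_continuous (a c : ℝ) : Continuous (va a c) := by
  unfold va
  have := vv_continuous
  have := ee_continuous
  fun_prop

theorem va_norm {a : ℝ} (ha : 0 < a) (c r : ℝ) : ‖va a c r‖ ≤ Cv * kr a r := by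
  unfold va kr
  rw [norm_mul, norm_ee, one_mul, Complex.norm_real, Real.norm_eq_abs, abs_mul, abs_of_pos (inv_pos.2 ha)]
  have := Cv_spec (r / a)
  calc a⁻¹ * |vv (r/a)| ≤ a⁻¹ * (Cv * pp (r/a)) := by gcongr
    _ = _ := by ring

theorem va_enorm {a : ℝ} (ha : 0 < a) (c r : ℝ) : ‖va a c r‖ₑ ≤ ENNReal.ofReal Cv * kk a r := by
  unfold kk
  rw [← ENNReal.ofReal_mul Cv_pos.le, ← ofReal_norm]
  exact ENNReal.ofReal_le_ofReal (va_norm ha c r)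

theorem kr_integrable {a : ℝ} (ha : 0 < a) : Integrable (kr a) := by
  unfold kr
  exact (pp_integrable.comp_div ha.ne').const_mul _

theorem va_integrable {a : ℝ} (ha : 0 < a) (c : ℝ) : Integrable (va a c) :=
  ((kr_integrable ha).const_mul Cv).mono' (va_continuous a c).aestronglyMeasurable
    (Filter.Eventually.of_forall fun r => va_norm ha c r)

theorem scale_int {a : ℝ} (ha : 0 < a) (v : ℝ → ℝ) (l : ℝ) :
    ∫ r, ee (r * l) * ((a⁻¹ * v (r / a) : ℝ) : ℂ) = ∫ x, ee (x * (a * l)) * (v x : ℂ) := by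
  have h := Measure.integral_comp_div (fun x => ee (x * (a * l)) * ((a⁻¹ * v x : ℝ) : ℂ)) a
  have e : ∀ x : ℝ, x / a * (a * l) = x * l := fun x => by field_simp
  simp_rw [e] at h
  rw [h, ← integral_smul]
  congr 1; ext x
  rw [abs_of_pos ha, Complex.real_smul]
  push_cast
  have : (a : ℂ) ≠ 0 := by exact_mod_cast ha.ne'
  field_simp

theorem va_spec {a : ℝ} (ha : 0 < a) (c y : ℝ) (h : |a * (y - c)| ≤ 1) :
    ∫ r, ee (r * y) * va a c r = 1 := by
  unfold va
  have : ∀ r : ℝ, ee (r * y) * (ee (-(r * c)) * ((a⁻¹ * vv (r / a) : ℝ) : ℂ)) =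
      ee (r * (y - c)) * ((a⁻¹ * vv (r / a) : ℝ) : ℂ) := by
    intro r
    rw [← mul_assoc, ← ee_add]; congr 2; ring
  simp_rw [this]
  rw [scale_int ha, vv_spec _ h]

section
variable {m : Measure Ω} {Y : Ω → Fin n → ℝ}

/-- one-dimensional reproducing inequality -/
theorem repro1 [SFinite m] (hY : Measurable Y) {F : Ω → ℂ} (hF : Integrable F m) (i : Fin n) {A c : ℝ}
    (hA : 0 < A) (hs : ∀ ω, F ω ≠ 0 → |A * (Y ω i - c)| ≤ 1) (t : Fin n → ℝ) :
    ‖GG m Y F t‖ₑ ^ 2 ≤ ENNReal.ofReal (Cv ^ 2 * Real.pi) * Am (km A) i (fun t => ‖GG m Y F t‖ₑ ^ 2) t := by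
  have hf := GG_fubini (m := m) volume (va_integrable hA c) (single_measurable i) hY hF t
  have e : ∀ ω, F ω * ee (t ⬝ᵥ Y ω) * (∫ x, ee ((Pi.single i x : Fin n → ℝ) ⬝ᵥ Y ω) * va A c x) =
      F ω * ee (t ⬝ᵥ Y ω) := by
    intro ω
    by_cases h0 : F ω = 0
    · simp [h0]
    simp_rw [single_dotProduct]
    rw [va_spec hA c _ (hs ω h0), mul_one]
  simp_rw [e] at hf
  have hG := GG_meas (m := m) hY hF
  have hGc := (GG_continuous (m := m) hY hF).measurable
  have hsm := single_measurable i
  have hGs : Measurable (fun r => ‖GG m Y F (t + Pi.single i r)‖ₑ) := by fun_prop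
  have hkm := kk_measurable A
  have hle : ‖GG m Y F t‖ₑ ≤ ENNReal.ofReal Cv * ∫⁻ r, kk A r * ‖GG m Y F (t + Pi.single i r)‖ₑ := by
    have : GG m Y F t = ∫ x, va A c x * GG m Y F (t + Pi.single i x) := hf.symm
    rw [this]
    refine (enorm_integral_le_lintegral_enorm _).trans ?_
    rw [← lintegral_const_mul' _ _ ENNReal.ofReal_ne_top]
    apply lintegral_mono
    intro r
    dsimp only
    rw [enorm_mul, ← mul_assoc]
    gcongr
    exact va_enorm hA c r
  have hcs := cs_lint volume hkm hGs
  rw [lintegral_kk hA] at hcs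
  have hAm : Am (km A) i (fun t => ‖GG m Y F t‖ₑ ^ 2) t = ∫⁻ r, kk A r * ‖GG m Y F (t + Pi.single i r)‖ₑ ^ 2 := by
    have h2 : Measurable (fun r => ‖GG m Y F (t + Pi.single i r)‖ₑ ^ 2) := hGs.pow_const 2
    unfold Am km
    rw [lintegral_withDensity_eq_lintegral_mul₀ hkm.aemeasurable h2.aemeasurable]
    simp only [Pi.mul_apply]
  rw [hAm, ENNReal.ofReal_mul (sq_nonneg _), ENNReal.ofReal_pow Cv_pos.le, mul_assoc]
  refine (pow_le_pow_left' hle 2).trans ?_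
  rw [mul_pow]
  exact mul_le_mul_right hcs _

/-- n-dimensional reproducing inequality -/
theorem repron [SFinite m] (hY : Measurable Y) {F : Ω → ℂ} (hF : Integrable F m) {A c : Fin n → ℝ}
    (hA : ∀ i, 0 < A i) (hs : ∀ ω, F ω ≠ 0 → ∀ i, |A i * (Y ω i - c i)| ≤ 1) (t : Fin n → ℝ) :
    ‖GG m Y F t‖ₑ ^ 2 ≤ ENNReal.ofReal (Cv ^ 2 * Real.pi) ^ n * TT A (fun t => ‖GG m Y F t‖ₑ ^ 2) t := by
  have hki : Integrable (fun s : Fin n → ℝ => ∏ i, va (A i) (c i) (s i)) :=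
    Integrable.fintype_prod (fun i => va_integrable (hA i) (c i))
  have hf := GG_fubini (m := m) volume hki measurable_id hY hF t
  have e : ∀ ω, F ω * ee (t ⬝ᵥ Y ω) * (∫ x : Fin n → ℝ, ee (id x ⬝ᵥ Y ω) * ∏ i, va (A i) (c i) (x i)) =
      F ω * ee (t ⬝ᵥ Y ω) := by
    intro ω
    by_cases h0 : F ω = 0
    · simp [h0]
    have : ∀ x : Fin n → ℝ, ee (id x ⬝ᵥ Y ω) * ∏ i, va (A i) (c i) (x i) = ∏ i, (ee (x i * Y ω i) * va (A i) (c i) (x i)) := by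
      intro x
      rw [Finset.prod_mul_distrib]
      congr 1
      unfold ee dotProduct
      rw [← Complex.exp_sum]
      congr 1
      push_cast
      rw [Finset.mul_sum, Finset.sum_mul]
      rfl
    simp_rw [this]
    rw [integral_fintype_prod_volume_eq_prod (fun i r => ee (r * Y ω i) * va (A i) (c i) r)]
    rw [Finset.prod_eq_one, mul_one]
    intro i _
    exact va_spec (hA i) _ _ (hs ω h0 i)
  simp_rw [e] at hf
  have hGc := (GG_continuous (m := m) hY hF).measurable
  have hGs : Measurable (fun r => ‖GG m Y F (t + r)‖ₑ) := by fun_prop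
  have hkm := KK_measurable A
  have hle : ‖GG m Y F t‖ₑ ≤ ENNReal.ofReal Cv ^ n * ∫⁻ r : Fin n → ℝ, (∏ i, kk (A i) (r i)) * ‖GG m Y F (t + r)‖ₑ := by
    have : GG m Y F t = ∫ x : Fin n → ℝ, (∏ i, va (A i) (c i) (x i)) * GG m Y F (t + x) := by
      rw [show (∫ x : Fin n → ℝ, (∏ i, va (A i) (c i) (x i)) * GG m Y F (t + x)) = ∫ x : Fin n → ℝ, (∏ i, va (A i) (c i) (x i)) * GG m Y F (t + id x) from rfl, hf]; rfl
    rw [this]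
    refine (enorm_integral_le_lintegral_enorm _).trans ?_
    rw [← lintegral_const_mul' _ _ (ENNReal.pow_ne_top ENNReal.ofReal_ne_top)]
    apply lintegral_mono
    intro r
    dsimp only
    rw [enorm_mul, ← mul_assoc]
    gcongr
    rw [← ofReal_norm, norm_prod, ENNReal.ofReal_prod_of_nonneg (fun _ _ => norm_nonneg _)]
    calc _ ≤ ∏ i, ENNReal.ofReal Cv * kk (A i) (r i) := by
          gcongr with i
          rw [ofReal_norm]; exact va_enorm (hA i) _ _
      _ = _ := by rw [Finset.prod_mul_distrib]; simp
  calc _ ≤ _ := pow_le_pow_left' hle 2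
    _ ≤ (ENNReal.ofReal Cv ^ n) ^ 2 * ((∫⁻ r : Fin n → ℝ, (∏ i, kk (A i) (r i))) * ∫⁻ r : Fin n → ℝ, (∏ i, kk (A i) (r i)) * ‖GG m Y F (t + r)‖ₑ ^ 2) := by
        rw [mul_pow]; gcongr; exact cs_lint _ hkm hGs
    _ = _ := by
        rw [lintegral_KK hA]
        unfold TT
        rw [ENNReal.ofReal_mul (by positivity), ENNReal.ofReal_pow Cv_pos.le, mul_pow, ← pow_mul, ← pow_mul, mul_comm n 2, mul_assoc]
        simp_rw [mul_comm]
end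

end S17

open MeasureTheory Metric Set
open scoped ENNReal
namespace S17

variable {n : ℕ} {Ω : Type*} [MeasurableSpace Ω]

theorem single_cont (i : Fin n) : Continuous (fun r : ℝ => (Pi.single i r : Fin n → ℝ)) := by
  exact continuous_single (A := fun _ : Fin n => ℝ) i

noncomputable def Cw : ℝ := ww_upper.choose
theorem Cw_pos : 0 < Cw := ww_upper.choose_spec.1
theorem Cw_spec (x : ℝ) : ww x ≤ Cw * pp x := ww_upper.choose_spec.2 x

noncomputable def wa (a r : ℝ) : ℝ := a⁻¹ * ww (r / a)

theorem wa_continuous (a : ℝ) : Continuous (wa a) := by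
  unfold wa
  have := ww_continuous
  fun_prop

theorem wa_nonneg {a : ℝ} (ha : 0 < a) (r : ℝ) : 0 ≤ wa a r := by
  unfold wa; have := ww_nonneg (r / a); positivity

theorem wa_le {a : ℝ} (ha : 0 < a) (r : ℝ) : wa a r ≤ Cw * kr a r := by
  unfold wa kr
  calc a⁻¹ * ww (r/a) ≤ a⁻¹ * (Cw * pp (r/a)) := by gcongr; exact Cw_spec _
    _ = _ := by ring

theorem le_wa {a : ℝ} (ha : 0 < a) (r : ℝ) : kr a r ≤ 20 * wa a r := by
  unfold wa kr
  calc a⁻¹ * pp (r/a) ≤ a⁻¹ * (20 * ww (r/a)) := by gcongr; exact ww_lower _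
    _ = _ := by ring

theorem wa_integrable {a : ℝ} (ha : 0 < a) : Integrable (wa a) := by
  unfold wa
  exact (ww_integrable.comp_div ha.ne').const_mul _

noncomputable def pc (Y : Ω → Fin n → ℝ) (i : Fin n) (a : ℝ) (p : ℤ) (F : Ω → ℂ) : Ω → ℂ :=
  indicator {ω | ⌊a * Y ω i⌋ = p} F

theorem pc_set_meas {Y : Ω → Fin n → ℝ} (hY : Measurable Y) (i : Fin n) (a : ℝ) (p : ℤ) :
    MeasurableSet {ω | ⌊a * Y ω i⌋ = p} := by
  have : Measurable (fun ω => ⌊a * Y ω i⌋) := Int.measurable_floor.comp (measurable_const.mul ((measurable_pi_apply i).comp hY))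
  exact this (measurableSet_singleton p)

section
variable {m : Measure Ω} {Y : Ω → Fin n → ℝ}

theorem pc_integrable (hY : Measurable Y) {F : Ω → ℂ} (hF : Integrable F m) (i : Fin n) (a : ℝ) (p : ℤ) :
    Integrable (pc Y i a p F) m := hF.indicator (pc_set_meas hY i a p)

theorem GG_sum (hY : Measurable Y) {ι : Type*} (S : Finset ι) {F : ι → Ω → ℂ} (hF : ∀ p ∈ S, Integrable (F p) m)
    (t : Fin n → ℝ) : GG m Y (fun ω => ∑ p ∈ S, F p ω) t = ∑ p ∈ S, GG m Y (F p) t := by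
  unfold GG
  rw [← integral_finsetSum _ (fun p hp => GG_integrable hY (hF p hp) t)]
  simp_rw [Finset.sum_mul]

theorem GG_norm_le (F : Ω → ℂ) (t : Fin n → ℝ) : ‖GG m Y F t‖ ≤ ∫ ω, ‖F ω‖ ∂m := by
  unfold GG
  refine (norm_integral_le_integral_norm _).trans ?_
  simp

theorem GG_prod [SFinite m] (F1 F2 : Ω → ℂ) (t : Fin n → ℝ) :
    GG m Y F1 t * (starRingEnd ℂ) (GG m Y F2 t) =
      GG (m.prod m) (fun p : Ω × Ω => Y p.1 - Y p.2) (fun p => F1 p.1 * (starRingEnd ℂ) (F2 p.2)) t := by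
  unfold GG
  rw [← integral_conj, ← integral_prod_mul]
  congr 1; ext p
  rw [map_mul, conj_ee, dotProduct_sub, sub_eq_add_neg, ee_add]
  ring

theorem cross_zero [SFinite m] (hY : Measurable Y) {F1 F2 : Ω → ℂ} (hF1 : Integrable F1 m) (hF2 : Integrable F2 m)
    (i : Fin n) {a : ℝ} (ha : 0 < a) (hs : ∀ ω ω', F1 ω ≠ 0 → F2 ω' ≠ 0 → 1 ≤ |a * (Y ω i - Y ω' i)|) (t : Fin n → ℝ) :
    ∫ r, (wa a r : ℂ) * (GG m Y F1 (t + Pi.single i r) * (starRingEnd ℂ) (GG m Y F2 (t + Pi.single i r))) = 0 := by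
  simp_rw [GG_prod]
  have hY2 : Measurable (fun p : Ω × Ω => Y p.1 - Y p.2) := (hY.comp measurable_fst).sub (hY.comp measurable_snd)
  have hc2 : Integrable (fun ω => (starRingEnd ℂ) (F2 ω)) m := by
    have := (Complex.conjCLE.toContinuousLinearMap).integrable_comp hF2
    exact this
  have hk : Integrable (fun r => (wa a r : ℂ)) := (wa_integrable ha).ofReal
  rw [GG_fubini volume hk (single_measurable i) hY2 (hF1.mul_prod hc2) t]
  apply integral_eq_zero_of_ae
  refine Filter.Eventually.of_forall fun p => ?_
  simp only [Pi.zero_apply]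
  by_cases h1 : F1 p.1 = 0
  · simp [h1]
  by_cases h2 : F2 p.2 = 0
  · simp [h2]
  simp_rw [single_dotProduct]
  unfold wa
  rw [scale_int ha, ww_spec _ (by simpa using hs p.1 p.2 h1 h2), mul_zero]

theorem orth_real [SFinite m] (hY : Measurable Y) {F : Ω → ℂ} (hF : Integrable F m) (i : Fin n) {a : ℝ}
    (ha : 0 < a) (S : Finset ℤ) (hS : ∀ ω, F ω ≠ 0 → ⌊a * Y ω i⌋ ∈ S) (t : Fin n → ℝ) :
    ∫ r, wa a r * ‖GG m Y F (t + Pi.single i r)‖ ^ 2 ≤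
      3 * ∑ p ∈ S, ∫ r, wa a r * ‖GG m Y (pc Y i a p F) (t + Pi.single i r)‖ ^ 2 := by
  set g : ℤ → ℝ → ℂ := fun p r => GG m Y (pc Y i a p F) (t + Pi.single i r) with hg
  have hFp := fun p => pc_integrable (m := m) hY hF i a p
  have hFs : F = fun ω => ∑ p ∈ S, pc Y i a p F ω := by
    ext ω
    unfold pc
    by_cases h0 : F ω = 0
    · simp [indicator_apply, h0]
    · rw [Finset.sum_eq_single_of_mem _ (hS ω h0)]
      · simp
      · intro q _ hq
        rw [indicator_of_notMem]
        simpa using hq.symm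
  have hGs : ∀ r : ℝ, GG m Y F (t + Pi.single i r) = ∑ p ∈ S, g p r := by
    intro r
    conv_lhs => rw [hFs]
    exact GG_sum hY S (fun p _ => hFp p) _
  have hgc : ∀ p, Continuous (g p) := fun p =>
    (GG_continuous hY (hFp p)).comp (continuous_const.add (single_cont i))
  have hgb : ∀ p r, ‖g p r‖ ≤ ∫ ω, ‖pc Y i a p F ω‖ ∂m := fun p r => GG_norm_le _ _
  have hintg : ∀ p q, Integrable (fun r => (wa a r : ℂ) * (g p r * (starRingEnd ℂ) (g q r))) := by
    intro p q
    apply (wa_integrable ha).ofReal.mul_bdd (c := (∫ ω, ‖pc Y i a p F ω‖ ∂m) * (∫ ω, ‖pc Y i a q F ω‖ ∂m))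
    · exact ((hgc p).mul (Complex.continuous_conj.comp (hgc q))).aestronglyMeasurable
    · refine Filter.Eventually.of_forall fun r => ?_
      rw [norm_mul, RCLike.norm_conj]
      exact mul_le_mul (hgb p r) (hgb q r) (norm_nonneg _) ((norm_nonneg _).trans (hgb p r))
  have hint2 : ∀ p q, Integrable (fun r => wa a r * (g p r * (starRingEnd ℂ) (g q r)).re) := by
    intro p q
    have := (hintg p q).re
    refine this.congr (Filter.Eventually.of_forall fun r => ?_)
    simp
  have hsq : ∀ z : ℂ, ‖z‖ ^ 2 = (z * (starRingEnd ℂ) z).re := by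
    intro z; rw [Complex.mul_conj, Complex.normSq_eq_norm_sq]; norm_cast
  set x : ℤ → ℝ := fun p => ∫ r, wa a r * ‖g p r‖ ^ 2 with hx
  have hxn : ∀ p, 0 ≤ x p := fun p => integral_nonneg fun r => mul_nonneg (wa_nonneg ha r) (sq_nonneg _)
  have hdiag : ∀ p, Integrable (fun r => wa a r * ‖g p r‖ ^ 2) := by
    intro p; simp_rw [hsq]; exact hint2 p p
  have hcross : ∀ p q, ∫ r, wa a r * (g p r * (starRingEnd ℂ) (g q r)).re ≤
      if |p - q| ≤ 1 then (x p + x q) / 2 else 0 := by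
    intro p q
    split_ifs with h
    · have : (x p + x q) / 2 = ∫ r, (wa a r * ‖g p r‖ ^ 2 + wa a r * ‖g q r‖ ^ 2) / 2 := by
        rw [integral_div, integral_add (hdiag p) (hdiag q)]
      rw [this]
      apply integral_mono (hint2 p q) (((hdiag p).add (hdiag q)).div_const 2)
      intro r
      simp only [Pi.add_apply]
      have h1 : (g p r * (starRingEnd ℂ) (g q r)).re ≤ ‖g p r‖ * ‖g q r‖ := by
        refine (Complex.re_le_norm _).trans ?_
        rw [norm_mul, RCLike.norm_conj]
      have h2 : (g p r * (starRingEnd ℂ) (g q r)).re ≤ (‖g p r‖ ^ 2 + ‖g q r‖ ^ 2) / 2 := by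
        nlinarith [sq_nonneg (‖g p r‖ - ‖g q r‖)]
      calc _ ≤ wa a r * ((‖g p r‖ ^ 2 + ‖g q r‖ ^ 2) / 2) := mul_le_mul_of_nonneg_left h2 (wa_nonneg ha r)
        _ = _ := by ring
    · have hz := cross_zero (m := m) hY (hFp p) (hFp q) i ha (by
        intro ω ω' h1 h2
        have e1 : ⌊a * Y ω i⌋ = p := by
          by_contra hc; exact h1 (indicator_of_notMem (s := {ω | ⌊a * Y ω i⌋ = p}) hc _)
        have e2 : ⌊a * Y ω' i⌋ = q := by
          by_contra hc; exact h2 (indicator_of_notMem (s := {ω | ⌊a * Y ω i⌋ = q}) hc _)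
        by_contra hc
        push Not at hc h
        apply absurd h
        push Not
        rw [mul_sub] at hc
        have l1 := Int.floor_le (a * Y ω i)
        have l2 := Int.lt_floor_add_one (a * Y ω i)
        have l3 := Int.floor_le (a * Y ω' i)
        have l4 := Int.lt_floor_add_one (a * Y ω' i)
        rw [e1] at l1 l2
        rw [e2] at l3 l4
        rw [abs_lt] at hc
        have k1 : ((p - q : ℤ) : ℝ) < (2 : ℤ) := by push_cast; linarith
        have k2 : ((-2 : ℤ) : ℝ) < ((p - q : ℤ) : ℝ) := by push_cast; linarith
        have k1' := Int.cast_lt.1 k1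
        have k2' := Int.cast_lt.1 k2
        rw [abs_le]; omega) t
      have h3 : ∫ r, wa a r * (g p r * (starRingEnd ℂ) (g q r)).re =
          (∫ r, (wa a r : ℂ) * (g p r * (starRingEnd ℂ) (g q r))).re := by
        have := integral_re (hintg p q)
        simp only [RCLike.re_to_complex] at this
        rw [← this]
        congr 1; ext r; simp
      rw [h3, hz]; simp
  calc ∫ r, wa a r * ‖GG m Y F (t + Pi.single i r)‖ ^ 2
      = ∫ r, ∑ p ∈ S, ∑ q ∈ S, wa a r * (g p r * (starRingEnd ℂ) (g q r)).re := by
        congr 1; ext r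
        rw [hGs, hsq, map_sum, Finset.sum_mul_sum, Complex.re_sum, Finset.mul_sum]
        simp_rw [Complex.re_sum, Finset.mul_sum]
    _ = ∑ p ∈ S, ∑ q ∈ S, ∫ r, wa a r * (g p r * (starRingEnd ℂ) (g q r)).re := by
        rw [integral_finsetSum _ (fun p _ => integrable_finsetSum _ (fun q _ => hint2 p q))]
        congr 1; ext p
        rw [integral_finsetSum _ (fun q _ => hint2 p q)]
    _ ≤ ∑ p ∈ S, ∑ q ∈ S, (if |p - q| ≤ 1 then (x p + x q) / 2 else 0) := by
        gcongr with p _ q _; exact hcross p q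
    _ = ∑ p ∈ S, ∑ q ∈ S, ((if |p - q| ≤ 1 then x p / 2 else 0) + (if |q - p| ≤ 1 then x q / 2 else 0)) := by
        congr 1; ext p; congr 1; ext q
        rw [abs_sub_comm q p]
        split_ifs
        · ring
        · ring
    _ = ∑ p ∈ S, ∑ q ∈ S, (if |p - q| ≤ 1 then x p else 0) := by
        simp_rw [Finset.sum_add_distrib]
        nth_rewrite 2 [Finset.sum_comm]
        rw [← Finset.sum_add_distrib]
        congr 1; ext p
        rw [← Finset.sum_add_distrib]
        congr 1; ext q
        split_ifs
        · ring
        · ring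
    _ ≤ ∑ p ∈ S, 3 * x p := by
        gcongr with p _
        rw [← Finset.sum_filter, Finset.sum_const, nsmul_eq_mul]
        gcongr
        · exact hxn p
        have : (S.filter (fun q => |p - q| ≤ 1)).card ≤ (Finset.Icc (p - 1) (p + 1)).card := by
          apply Finset.card_le_card
          intro q hq
          rw [Finset.mem_filter, abs_le] at hq
          rw [Finset.mem_Icc]; omega
        rw [Int.card_Icc] at this
        have h4 : (p + 1 + 1 - (p - 1)).toNat = 3 := by
          rw [show p + 1 + 1 - (p - 1) = 3 by ring]; rfl
        rw [h4] at this
        exact_mod_cast this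
    _ = _ := by rw [← Finset.mul_sum]

theorem lint_wa [SFinite m] (hY : Measurable Y) {F : Ω → ℂ} (hF : Integrable F m) (i : Fin n) {a : ℝ}
    (ha : 0 < a) (t : Fin n → ℝ) :
    ∫⁻ r, ENNReal.ofReal (wa a r) * ‖GG m Y F (t + Pi.single i r)‖ₑ ^ 2 =
      ENNReal.ofReal (∫ r, wa a r * ‖GG m Y F (t + Pi.single i r)‖ ^ 2) := by
  have hgc : Continuous (fun r => GG m Y F (t + Pi.single i r)) :=
    (GG_continuous hY hF).comp (continuous_const.add (single_cont i))
  have hg2 : Continuous (fun r => ‖GG m Y F (t + Pi.single i r)‖ ^ 2) := hgc.norm.pow 2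
  rw [ofReal_integral_eq_lintegral_ofReal]
  · congr 1; ext r
    rw [ENNReal.ofReal_mul (wa_nonneg ha r), ENNReal.ofReal_pow (norm_nonneg _), ofReal_norm]
  · apply (wa_integrable ha).mul_bdd (c := (∫ ω, ‖F ω‖ ∂m) ^ 2) hg2.aestronglyMeasurable
    refine Filter.Eventually.of_forall fun r => ?_
    rw [norm_pow, norm_norm]
    exact pow_le_pow_left₀ (norm_nonneg _) (GG_norm_le _ _) 2
  · exact Filter.Eventually.of_forall fun r => mul_nonneg (wa_nonneg ha r) (sq_nonneg _)

theorem Am_km_eq {a : ℝ} (i : Fin n) {u : (Fin n → ℝ) → ℝ≥0∞} (hu : Measurable u) (t : Fin n → ℝ) :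
    Am (km a) i u t = ∫⁻ r, kk a r * u (t + Pi.single i r) := by
  have h2 : Measurable (fun r => u (t + Pi.single i r)) := hu.comp (measurable_const.add (single_measurable i))
  unfold Am km
  rw [lintegral_withDensity_eq_lintegral_mul₀ (kk_measurable a).aemeasurable h2.aemeasurable]
  simp only [Pi.mul_apply]

theorem orth1 [SFinite m] (hY : Measurable Y) {F : Ω → ℂ} (hF : Integrable F m) (i : Fin n) {a : ℝ}
    (ha : 0 < a) (S : Finset ℤ) (hS : ∀ ω, F ω ≠ 0 → ⌊a * Y ω i⌋ ∈ S) (t : Fin n → ℝ) :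
    Am (km a) i (fun t => ‖GG m Y F t‖ₑ ^ 2) t ≤
      ENNReal.ofReal (60 * Cw) * ∑' p : ℤ, Am (km a) i (fun t => ‖GG m Y (pc Y i a p F) t‖ₑ ^ 2) t := by
  have hFp := fun p => pc_integrable (m := m) hY hF i a p
  rw [Am_km_eq i (GG_meas hY hF)]
  calc ∫⁻ r, kk a r * ‖GG m Y F (t + Pi.single i r)‖ₑ ^ 2
      ≤ ∫⁻ r, ENNReal.ofReal 20 * (ENNReal.ofReal (wa a r) * ‖GG m Y F (t + Pi.single i r)‖ₑ ^ 2) := by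
        apply lintegral_mono; intro r
        dsimp only
        rw [← mul_assoc, ← ENNReal.ofReal_mul (by norm_num)]
        gcongr
        exact ENNReal.ofReal_le_ofReal (le_wa ha r)
    _ = ENNReal.ofReal 20 * ENNReal.ofReal (∫ r, wa a r * ‖GG m Y F (t + Pi.single i r)‖ ^ 2) := by
        rw [lintegral_const_mul' _ _ ENNReal.ofReal_ne_top, lint_wa hY hF i ha]
    _ ≤ ENNReal.ofReal 20 * ENNReal.ofReal (3 * ∑ p ∈ S, ∫ r, wa a r * ‖GG m Y (pc Y i a p F) (t + Pi.single i r)‖ ^ 2) := by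
        gcongr; exact orth_real hY hF i ha S hS t
    _ = ENNReal.ofReal 60 * ∑ p ∈ S, ∫⁻ r, ENNReal.ofReal (wa a r) * ‖GG m Y (pc Y i a p F) (t + Pi.single i r)‖ₑ ^ 2 := by
        rw [ENNReal.ofReal_mul (by norm_num), ← mul_assoc, ← ENNReal.ofReal_mul (by norm_num),
          ENNReal.ofReal_sum_of_nonneg (fun p _ => integral_nonneg fun r => mul_nonneg (wa_nonneg ha r) (sq_nonneg _))]
        simp_rw [lint_wa hY (hFp _) i ha]
        norm_num
    _ ≤ ENNReal.ofReal 60 * ∑ p ∈ S, ENNReal.ofReal Cw * Am (km a) i (fun t => ‖GG m Y (pc Y i a p F) t‖ₑ ^ 2) t := by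
        gcongr with p _
        rw [Am_km_eq i (GG_meas hY (hFp p)), ← lintegral_const_mul' _ _ ENNReal.ofReal_ne_top]
        apply lintegral_mono; intro r
        dsimp only
        rw [← mul_assoc]
        unfold kk
        rw [← ENNReal.ofReal_mul Cw_pos.le]
        gcongr
        exact wa_le ha r
    _ ≤ _ := by
        rw [← Finset.mul_sum, ← mul_assoc, ← ENNReal.ofReal_mul (by norm_num)]
        gcongr
        exact ENNReal.sum_le_tsum S

end
end S17

open MeasureTheory Metric Set
open scoped ENNReal
namespace S17

variable {n : ℕ} {Ω : Type*} [MeasurableSpace Ω]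

theorem kk_le_of {a b : ℝ} (ha : 0 < a) (hab : a ≤ b) (hb2 : b ≤ 2 * a) (x : ℝ) : kk a x ≤ 4 * kk b x := by
  have hb : 0 < b := ha.trans_le hab
  unfold kk
  rw [← ENNReal.ofReal_ofNat 4, ← ENNReal.ofReal_mul (by norm_num)]
  apply ENNReal.ofReal_le_ofReal
  rw [kr_eq ha, kr_eq hb, ← mul_div_assoc, div_le_div_iff₀ (by positivity) (by positivity)]
  have h1 : b ^ 2 ≤ 4 * a ^ 2 := by nlinarith
  have h2 : b ^ 2 + x ^ 2 ≤ 4 * (a ^ 2 + x ^ 2) := by nlinarith [sq_nonneg x]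
  calc a * (b ^ 2 + x ^ 2) ≤ b * (4 * (a ^ 2 + x ^ 2)) := by gcongr
    _ = _ := by ring

theorem TT_update_le (a : Fin n → ℝ) (i : Fin n) {x y : ℝ} (hx : 0 < x) (hxy : x ≤ y) (hy : y ≤ 2 * x)
    (u : (Fin n → ℝ) → ℝ≥0∞) (t : Fin n → ℝ) :
    TT (Function.update a i x) u t ≤ 4 * TT (Function.update a i y) u t := by
  unfold TT
  rw [← lintegral_const_mul' _ _ (by norm_num)]
  apply lintegral_mono
  intro s
  dsimp only
  rw [← Finset.mul_prod_erase _ _ (Finset.mem_univ i), ← Finset.mul_prod_erase (a := i) Finset.univ (fun j => kk (Function.update a i y j) (s j)) (Finset.mem_univ i)]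
  simp only [Function.update_self]
  have : ∏ j ∈ Finset.univ.erase i, kk (Function.update a i x j) (s j) = ∏ j ∈ Finset.univ.erase i, kk (Function.update a i y j) (s j) := by
    apply Finset.prod_congr rfl
    intro j hj
    rw [Function.update_of_ne (Finset.ne_of_mem_erase hj), Function.update_of_ne (Finset.ne_of_mem_erase hj)]
  rw [this]
  calc _ ≤ u (t + s) * (4 * kk y (s i) * ∏ j ∈ Finset.univ.erase i, kk (Function.update a i y j) (s j)) := by
        gcongr; exact kk_le_of hx hxy hy _
    _ = _ := by ring

noncomputable def cO (n : ℕ) : ℝ≥0∞ := ENNReal.ofReal (2 ^ n * 4) * (ENNReal.ofReal (60 * Cw) * ENNReal.ofReal (16 * Real.pi))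
noncomputable def cR : ℝ≥0∞ := 4 * (ENNReal.ofReal (Cv ^ 2 * Real.pi) * ENNReal.ofReal (16 * Real.pi) + 1)
theorem cO_top (n : ℕ) : cO n ≠ ⊤ := by
  unfold cO; exact ENNReal.mul_ne_top ENNReal.ofReal_ne_top (ENNReal.mul_ne_top ENNReal.ofReal_ne_top ENNReal.ofReal_ne_top)
theorem cR_top : cR ≠ ⊤ := by
  unfold cR
  exact ENNReal.mul_ne_top (by norm_num) (ENNReal.add_ne_top.2 ⟨ENNReal.mul_ne_top ENNReal.ofReal_ne_top ENNReal.ofReal_ne_top, by norm_num⟩)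

noncomputable def SQ (m : Measure Ω) (Y : Ω → Fin n → ℝ) (F : Ω → ℂ) : (Fin n → ℝ) → ℝ≥0∞ :=
  fun t => ‖GG m Y F t‖ₑ ^ 2

section
variable {m : Measure Ω} {Y : Ω → Fin n → ℝ}

theorem TT_orth [SFinite m] (hY : Measurable Y) {F : Ω → ℂ} (hF : Integrable F m) (i : Fin n) {a : Fin n → ℝ}
    (ha : ∀ i, 0 < a i) {B : ℝ} (hB : ∀ ω, F ω ≠ 0 → |Y ω i| ≤ B) (t : Fin n → ℝ) :
    TT a (SQ m Y F) t ≤ cO n * ∑' p : ℤ, TT a (SQ m Y (pc Y i (a i) p F)) t := by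
  have hFp := fun p => pc_integrable (m := m) hY hF i (a i) p
  have hm : Measurable (SQ m Y F) := GG_meas hY hF
  have hmp : ∀ p, Measurable (SQ m Y (pc Y i (a i) p F)) := fun p => GG_meas hY (hFp p)
  have hS : ∀ ω, F ω ≠ 0 → ⌊a i * Y ω i⌋ ∈ Finset.Icc ⌊-(a i * B)⌋ ⌊a i * B⌋ := by
    intro ω h
    have h1 := abs_le.1 (hB ω h)
    have h2 := (ha i).le
    rw [Finset.mem_Icc]
    constructor
    · apply Int.floor_le_floor; nlinarith
    · apply Int.floor_le_floor; nlinarith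
  calc TT a (SQ m Y F) t ≤ ENNReal.ofReal (2 ^ n * 4) * TT a (Am (km (a i)) i (SQ m Y F)) t := TT_le_TT_Am ha hm t i
    _ ≤ ENNReal.ofReal (2 ^ n * 4) * TT a (fun t => ENNReal.ofReal (60 * Cw) * ∑' p : ℤ, Am (km (a i)) i (SQ m Y (pc Y i (a i) p F)) t) t := by
        gcongr
        exact TT_mono a (fun t => orth1 hY hF i (ha i) _ hS t) t
    _ = ENNReal.ofReal (2 ^ n * 4) * (ENNReal.ofReal (60 * Cw) * ∑' p : ℤ, Am (km (a i)) i (TT a (SQ m Y (pc Y i (a i) p F))) t) := by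
        rw [TT_const_mul a (Measurable.tsum fun p => Am_measurable _ i (hmp p)), TT_tsum a (fun p => Am_measurable _ i (hmp p))]
        simp_rw [TT_Am a _ i (hmp _)]
    _ ≤ ENNReal.ofReal (2 ^ n * 4) * (ENNReal.ofReal (60 * Cw) * ∑' p : ℤ, ENNReal.ofReal (16 * Real.pi) * TT a (SQ m Y (pc Y i (a i) p F)) t) := by
        gcongr with p
        have := Am_TT i (ha i) le_rfl (hmp p) t
        rwa [Function.update_eq_self] at this
    _ = _ := by
        rw [ENNReal.tsum_mul_left]; unfold cO; ring

theorem TT_repro [SFinite m] (hY : Measurable Y) {F : Ω → ℂ} (hF : Integrable F m) (i : Fin n) {a : Fin n → ℝ}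
    (ha : ∀ i, 0 < a i) {A : ℝ} (hA : a i ≤ A) (hs : ∀ ω ω', F ω ≠ 0 → F ω' ≠ 0 → |Y ω i - Y ω' i| ≤ 2 / A) (t : Fin n → ℝ) :
    TT a (SQ m Y F) t ≤ cR * TT (Function.update a i A) (SQ m Y F) t := by
  have hm : Measurable (SQ m Y F) := GG_meas hY hF
  have hA0 : 0 < A := (ha i).trans_le hA
  by_cases h0 : ∃ ω, F ω ≠ 0
  swap
  · push Not at h0
    have : SQ m Y F = fun _ => 0 := by
      ext t; unfold SQ GG; simp [h0]
    rw [this]; unfold TT; simp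
  obtain ⟨ω0, h0⟩ := h0
  by_cases h2 : a i ≤ A / 2
  · have hr := repro1 (m := m) hY hF i (A := A / 2) (c := Y ω0 i) (by positivity) (by
      intro ω hω
      rw [abs_mul, abs_of_pos (by positivity)]
      calc A / 2 * |Y ω i - Y ω0 i| ≤ A / 2 * (2 / A) := by gcongr; exact hs ω ω0 hω h0
        _ = 1 := by field_simp)
    calc TT a (SQ m Y F) t ≤ TT a (fun t => ENNReal.ofReal (Cv ^ 2 * Real.pi) * Am (km (A/2)) i (SQ m Y F) t) t :=
          TT_mono a hr t
      _ = ENNReal.ofReal (Cv ^ 2 * Real.pi) * Am (km (A/2)) i (TT a (SQ m Y F)) t := by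
          rw [TT_const_mul a (Am_measurable _ i hm), TT_Am a _ i hm]
      _ ≤ ENNReal.ofReal (Cv ^ 2 * Real.pi) * (ENNReal.ofReal (16 * Real.pi) * (4 * TT (Function.update a i A) (SQ m Y F) t)) := by
          gcongr
          refine (Am_TT i (ha i) h2 hm t).trans ?_
          gcongr
          exact TT_update_le a i (by positivity) (by linarith) (by linarith) _ _
      _ ≤ _ := by
          unfold cR
          calc _ = 4 * (ENNReal.ofReal (Cv ^ 2 * Real.pi) * ENNReal.ofReal (16 * Real.pi)) * TT (Function.update a i A) (SQ m Y F) t := by ring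
            _ ≤ _ := by gcongr; exact le_self_add
  · push Not at h2
    have := TT_update_le a i (ha i) hA (by linarith) (SQ m Y F) t
    rw [Function.update_eq_self] at this
    refine this.trans ?_
    unfold cR
    gcongr
    calc (4 : ℝ≥0∞) = 4 * 1 := by simp
      _ ≤ _ := by gcongr; exact le_add_self

/-- splitting a family in all coordinates of a finset -/
theorem split_all [SFinite m] (hY : Measurable Y) {F : Ω → ℂ} {B : ℝ} (hB : ∀ ω, F ω ≠ 0 → ∀ i, |Y ω i| ≤ B)
    {a : Fin n → ℝ} (ha : ∀ i, 0 < a i) (s : Finset (Fin n)) :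
    ∀ (ι : Type) [Countable ι] (Φ : ι → Ω → ℂ), (∀ α, Integrable (Φ α) m) → (∀ α ω, ‖Φ α ω‖ ≤ ‖F ω‖) →
    ∃ (ι' : Type) (_ : Countable ι') (Φ' : ι' → Ω → ℂ), (∀ α, Integrable (Φ' α) m) ∧ (∀ α ω, ‖Φ' α ω‖ ≤ ‖F ω‖) ∧
      (∑' α, ∫⁻ ω, ‖Φ' α ω‖ₑ ^ 2 ∂m ≤ ∑' α, ∫⁻ ω, ‖Φ α ω‖ₑ ^ 2 ∂m) ∧
      (∀ α ω ω', Φ' α ω ≠ 0 → Φ' α ω' ≠ 0 → ∀ i ∈ s, |Y ω i - Y ω' i| ≤ 1 / a i) ∧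
      (∀ t, ∑' α, TT a (SQ m Y (Φ α)) t ≤ cO n ^ s.card * ∑' α, TT a (SQ m Y (Φ' α)) t) := by
  induction s using Finset.induction_on with
  | empty =>
    intro ι _ Φ h1 h2
    exact ⟨ι, inferInstance, Φ, h1, h2, le_rfl, by simp, by simp⟩
  | insert i s his ih =>
    intro ι _ Φ h1 h2
    obtain ⟨ι', hι', Φ', k1, k2, k3, k4, k5⟩ := ih ι Φ h1 h2
    refine ⟨ι' × ℤ, inferInstance, fun q => pc Y i (a i) q.2 (Φ' q.1), fun q => pc_integrable hY (k1 q.1) i _ _, ?_, ?_, ?_, ?_⟩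
    · intro q ω
      refine le_trans ?_ (k2 q.1 ω)
      unfold pc
      exact norm_indicator_le_norm_self _ _
    · refine le_trans ?_ k3
      rw [ENNReal.tsum_prod']
      gcongr with α
      have hme : ∀ p : ℤ, AEMeasurable (fun ω => ‖pc Y i (a i) p (Φ' α) ω‖ₑ ^ 2) m := fun p =>
        ((pc_integrable hY (k1 α) i (a i) p).aestronglyMeasurable.enorm).pow_const 2
      dsimp only
      rw [← lintegral_tsum hme]
      apply lintegral_mono
      intro ω
      dsimp only
      rw [tsum_eq_single ⌊a i * Y ω i⌋]
      · unfold pc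
        gcongr
        exact enorm_indicator_le_enorm_self _ _
      · intro p hp
        unfold pc
        rw [indicator_of_notMem]
        · simp
        · simpa using hp.symm
    · intro q ω ω' hω hω' j hj
      have e1 : ⌊a i * Y ω i⌋ = q.2 := by
        by_contra hc; exact hω (indicator_of_notMem (s := {ω | ⌊a i * Y ω i⌋ = q.2}) hc _)
      have e2 : ⌊a i * Y ω' i⌋ = q.2 := by
        by_contra hc; exact hω' (indicator_of_notMem (s := {ω | ⌊a i * Y ω i⌋ = q.2}) hc _)
      rw [Finset.mem_insert] at hj
      rcases hj with rfl | hj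
      · have h3 := Int.abs_sub_lt_one_of_floor_eq_floor (e1.trans e2.symm)
        rw [← mul_sub, abs_mul, abs_of_pos (ha j)] at h3
        rw [le_div_iff₀ (ha j), mul_comm]; exact h3.le
      · refine k4 q.1 ω ω' ?_ ?_ j hj
        · intro h; apply hω; simp [pc, indicator_apply, h]
        · intro h; apply hω'; simp [pc, indicator_apply, h]
    · intro t
      refine (k5 t).trans ?_
      rw [Finset.card_insert_of_notMem his, pow_succ, mul_assoc, ENNReal.tsum_prod', ← ENNReal.tsum_mul_left (a := cO n)]
      gcongr with α
      refine TT_orth hY (k1 α) i ha (B := B) (fun ω hω => hB ω ?_ i) t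
      intro h
      apply hω
      have := k2 α ω
      rw [h, norm_zero] at this
      exact norm_le_zero_iff.1 this

end
end S17

open MeasureTheory Metric Set
open scoped ENNReal
namespace S17

variable {n : ℕ} {Ω : Type*} [MeasurableSpace Ω]

noncomputable def VV (R : ℝ) : List (Fin n) → ((Fin n → ℝ) → ℝ≥0∞) → ((Fin n → ℝ) → ℝ≥0∞)
  | [], u => u
  | i :: l, u => VV R l (Am (vm R) i u)

theorem VV_measurable (R : ℝ) (l : List (Fin n)) {u : (Fin n → ℝ) → ℝ≥0∞} (hu : Measurable u) : Measurable (VV R l u) := by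
  induction l generalizing u with
  | nil => exact hu
  | cons i l ih => exact ih (Am_measurable _ i hu)

theorem VV_mono (R : ℝ) (l : List (Fin n)) {u v : (Fin n → ℝ) → ℝ≥0∞} (h : ∀ t, u t ≤ v t) (t : Fin n → ℝ) :
    VV R l u t ≤ VV R l v t := by
  induction l generalizing u v with
  | nil => exact h t
  | cons i l ih => exact ih (Am_mono _ i h)

theorem Am_const_mul (ρ : Measure ℝ) (i : Fin n) {c : ℝ≥0∞} (hc : c ≠ ⊤) (u : (Fin n → ℝ) → ℝ≥0∞) :
    Am ρ i (fun t => c * u t) = fun t => c * Am ρ i u t := by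
  ext t; unfold Am; rw [lintegral_const_mul' _ _ hc]

theorem VV_const_mul (R : ℝ) (l : List (Fin n)) {c : ℝ≥0∞} (hc : c ≠ ⊤) (u : (Fin n → ℝ) → ℝ≥0∞) :
    VV R l (fun t => c * u t) = fun t => c * VV R l u t := by
  induction l generalizing u with
  | nil => rfl
  | cons i l ih => simp only [VV]; rw [Am_const_mul _ i hc, ih]

def LC (R : ℝ) (c : ℝ≥0∞) (i : Fin n) (u : (Fin n → ℝ) → ℝ≥0∞) : Prop :=
  ∀ t r, |r| ≤ R → u (t + Pi.single i r) ≤ c * u t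

theorem LC_Am {R : ℝ} {c : ℝ≥0∞} (hc : c ≠ ⊤) {i i' : Fin n} {u : (Fin n → ℝ) → ℝ≥0∞} (h : LC R c i u) :
    LC R c i (Am (vm R) i' u) := by
  intro t r hr
  unfold Am
  rw [← lintegral_const_mul' _ _ hc]
  apply lintegral_mono
  intro r'
  have := h (t + Pi.single i' r') r hr
  rwa [add_right_comm] at this

theorem ae_vm (R : ℝ) : ∀ᵐ r ∂(vm R), r ∈ Icc 0 R := by
  unfold vm
  exact Measure.ae_smul_measure (ae_restrict_mem measurableSet_Icc) _

theorem LC_le_Am {R : ℝ} (hR : 0 < R) {c : ℝ≥0∞} (hc : c ≠ ⊤) {i : Fin n} {u : (Fin n → ℝ) → ℝ≥0∞} (h : LC R c i u)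
    (t : Fin n → ℝ) : u t ≤ c * Am (vm R) i u t := by
  have := vm_prob hR
  calc u t = ∫⁻ r, u t ∂(vm R) := by simp
    _ ≤ ∫⁻ r, c * u (t + Pi.single i r) ∂(vm R) := by
        apply lintegral_mono_ae
        filter_upwards [ae_vm R] with r hr
        have := h (t + Pi.single i r) (-r) (by rw [abs_neg, abs_of_nonneg hr.1]; exact hr.2)
        rwa [add_assoc, ← Pi.single_add, add_neg_cancel, Pi.single_zero, add_zero] at this
    _ = _ := by rw [lintegral_const_mul' _ _ hc]; rfl

theorem box_step {R : ℝ} (hR : 0 < R) (i : Fin n) {u : (Fin n → ℝ) → ℝ≥0∞} (hu : Measurable u) (c : Fin n → ℝ) (ρ : ℝ) :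
    ∫⁻ t in closedBall c ρ, u t ≤ ∫⁻ t in closedBall c (ρ + R), Am (vm R) i u t := by
  have := vm_prob hR
  have hs := single_measurable i
  unfold Am
  rw [lintegral_lintegral_swap (by
    apply Measurable.aemeasurable
    exact hu.comp (measurable_fst.add (hs.comp measurable_snd)))]
  calc _ = ∫⁻ r, (∫⁻ t in closedBall c ρ, u t) ∂(vm R) := by simp
    _ ≤ _ := by
      apply lintegral_mono_ae
      filter_upwards [ae_vm R] with r hr
      rw [← lintegral_indicator isClosed_closedBall.measurableSet, ← lintegral_indicator isClosed_closedBall.measurableSet,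
        ← lintegral_add_right_eq_self (fun t => (closedBall c ρ).indicator u t) (Pi.single i r)]
      apply lintegral_mono
      intro t
      dsimp only
      by_cases ht : t + Pi.single i r ∈ closedBall c ρ
      · rw [indicator_of_mem ht, indicator_of_mem]
        rw [mem_closedBall, dist_eq_norm] at ht ⊢
        have e : t - c = (t + Pi.single i r - c) - Pi.single i r := by abel
        rw [e]
        refine (norm_sub_le _ _).trans (add_le_add ht ?_)
        rw [Pi.norm_single, Real.norm_eq_abs, abs_of_nonneg hr.1]; exact hr.2
      · rw [indicator_of_notMem ht]; exact zero_le

theorem holder_step {R : ℝ} (hR : 0 < R) {c : ℝ≥0∞} (hc : c ≠ ⊤) (hc1 : 1 ≤ c) (i : Fin n) (J : Finset (Fin n)) {a : ℝ} (ha : 0 ≤ a)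
    (hJ : a * ((J.card : ℝ) - 1) ≤ 1)
    {u : Fin n → (Fin n → ℝ) → ℝ≥0∞} (hu : ∀ j, Measurable (u j)) (hLC : ∀ j ∈ J, (j = i ∨ i ∉ J) → LC R c i (u j)) (t : Fin n → ℝ) :
    Am (vm R) i (fun t => ∏ j ∈ J, u j t ^ a) t ≤ ((c * c) ^ a) ^ J.card * ∏ j ∈ J, Am (vm R) i (u j) t ^ a := by
  classical
  have := vm_prob hR
  have hs := single_measurable i
  set J0 : Finset (Fin n) := if i ∈ J then J.erase i else ∅ with hJ0
  have hsub : J0 ⊆ J := by rw [hJ0]; split_ifs <;> simp [Finset.erase_subset]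
  have hcard : a * (J0.card : ℝ) ≤ 1 := by
    rw [hJ0]
    split_ifs with h
    · rw [Finset.card_erase_of_mem h, Nat.cast_sub (Finset.card_pos.2 ⟨i, h⟩)]
      simpa using hJ
    · simp
  have hL : ∀ j ∈ J \ J0, LC R c i (u j) := by
    intro j hj
    rw [Finset.mem_sdiff] at hj
    apply hLC j hj.1
    by_contra hcon
    push Not at hcon
    apply hj.2
    rw [hJ0, if_pos hcon.2]
    exact Finset.mem_erase.2 ⟨hcon.1, hj.1⟩
  have hum : ∀ j, Measurable (fun r : ℝ => u j (t + Pi.single i r)) := fun j =>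
    (hu j).comp (measurable_const.add hs)
  have h1 : 1 ≤ (c * c) ^ a := by
    have := ENNReal.rpow_le_rpow (one_le_mul hc1 hc1) ha
    rwa [ENNReal.one_rpow] at this
  have key : Am (vm R) i (fun t => ∏ j ∈ J, u j t ^ a) t ≤
      ∫⁻ r, (∏ j ∈ J \ J0, (c * c * Am (vm R) i (u j) t) ^ a) * ∏ j ∈ J0, u j (t + Pi.single i r) ^ a ∂(vm R) := by
    unfold Am
    apply lintegral_mono_ae
    filter_upwards [ae_vm R] with r hr
    rw [← Finset.prod_sdiff hsub]
    gcongr with j hj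
    refine (hL j hj t r (by rw [abs_of_nonneg hr.1]; exact hr.2)).trans ?_
    rw [mul_assoc]
    gcongr
    exact LC_le_Am hR hc (hL j hj) t
  refine key.trans ?_
  rw [lintegral_const_mul _ (Finset.measurable_fun_prod _ fun j _ => (hum j).pow_const a)]
  have h2 := ENNReal.lintegral_mul_prod_norm_pow_le (μ := vm R) J0 (g := fun _ => 1) (f := fun j r => u j (t + Pi.single i r))
    aemeasurable_const (fun j _ => (hum j).aemeasurable) (1 - a * J0.card) (p := fun _ => a) (by simp [mul_comm]) (by linarith) (fun _ _ => ha)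
  simp only [ENNReal.one_rpow, one_mul, lintegral_const, measure_univ, mul_one] at h2
  refine (mul_le_mul_right h2 _).trans ?_
  simp_rw [ENNReal.mul_rpow_of_nonneg (c * c) _ ha, Finset.prod_mul_distrib, Finset.prod_const]
  rw [← Finset.prod_sdiff hsub (f := fun j => Am (vm R) i (u j) t ^ a)]
  rw [← mul_assoc]
  gcongr ?_ * _ * _
  · exact pow_le_pow_right₀ h1 (Finset.card_le_card Finset.sdiff_subset)

theorem VV_step {R : ℝ} (hR : 0 < R) {c : ℝ≥0∞} (hc : c ≠ ⊤) (hc1 : 1 ≤ c) (J : Finset (Fin n)) {a : ℝ} (ha : 0 ≤ a)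
    (hJ : a * ((J.card : ℝ) - 1) ≤ 1) (l : List (Fin n)) :
    ∀ {u : Fin n → (Fin n → ℝ) → ℝ≥0∞}, (∀ j, Measurable (u j)) → (∀ i, ∀ j ∈ J, (j = i ∨ i ∉ J) → LC R c i (u j)) →
    ∀ (x : Fin n → ℝ) (ρ : ℝ),
    ∫⁻ t in closedBall x ρ, ∏ j ∈ J, u j t ^ a ≤
      (((c * c) ^ a) ^ J.card) ^ l.length * ∫⁻ t in closedBall x (ρ + l.length * R), ∏ j ∈ J, VV R l (u j) t ^ a := by
  induction l with
  | nil => intro u _ _ x ρ; simp [VV]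
  | cons i l ih =>
    intro u hu hLC x ρ
    have hC : ((c * c) ^ a) ^ J.card ≠ ⊤ :=
      ENNReal.pow_ne_top (ENNReal.rpow_ne_top_of_nonneg ha (ENNReal.mul_ne_top hc hc))
    have h1 := box_step hR i (u := fun t => ∏ j ∈ J, u j t ^ a) (Finset.measurable_fun_prod _ fun j _ => (hu j).pow_const a) x ρ
    have h2 : ∫⁻ t in closedBall x (ρ + R), Am (vm R) i (fun t => ∏ j ∈ J, u j t ^ a) t ≤
        ((c * c) ^ a) ^ J.card * ∫⁻ t in closedBall x (ρ + R), ∏ j ∈ J, Am (vm R) i (u j) t ^ a := by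
      rw [← lintegral_const_mul' _ _ hC]
      exact lintegral_mono fun t => holder_step hR hc hc1 i J ha hJ hu (hLC i) t
    have h3 := ih (u := fun j => Am (vm R) i (u j)) (fun j => Am_measurable _ i (hu j))
      (fun i' j hj h => LC_Am hc (hLC i' j hj h)) x (ρ + R)
    refine h1.trans (h2.trans ((mul_le_mul_right h3 _).trans (le_of_eq ?_)))
    rw [← mul_assoc, List.length_cons, pow_succ']
    congr 4
    push_cast; ring

def mxl (R : ℝ) : List (Fin n) → (Fin n → ℝ) → (Fin n → ℝ)
  | [], a => a
  | i :: l, a => mxl R l (Function.update a i (max (a i) R))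

theorem mxl_apply (R : ℝ) (l : List (Fin n)) (a : Fin n → ℝ) (i : Fin n) :
    mxl R l a i = if i ∈ l then max (a i) R else a i := by
  induction l generalizing a with
  | nil => simp [mxl]
  | cons k l ih =>
    simp only [mxl, ih, List.mem_cons]
    by_cases h : i = k
    · subst h; simp
    · simp [h]

noncomputable def cV (n : ℕ) : ℝ≥0∞ := 2 * ENNReal.ofReal (16 * Real.pi) + ENNReal.ofReal (2 ^ n * 2)
theorem cV_top (n : ℕ) : cV n ≠ ⊤ := by
  unfold cV
  exact ENNReal.add_ne_top.2 ⟨ENNReal.mul_ne_top (by norm_num) ENNReal.ofReal_ne_top, ENNReal.ofReal_ne_top⟩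
theorem cV_one (n : ℕ) : 1 ≤ cV n := by
  unfold cV
  refine le_add_left ?_
  rw [← ENNReal.ofReal_one]
  apply ENNReal.ofReal_le_ofReal
  have : (1:ℝ) ≤ 2 ^ n := one_le_pow₀ (by norm_num)
  linarith

theorem Am_vm_TT {R : ℝ} (hR : 0 < R) {a : Fin n → ℝ} (ha : ∀ i, 0 < a i) (i : Fin n) {u : (Fin n → ℝ) → ℝ≥0∞} (hu : Measurable u)
    (t : Fin n → ℝ) : Am (vm R) i (TT a u) t ≤ cV n * TT (Function.update a i (max (a i) R)) u t := by
  rcases le_total (a i) R with h | h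
  · rw [max_eq_right h]
    refine (Am_vm_le hR i _ t).trans ?_
    refine (mul_le_mul_right (Am_TT i (ha i) h hu t) _).trans ?_
    rw [← mul_assoc]
    gcongr
    unfold cV; exact le_self_add
  · rw [max_eq_left h, Function.update_eq_self]
    have := vm_prob hR
    calc Am (vm R) i (TT a u) t ≤ ∫⁻ r, ENNReal.ofReal (2 ^ n * 2) * TT a u t ∂(vm R) := by
          unfold Am
          apply lintegral_mono_ae
          filter_upwards [ae_vm R] with r hr
          exact TT_shift_single ha u t i r (by rw [abs_of_nonneg hr.1]; exact hr.2.trans h)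
      _ = ENNReal.ofReal (2 ^ n * 2) * TT a u t := by simp
      _ ≤ _ := by gcongr; unfold cV; exact le_add_self

theorem VV_S {ι : Type*} [Countable ι] {R : ℝ} (hR : 0 < R) {w : ι → (Fin n → ℝ) → ℝ≥0∞} (hw : ∀ α, Measurable (w α))
    (l : List (Fin n)) : ∀ {a : Fin n → ℝ} (_ : ∀ i, 0 < a i) (t : Fin n → ℝ),
    VV R l (fun t => ∑' α, TT a (w α) t) t ≤ cV n ^ l.length * ∑' α, TT (mxl R l a) (w α) t := by
  induction l with
  | nil => intro a ha t; simp [VV, mxl]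
  | cons i l ih =>
    intro a ha t
    have hs := single_measurable i
    have h1 : ∀ t, Am (vm R) i (fun t => ∑' α, TT a (w α) t) t ≤ cV n * ∑' α, TT (Function.update a i (max (a i) R)) (w α) t := by
      intro t
      rw [← ENNReal.tsum_mul_left]
      have hm : ∀ α, AEMeasurable (fun r : ℝ => TT a (w α) (t + Pi.single i r)) (vm R) :=
        fun α => ((TT_measurable a (hw α)).comp (measurable_const.add hs)).aemeasurable
      unfold Am
      dsimp only
      rw [lintegral_tsum hm]
      gcongr with α
      exact Am_vm_TT hR ha i (hw α) t
    simp only [VV]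
    refine (VV_mono R l h1 t).trans ?_
    rw [VV_const_mul R l (cV_top n)]
    have h2 := ih (a := Function.update a i (max (a i) R)) (by
      intro k
      by_cases h : k = i
      · subst h; simp [ha k]
      · rw [Function.update_of_ne h]; exact ha k) t
    dsimp only
    refine (mul_le_mul_right h2 _).trans (le_of_eq ?_)
    rw [← mul_assoc, List.length_cons, pow_succ']
    rfl

end S17

open MeasureTheory Metric Set
open scoped ENNReal
namespace S17

variable {n : ℕ} {Ω : Type*} [MeasurableSpace Ω]

/-- square-function data at a level -/
def Lev (m : Measure Ω) (Y : Ω → Fin n → ℝ) (F : Ω → ℂ) (a : Fin n → ℝ) (b : (Fin n → ℝ) → ℝ≥0∞) : Prop :=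
  ∃ (ι : Type) (_ : Countable ι) (Φ : ι → Ω → ℂ), (∀ α, Integrable (Φ α) m) ∧ (∀ α ω, ‖Φ α ω‖ ≤ ‖F ω‖) ∧
    (∑' α, ∫⁻ ω, ‖Φ α ω‖ₑ ^ 2 ∂m ≤ ∫⁻ ω, ‖F ω‖ₑ ^ 2 ∂m) ∧ b = fun t => ∑' α, TT a (SQ m Y (Φ α)) t

section
variable {m : Measure Ω} {Y : Ω → Fin n → ℝ} {F : Ω → ℂ} {a : Fin n → ℝ} {b : (Fin n → ℝ) → ℝ≥0∞}

theorem SQ_meas [SFinite m] (hY : Measurable Y) {F : Ω → ℂ} (hF : Integrable F m) : Measurable (SQ m Y F) := GG_meas hY hF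

theorem Lev.meas [SFinite m] (hY : Measurable Y) (h : Lev m Y F a b) : Measurable b := by
  obtain ⟨ι, _, Φ, h1, h2, h3, rfl⟩ := h
  exact Measurable.tsum fun α => TT_measurable a (SQ_meas hY (h1 α))

theorem Lev.shift (ha : ∀ i, 0 < a i) (h : Lev m Y F a b) (t r : Fin n → ℝ) :
    b (t + r) ≤ (∏ i, ENNReal.ofReal (2 * (1 + (r i / a i) ^ 2))) * b t := by
  obtain ⟨ι, _, Φ, h1, h2, h3, rfl⟩ := h
  dsimp only
  rw [← ENNReal.tsum_mul_left]
  gcongr with α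
  exact TT_shift ha _ t r

theorem Lev.lint [SFinite m] (hY : Measurable Y) (ha : ∀ i, 0 < a i) (h : Lev m Y F a b) {K : ℝ≥0∞}
    (hK : ∀ F' : Ω → ℂ, Integrable F' m → (∀ ω, ‖F' ω‖ ≤ ‖F ω‖) → ∫⁻ t, SQ m Y F' t ≤ K * ∫⁻ ω, ‖F' ω‖ₑ ^ 2 ∂m) :
    ∫⁻ t, b t ≤ ENNReal.ofReal Real.pi ^ n * (K * ∫⁻ ω, ‖F ω‖ₑ ^ 2 ∂m) := by
  obtain ⟨ι, _, Φ, h1, h2, h3, rfl⟩ := h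
  rw [lintegral_tsum fun α => (TT_measurable a (SQ_meas hY (h1 α))).aemeasurable]
  simp_rw [lintegral_TT ha (SQ_meas hY (h1 _))]
  rw [ENNReal.tsum_mul_left]
  gcongr
  calc _ ≤ ∑' α, K * ∫⁻ ω, ‖Φ α ω‖ₑ ^ 2 ∂m := by
        gcongr with α; exact hK _ (h1 α) (h2 α)
    _ ≤ _ := by rw [ENNReal.tsum_mul_left]; gcongr

theorem Lev.LC_of (ha : ∀ i, 0 < a i) (h : Lev m Y F a b) {R : ℝ} {i : Fin n} (hR : R ≤ a i) : LC R (cV n) i b := by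
  obtain ⟨ι, _, Φ, h1, h2, h3, rfl⟩ := h
  intro t r hr
  dsimp only
  rw [← ENNReal.tsum_mul_left]
  gcongr with α
  refine (TT_shift_single ha _ t i r (hr.trans hR)).trans ?_
  gcongr; unfold cV; exact le_add_self

def av (M L : ℝ) (J : Finset (Fin n)) (j : Fin n) (q : ℕ) : Fin n → ℝ :=
  fun i => if i = j then min (M ^ (q + 1)) L else if i ∈ J then M ^ q else L

theorem av_pos {M L : ℝ} (hM : 1 ≤ M) (hL : 1 ≤ L) (J : Finset (Fin n)) (j : Fin n) (q : ℕ) (i : Fin n) : 0 < av M L J j q i := by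
  unfold av; split_ifs <;> positivity

/-- one level step for a single function -/
theorem lev_step [SFinite m] (hY : Measurable Y) {B : ℝ} (hB : ∀ ω, F ω ≠ 0 → ∀ i, |Y ω i| ≤ B)
    {M L : ℝ} (hM : 1 ≤ M) (J : Finset (Fin n)) {j : Fin n} (hj : j ∈ J) (q : ℕ) (hq : M ^ (q + 1) ≤ L)
    (hoff : ∀ ω ω', F ω ≠ 0 → F ω' ≠ 0 → ∀ i, i ∉ J → |Y ω i - Y ω' i| ≤ 1 / L)
    (hcv : ∀ ω ω' D, F ω ≠ 0 → F ω' ≠ 0 → (∀ i, |Y ω i - Y ω' i| ≤ D) → |Y ω j - Y ω' j| ≤ D / M + 1 / L)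
    (h : Lev m Y F (av M L J j q) b) :
    ∃ b', Lev m Y F (av M L J j (q + 1)) b' ∧
      ∀ t, VV (M ^ (q + 1)) (List.finRange n) b t ≤ cV n ^ n * (cO n ^ J.card * (cR * b' t)) := by
  have hL : 1 ≤ L := (one_le_pow₀ hM).trans hq
  have hR : 0 < M ^ (q + 1) := by positivity
  obtain ⟨ι, _, Φ, h1, h2, h3, rfl⟩ := h
  set R := M ^ (q + 1) with hRdef
  set a' : Fin n → ℝ := fun i => if i ∈ J then R else L with ha'
  have hmx : mxl R (List.finRange n) (av M L J j q) = a' := by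
    ext i
    rw [mxl_apply, if_pos (List.mem_finRange i), ha']
    unfold av
    by_cases hi : i = j
    · subst hi; simp [hj, ← hRdef, hq]
    · by_cases hiJ : i ∈ J
      · simp only [hi, hiJ, if_true, if_false]
        exact max_eq_right (pow_le_pow_right₀ hM (by omega))
      · simp only [hi, hiJ, if_false]
        exact max_eq_left hq
  have ha'pos : ∀ i, 0 < a' i := by intro i; rw [ha']; dsimp only; split_ifs <;> positivity
  obtain ⟨ι', hι', Φ', k1, k2, k3, k4, k5⟩ := split_all (m := m) hY hB ha'pos J ι Φ h1 h2
  have hne : ∀ α ω, Φ' α ω ≠ 0 → F ω ≠ 0 := by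
    intro α ω hω h0
    have := k2 α ω
    rw [h0, norm_zero] at this
    exact hω (norm_le_zero_iff.1 this)
  have hup : Function.update a' j (min (M ^ (q + 1 + 1)) L) = av M L J j (q + 1) := by
    ext i
    unfold av
    by_cases hi : i = j
    · subst hi; simp
    · rw [Function.update_of_ne hi]; simp [hi, ha', hRdef]
  refine ⟨fun t => ∑' α, TT (av M L J j (q + 1)) (SQ m Y (Φ' α)) t, ⟨ι', hι', Φ', k1, k2, k3.trans h3, rfl⟩, ?_⟩
  intro t
  have e1 := VV_S hR (fun α => SQ_meas hY (h1 α)) (List.finRange n) (av_pos hM hL J j q) t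
  rw [hmx, List.length_finRange] at e1
  refine e1.trans ?_
  gcongr
  refine (k5 t).trans ?_
  gcongr
  rw [← ENNReal.tsum_mul_left]
  gcongr with α
  rw [← hup]
  refine TT_repro hY (k1 α) j ha'pos ?_ ?_ t
  · rw [ha']; simp only [hj, if_true]
    exact le_min (pow_le_pow_right₀ hM (by omega)) hq
  · intro ω ω' hω hω'
    have := hcv ω ω' (1 / R) (hne _ _ hω) (hne _ _ hω') (by
      intro i
      by_cases hi : i ∈ J
      · have := k4 α ω ω' hω hω' i hi
        rw [ha'] at this
        simpa [hi] using this
      · refine (hoff ω ω' (hne _ _ hω) (hne _ _ hω') i hi).trans ?_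
        exact one_div_le_one_div_of_le hR hq)
    refine this.trans ?_
    have hp : 0 < min (M ^ (q + 1 + 1)) L := by positivity
    have t1 : 1 / R / M ≤ 1 / min (M ^ (q + 1 + 1)) L := by
      rw [div_div, hRdef, ← pow_succ]
      exact one_div_le_one_div_of_le hp (min_le_left _ _)
    have t2 : 1 / L ≤ 1 / min (M ^ (q + 1 + 1)) L := one_div_le_one_div_of_le hp (min_le_right _ _)
    calc _ ≤ 1 / min (M ^ (q + 1 + 1)) L + 1 / min (M ^ (q + 1 + 1)) L := add_le_add t1 t2
      _ = _ := by ring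

/-- start -/
theorem lev_start [SFinite m] (hY : Measurable Y) (hF : Integrable F m)
    {M L : ℝ} (hM : 1 ≤ M) (hML : M ≤ L) (J : Finset (Fin n)) {j : Fin n}
    (hoff : ∀ ω ω', F ω ≠ 0 → F ω' ≠ 0 → ∀ i, i ∉ J → |Y ω i - Y ω' i| ≤ 1 / L)
    (hcv : ∀ ω ω' D, F ω ≠ 0 → F ω' ≠ 0 → (∀ i, |Y ω i - Y ω' i| ≤ D) → |Y ω j - Y ω' j| ≤ D / M + 1 / L)
    (hsp : ∀ ω ω', F ω ≠ 0 → F ω' ≠ 0 → ∀ i, |Y ω i - Y ω' i| ≤ 1) :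
    ∃ b, Lev m Y F (av M L J j 0) b ∧ ∀ t, SQ m Y F t ≤ ENNReal.ofReal (Cv ^ 2 * Real.pi) ^ n * (4 * b t) := by
  have hL : 1 ≤ L := hM.trans hML
  have hM0 : 0 < M := by linarith
  refine ⟨fun t => ∑' _ : Unit, TT (av M L J j 0) (SQ m Y F) t, ⟨Unit, inferInstance, fun _ => F, fun _ => hF, fun _ _ => le_rfl, by simp, rfl⟩, ?_⟩
  intro t
  by_cases h0 : ∃ ω, F ω ≠ 0
  swap
  · push Not at h0
    have : SQ m Y F t = 0 := by unfold SQ GG; simp [h0]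
    rw [this]; exact zero_le
  obtain ⟨ω0, h0⟩ := h0
  have hav : av M L J j 0 j = M := by unfold av; simp [hML]
  have e := repron (m := m) hY hF (A := Function.update (av M L J j 0) j (M / 2)) (c := Y ω0) (by
    intro i
    by_cases hi : i = j
    · subst hi; simp [hM0]
    · rw [Function.update_of_ne hi]; exact av_pos hM hL J j 0 i) (by
    intro ω hω i
    by_cases hi : i = j
    · subst hi
      rw [Function.update_self, abs_mul, abs_of_pos (by positivity)]
      have h1 := hcv ω ω0 1 hω h0 (hsp ω ω0 hω h0)
      have h2 : 1 / L ≤ 1 / M := one_div_le_one_div_of_le hM0 hML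
      calc M / 2 * |Y ω i - Y ω0 i| ≤ M / 2 * (1 / M + 1 / M) := by gcongr; linarith
        _ = 1 := by field_simp; norm_num
    · rw [Function.update_of_ne hi, abs_mul, abs_of_pos (av_pos hM hL J j 0 i)]
      unfold av
      by_cases hiJ : i ∈ J
      · simp only [hi, hiJ, if_true, if_false, pow_zero, one_mul]; exact hsp ω ω0 hω h0 i
      · simp only [hi, hiJ, if_false]
        calc L * |Y ω i - Y ω0 i| ≤ L * (1 / L) := by gcongr; exact hoff ω ω0 hω h0 i hiJ
          _ = 1 := by field_simp) t
  unfold SQ at e ⊢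
  refine e.trans ?_
  gcongr
  dsimp only
  rw [tsum_fintype]
  simp only [Finset.univ_unique, Finset.sum_const, Finset.card_singleton, one_smul]
  have := TT_update_le (av M L J j 0) j (x := M / 2) (y := M) (by positivity) (by linarith) (by linarith) (fun t => ‖GG m Y F t‖ₑ ^ 2) t
  have hu : Function.update (av M L J j 0) j M = av M L J j 0 := by
    ext i
    by_cases hi : i = j
    · subst hi; rw [Function.update_self, hav]
    · rw [Function.update_of_ne hi]
  rwa [hu] at this

end
end S17

open MeasureTheory Metric Set
open scoped ENNReal
namespace S17

variable {n : ℕ} {Ω : Type*} [MeasurableSpace Ω]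

noncomputable def cC (n k : ℕ) (a : ℝ) : ℝ≥0∞ :=
  (((cV n * cV n) ^ a) ^ k) ^ n * ((cV n ^ n * (cO n ^ k * cR)) ^ a) ^ k
theorem cC_top (n k : ℕ) {a : ℝ} (ha : 0 ≤ a) : cC n k a ≠ ⊤ := by
  unfold cC
  have h1 := cV_top n
  have h2 := cO_top n
  have h3 := cR_top
  refine ENNReal.mul_ne_top ?_ ?_
  · exact ENNReal.pow_ne_top (ENNReal.pow_ne_top (ENNReal.rpow_ne_top_of_nonneg ha (ENNReal.mul_ne_top h1 h1)))
  · exact ENNReal.pow_ne_top (ENNReal.rpow_ne_top_of_nonneg ha (ENNReal.mul_ne_top (ENNReal.pow_ne_top h1)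
      (ENNReal.mul_ne_top (ENNReal.pow_ne_top h2) h3)))

section
variable {m : Measure Ω} {Y : Ω → Fin n → ℝ} {F : Fin n → Ω → ℂ}

theorem chain [SFinite m] (hY : Measurable Y) {B : ℝ} (J : Finset (Fin n))
    (hB : ∀ j ∈ J, ∀ ω, F j ω ≠ 0 → ∀ i, |Y ω i| ≤ B)
    {M L : ℝ} (hM : 1 ≤ M)
    (hoff : ∀ j ∈ J, ∀ ω ω', F j ω ≠ 0 → F j ω' ≠ 0 → ∀ i, i ∉ J → |Y ω i - Y ω' i| ≤ 1 / L)
    (hcv : ∀ j ∈ J, ∀ ω ω' D, F j ω ≠ 0 → F j ω' ≠ 0 → (∀ i, |Y ω i - Y ω' i| ≤ D) → |Y ω j - Y ω' j| ≤ D / M + 1 / L)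
    {a : ℝ} (ha : 0 ≤ a) (hJ : a * ((J.card : ℝ) - 1) ≤ 1)
    {b : Fin n → (Fin n → ℝ) → ℝ≥0∞} (hb : ∀ j, Measurable (b j)) (hlev : ∀ j ∈ J, Lev m Y (F j) (av M L J j 0) (b j)) (p : ℕ)
    (hp : M ^ p ≤ L) :
    ∃ b' : Fin n → (Fin n → ℝ) → ℝ≥0∞, (∀ j, Measurable (b' j)) ∧ (∀ j ∈ J, Lev m Y (F j) (av M L J j p) (b' j)) ∧
      ∀ x ρ, ∫⁻ t in closedBall x ρ, ∏ j ∈ J, b j t ^ a ≤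
        cC n J.card a ^ p * ∫⁻ t in closedBall x (ρ + p * (n * L)), ∏ j ∈ J, b' j t ^ a := by
  induction p with
  | zero => exact ⟨b, hb, hlev, by simp⟩
  | succ p ih =>
    have hp' : M ^ p ≤ L := (pow_le_pow_right₀ hM (by omega)).trans hp
    have hL : 1 ≤ L := (one_le_pow₀ hM).trans hp
    obtain ⟨b1, k1, k2, k3⟩ := ih hp'
    have hst := fun j hj => lev_step hY (hB j hj) hM J hj p hp (hoff j hj) (hcv j hj) (k2 j hj)
    choose! b2 l1 l2 using hst
    classical
    refine ⟨fun j => if j ∈ J then b2 j else 0, ?_, ?_, ?_⟩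
    · intro j
      by_cases hj : j ∈ J
      · simp only [hj, if_true]; exact (l1 j hj).meas hY
      · simp only [hj, if_false]; exact measurable_const
    · intro j hj; simp only [hj, if_true]; exact l1 j hj
    intro x ρ
    refine (k3 x ρ).trans ?_
    rw [pow_succ, mul_assoc]
    gcongr
    have hR : 0 < M ^ (p + 1) := by positivity
    have hC1 : ((cV n ^ n * (cO n ^ J.card * cR)) ^ a) ^ J.card ≠ ⊤ := by
      refine ENNReal.pow_ne_top (ENNReal.rpow_ne_top_of_nonneg ha (ENNReal.mul_ne_top (ENNReal.pow_ne_top (cV_top n))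
        (ENNReal.mul_ne_top (ENNReal.pow_ne_top (cO_top n)) cR_top)))
    have h1 := VV_step hR (cV_top n) (cV_one n) J ha hJ (List.finRange n) k1 (by
      intro i j hj h
      refine (k2 j hj).LC_of (av_pos hM hL J j p) ?_
      unfold av
      by_cases hij : i = j
      · simp only [hij, if_true]; exact le_min le_rfl hp
      · have : i ∉ J := by rcases h with h | h; exact absurd h.symm hij; exact h
        simp only [hij, this, if_false]; exact hp) x (ρ + p * (n * L))
    rw [List.length_finRange] at h1
    refine h1.trans ?_
    unfold cC
    rw [mul_assoc]
    gcongr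
    rw [← lintegral_const_mul' _ _ hC1]
    refine (lintegral_mono_set (t := closedBall x (ρ + ((p + 1 : ℕ) : ℝ) * (n * L))) (closedBall_subset_closedBall ?_)).trans ?_
    · have : (n : ℝ) * M ^ (p + 1) ≤ n * L := by gcongr
      push_cast; linarith
    · apply lintegral_mono
      intro t
      dsimp only
      rw [← Finset.prod_const, ← Finset.prod_mul_distrib]
      apply Finset.prod_le_prod' 
      intro j hj
      simp only [hj, if_true]
      rw [← ENNReal.mul_rpow_of_nonneg _ _ ha]
      gcongr
      have := l2 j hj t
      rwa [mul_assoc, mul_assoc]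
end
end S17

open MeasureTheory Metric Set
open scoped ENNReal
namespace S17

variable {n : ℕ}

theorem vol_cb (x : Fin n → ℝ) {r : ℝ} (hr : 0 ≤ r) : volume (closedBall x r) = ENNReal.ofReal ((2 * r) ^ n) := by
  rw [Real.volume_pi_closedBall x hr]; simp

/-- averaging an integral over balls -/
theorem avg_ball (H : Measure (Fin n → ℝ)) [SFinite H] {u : (Fin n → ℝ) → ℝ≥0∞} (hu : Measurable u) {r : ℝ} (hr : 0 ≤ r) :
    ENNReal.ofReal ((2 * r) ^ n) * ∫⁻ x, u x ∂H = ∫⁻ c, ∫⁻ x in closedBall c r, u x ∂H := by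
  have hm : Measurable (fun p : (Fin n → ℝ) × (Fin n → ℝ) => ({p | dist p.2 p.1 ≤ r} : Set _).indicator (fun p => u p.2) p) := by
    apply Measurable.indicator (hu.comp measurable_snd)
    exact measurableSet_le (measurable_snd.dist measurable_fst) measurable_const
  have e : ∀ c, ∫⁻ x in closedBall c r, u x ∂H = ∫⁻ x, ({p | dist p.2 p.1 ≤ r} : Set ((Fin n → ℝ) × (Fin n → ℝ))).indicator (fun p => u p.2) (c, x) ∂H := by
    intro c
    rw [← lintegral_indicator isClosed_closedBall.measurableSet]
    rfl
  simp_rw [e]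
  rw [lintegral_lintegral_swap hm.aemeasurable, ← lintegral_const_mul _ hu]
  congr 1; ext x
  have e2 : ∀ c, ({p | dist p.2 p.1 ≤ r} : Set ((Fin n → ℝ) × (Fin n → ℝ))).indicator (fun p => u p.2) (c, x) = (closedBall x r).indicator (fun _ => u x) c := by
    intro c
    by_cases h : dist x c ≤ r
    · rw [indicator_of_mem (show (c, x) ∈ {p : (Fin n → ℝ) × (Fin n → ℝ) | dist p.2 p.1 ≤ r} from h), indicator_of_mem]
      rw [mem_closedBall, dist_comm]; exact h
    · rw [indicator_of_notMem (show (c, x) ∉ {p : (Fin n → ℝ) × (Fin n → ℝ) | dist p.2 p.1 ≤ r} from h), indicator_of_notMem]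
      rw [mem_closedBall, dist_comm]; exact h
  simp_rw [e2]
  rw [lintegral_indicator isClosed_closedBall.measurableSet, setLIntegral_const, vol_cb x hr, mul_comm]

theorem unit_local (H : Measure (Fin n → ℝ)) [SFinite H] {A : ℝ≥0∞} (hA : ∀ x, H (closedBall x 1) ≤ A)
    {P : (Fin n → ℝ) → ℝ≥0∞} (hP : Measurable P) {k : ℝ≥0∞} (hPl : ∀ t h : Fin n → ℝ, ‖h‖ ≤ 1 → P (t + h) ≤ k * P t)
    (c : Fin n → ℝ) (ρ : ℝ) :
    ∫⁻ x in closedBall c ρ, P x ∂H ≤ k * A * ∫⁻ t in closedBall c (ρ + 1), P t := by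
  have hm := isClosed_closedBall (x := c) (ε := ρ) |>.measurableSet
  have hm2 := isClosed_closedBall (x := c) (ε := ρ + 1) |>.measurableSet
  have a1 := avg_ball H (u := (closedBall c ρ).indicator P) (hP.indicator hm) (r := 1/2) (by norm_num)
  norm_num at a1
  rw [lintegral_indicator hm] at a1
  rw [a1, ← lintegral_indicator hm2, ← lintegral_const_mul _ (hP.indicator hm2)]
  apply lintegral_mono
  intro t
  dsimp only
  by_cases ht : t ∈ closedBall c (ρ + 1)
  · rw [indicator_of_mem ht]
    calc _ ≤ ∫⁻ x in closedBall t (1/2), k * P t ∂H := by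
          apply setLIntegral_mono measurable_const
          intro x hx
          refine (indicator_le_self _ _ _).trans ?_
          have := hPl t (x - t) (by rw [← dist_eq_norm]; exact (mem_closedBall.1 hx).trans (by norm_num))
          rwa [add_sub_cancel] at this
      _ = k * P t * H (closedBall t (1/2)) := by rw [setLIntegral_const]
      _ ≤ k * P t * A := by gcongr; exact (measure_mono (closedBall_subset_closedBall (by norm_num))).trans (hA t)
      _ = _ := by ring
  · rw [indicator_of_notMem ht, mul_zero]
    apply le_of_eq
    rw [setLIntegral_eq_zero_iff isClosed_closedBall.measurableSet (hP.indicator hm)]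
    refine Filter.Eventually.of_forall fun x hx => indicator_of_notMem ?_ _
    intro hxc
    apply ht
    rw [mem_closedBall] at *
    have := dist_triangle t x c
    rw [dist_comm t x] at this
    linarith

theorem endgame (H : Measure (Fin n → ℝ)) [SFinite H] {A : ℝ≥0∞} {γ L D : ℝ} (hL : 1 ≤ L)
    (hH : ∀ x r, 1 ≤ r → H (closedBall x r) ≤ A * ENNReal.ofReal (r ^ ((n : ℝ) - γ)))
    (J : Finset (Fin n)) (hJ : J.Nonempty) {a : ℝ} (ha : a = 2 / (2 * J.card - 1))
    {b b' : Fin n → (Fin n → ℝ) → ℝ≥0∞} (hb : ∀ j, Measurable (b j)) (hb' : ∀ j, Measurable (b' j))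
    {c0 c1 c2 : ℝ≥0∞} (hD : 0 ≤ D)
    (h0 : ∀ j ∈ J, ∀ t h, ‖h‖ ≤ 1 → b j (t + h) ≤ c0 * b j t)
    (h1 : ∀ j ∈ J, ∀ t h, ‖h‖ ≤ (2 + D) * L → b' j (t + h) ≤ c1 * b' j t)
    (h2 : ∀ x ρ, ∫⁻ t in closedBall x ρ, ∏ j ∈ J, b j t ^ a ≤ c2 * ∫⁻ t in closedBall x (ρ + D * L), ∏ j ∈ J, b' j t ^ a) :
    ∫⁻ x, ∏ j ∈ J, b j x ^ (1 / (J.card : ℝ)) ∂H ≤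
      ((c0 ^ a) ^ J.card * c2 * (c1 ^ a) ^ J.card * ENNReal.ofReal ((2 * (2 + D)) ^ n)) ^ (1 - 1 / (2 * (J.card : ℝ))) *
      A * ENNReal.ofReal (L ^ (-(γ / (2 * J.card)))) * ∏ j ∈ J, (∫⁻ t, b' j t) ^ (1 / (J.card : ℝ)) := by
  set k : ℝ := (J.card : ℝ) with hk
  have hk1 : 1 ≤ k := by rw [hk]; exact_mod_cast hJ.card_pos
  have ha0 : 0 < a := by rw [ha]; apply div_pos (by norm_num); linarith
  set θ : ℝ := 1 - 1 / (2 * k) with hθ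
  have hθ0 : 0 < θ := by
    rw [hθ]; have : 1 / (2 * k) ≤ 1 / 2 := one_div_le_one_div_of_le (by norm_num) (by linarith)
    linarith
  have hθ1 : 0 ≤ 1 - θ := by rw [hθ]; simp; positivity
  have haθ : a * θ = 1 / k := by rw [hθ, ha]; have : 2 * k - 1 ≠ 0 := by linarith
                                 field_simp
  set C3 := (c0 ^ a) ^ J.card * c2 * (c1 ^ a) ^ J.card * ENNReal.ofReal ((2 * (2 + D)) ^ n) with hC3
  set P : (Fin n → ℝ) → ℝ≥0∞ := fun t => ∏ j ∈ J, b j t ^ a with hP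
  have hPm : Measurable P := Finset.measurable_fun_prod _ fun j _ => (hb j).pow_const a
  set u : (Fin n → ℝ) → ℝ≥0∞ := fun t => ∏ j ∈ J, b j t ^ (1 / k) with hu
  have hum : Measurable u := Finset.measurable_fun_prod _ fun j _ => (hb j).pow_const _
  have huP : ∀ t, u t = P t ^ θ := by
    intro t
    simp only [hu, hP]
    rw [← ENNReal.prod_rpow_of_nonneg hθ0.le]
    simp_rw [← ENNReal.rpow_mul, haθ]
  have hA1 : ∀ x, H (closedBall x 1) ≤ A := fun x => by simpa using hH x 1 le_rfl
  have hPl : ∀ t h : Fin n → ℝ, ‖h‖ ≤ 1 → P (t + h) ≤ (c0 ^ a) ^ J.card * P t := by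
    intro t h hh
    simp only [hP]
    rw [← Finset.prod_const, ← Finset.prod_mul_distrib]
    apply Finset.prod_le_prod'
    intro j hj
    rw [← ENNReal.mul_rpow_of_nonneg _ _ ha0.le]
    gcongr
    exact h0 j hj t h hh
  have s2 : ∀ c, ∫⁻ x in closedBall c L, P x ∂H ≤ A * C3 * ENNReal.ofReal (L ^ n) * ∏ j ∈ J, b' j c ^ a := by
    intro c
    have e1 := unit_local H hA1 hPm hPl c L
    have e2 : ∫⁻ t in closedBall c (L + 1), P t ≤ c2 * ∫⁻ t in closedBall c ((2 + D) * L), ∏ j ∈ J, b' j t ^ a := by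
      refine (h2 c (L + 1)).trans ?_
      gcongr
      linarith
    have e3 : ∫⁻ t in closedBall c ((2 + D) * L), ∏ j ∈ J, b' j t ^ a ≤ ∫⁻ t in closedBall c ((2 + D) * L), (c1 ^ a) ^ J.card * ∏ j ∈ J, b' j c ^ a := by
      apply setLIntegral_mono measurable_const
      intro t ht
      rw [← Finset.prod_const, ← Finset.prod_mul_distrib]
      apply Finset.prod_le_prod'
      intro j hj
      rw [← ENNReal.mul_rpow_of_nonneg _ _ ha0.le]
      gcongr
      have := h1 j hj c (t - c) (by rw [← dist_eq_norm]; exact ht)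
      rwa [add_sub_cancel] at this
    rw [setLIntegral_const, vol_cb _ (by positivity)] at e3
    calc _ ≤ (c0 ^ a) ^ J.card * A * (c2 * ((c1 ^ a) ^ J.card * ∏ j ∈ J, b' j c ^ a) * ENNReal.ofReal ((2 * ((2 + D) * L)) ^ n)) := by
          refine e1.trans ?_
          gcongr
          refine e2.trans ?_
          rw [mul_assoc]
          gcongr
      _ = _ := by
          rw [hC3, ← mul_assoc 2, mul_pow _ L, ENNReal.ofReal_mul (by positivity)]; ring
  have s3 : ∀ c, ∫⁻ x in closedBall c L, u x ∂H ≤ C3 ^ θ * A * ENNReal.ofReal (L ^ ((n : ℝ) - γ / (2 * k))) * ∏ j ∈ J, b' j c ^ (1 / k) := by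
    intro c
    have e := ENNReal.lintegral_mul_norm_pow_le (μ := H.restrict (closedBall c L)) (f := P) (g := fun _ => 1) hPm.aemeasurable aemeasurable_const
      (p := θ) (q := 1 - θ) hθ0.le hθ1 (by ring)
    simp only [ENNReal.one_rpow, mul_one, lintegral_const, one_mul, Measure.restrict_apply_univ] at e
    simp_rw [huP]
    refine e.trans ?_
    refine (mul_le_mul' (ENNReal.rpow_le_rpow (s2 c) hθ0.le) (ENNReal.rpow_le_rpow (hH c L hL) hθ1)).trans (le_of_eq ?_)
    simp_rw [ENNReal.mul_rpow_of_nonneg _ _ hθ0.le, ENNReal.mul_rpow_of_nonneg _ _ hθ1]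
    have eb : (∏ j ∈ J, b' j c ^ a) ^ θ = ∏ j ∈ J, b' j c ^ (1 / k) := by
      rw [← ENNReal.prod_rpow_of_nonneg hθ0.le]
      simp_rw [← ENNReal.rpow_mul, haθ]
    have eA : A ^ θ * A ^ (1 - θ) = A := by
      rw [← ENNReal.rpow_add_of_nonneg _ _ hθ0.le hθ1]; simp
    have hL0 : 0 < L := by linarith
    have eL : ENNReal.ofReal (L ^ n) ^ θ * ENNReal.ofReal (L ^ ((n : ℝ) - γ)) ^ (1 - θ) = ENNReal.ofReal (L ^ ((n : ℝ) - γ / (2 * k))) := by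
      rw [ENNReal.ofReal_rpow_of_nonneg (by positivity) hθ0.le, ENNReal.ofReal_rpow_of_nonneg (by positivity) hθ1,
        ← ENNReal.ofReal_mul (by positivity), ← Real.rpow_natCast, ← Real.rpow_mul hL0.le, ← Real.rpow_mul hL0.le, ← Real.rpow_add hL0]
      congr 2
      rw [hθ]; field_simp; ring
    rw [eb]
    calc _ = C3 ^ θ * (A ^ θ * A ^ (1 - θ)) * (ENNReal.ofReal (L ^ n) ^ θ * ENNReal.ofReal (L ^ ((n : ℝ) - γ)) ^ (1 - θ)) * ∏ j ∈ J, b' j c ^ (1 / k) := by ring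
      _ = _ := by rw [eA, eL]
  have hL0 : 0 < L := by linarith
  have s4 := avg_ball H hum hL0.le
  have s5 : ∫⁻ c, ∫⁻ x in closedBall c L, u x ∂H ≤ C3 ^ θ * A * ENNReal.ofReal (L ^ ((n : ℝ) - γ / (2 * k))) * ∏ j ∈ J, (∫⁻ t, b' j t) ^ (1 / k) := by
    refine (lintegral_mono s3).trans ?_
    rw [lintegral_const_mul _ (Finset.measurable_fun_prod _ fun j _ => (hb' j).pow_const _)]
    gcongr
    apply ENNReal.lintegral_prod_norm_pow_le J (fun j _ => (hb' j).aemeasurable)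
    · rw [Finset.sum_const, nsmul_eq_mul, ← hk]; field_simp
    · intro j _; positivity
  rw [← s4] at s5
  have hLn : ENNReal.ofReal (L ^ n) ≤ ENNReal.ofReal ((2 * L) ^ n) := by
    apply ENNReal.ofReal_le_ofReal; gcongr; linarith
  have s6 : ∫⁻ x, u x ∂H = ENNReal.ofReal (L ^ (-(n:ℝ))) * (ENNReal.ofReal (L ^ n) * ∫⁻ x, u x ∂H) := by
    rw [← mul_assoc, ← ENNReal.ofReal_mul (by positivity), ← Real.rpow_natCast, ← Real.rpow_add hL0]; simp
  rw [s6]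
  calc _ ≤ ENNReal.ofReal (L ^ (-(n:ℝ))) * (C3 ^ θ * A * ENNReal.ofReal (L ^ ((n : ℝ) - γ / (2 * k))) * ∏ j ∈ J, (∫⁻ t, b' j t) ^ (1 / k)) := by
        exact mul_le_mul_right ((mul_le_mul_left hLn _).trans s5) _
    _ = C3 ^ θ * A * (ENNReal.ofReal (L ^ (-(n:ℝ))) * ENNReal.ofReal (L ^ ((n : ℝ) - γ / (2 * k)))) * ∏ j ∈ J, (∫⁻ t, b' j t) ^ (1 / k) := by ring
    _ = _ := by
        rw [← ENNReal.ofReal_mul (by positivity), ← Real.rpow_add hL0]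
        congr 4; ring

end S17

open MeasureTheory Metric Set
open scoped ENNReal
namespace S17

variable {n : ℕ} {Ω : Type*} [MeasurableSpace Ω]

noncomputable def aJ (k : ℕ) : ℝ := 2 / (2 * (k : ℝ) - 1)

noncomputable def cMR (n k N : ℕ) : ℝ≥0∞ :=
  (((ENNReal.ofReal 4 ^ n) ^ aJ k) ^ k * cC n k (aJ k) ^ N * ((ENNReal.ofReal (2 * (1 + (2 + (N : ℝ) * n) ^ 2)) ^ n) ^ aJ k) ^ k *
    ENNReal.ofReal ((2 * (2 + (N : ℝ) * n)) ^ n)) ^ (1 - 1 / (2 * (k : ℝ))) * ENNReal.ofReal Real.pi ^ n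

theorem aJ_nonneg {k : ℕ} (hk : 1 ≤ k) : 0 ≤ aJ k := by
  unfold aJ
  have : (1:ℝ) ≤ k := by exact_mod_cast hk
  apply div_nonneg (by norm_num); linarith

theorem cMR_top (n N : ℕ) {k : ℕ} (hk : 1 ≤ k) : cMR n k N ≠ ⊤ := by
  unfold cMR
  have ha := aJ_nonneg hk
  have hk' : (1:ℝ) ≤ k := by exact_mod_cast hk
  refine ENNReal.mul_ne_top (ENNReal.rpow_ne_top_of_nonneg ?_ ?_) (ENNReal.pow_ne_top ENNReal.ofReal_ne_top)
  · have : 1 / (2 * (k:ℝ)) ≤ 1 / 2 := one_div_le_one_div_of_le (by norm_num) (by linarith)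
    linarith
  · refine ENNReal.mul_ne_top (ENNReal.mul_ne_top (ENNReal.mul_ne_top ?_ ?_) ?_) ENNReal.ofReal_ne_top
    · exact ENNReal.pow_ne_top (ENNReal.rpow_ne_top_of_nonneg ha (ENNReal.pow_ne_top ENNReal.ofReal_ne_top))
    · exact ENNReal.pow_ne_top (cC_top n k ha)
    · exact ENNReal.pow_ne_top (ENNReal.rpow_ne_top_of_nonneg ha (ENNReal.pow_ne_top ENNReal.ofReal_ne_top))

noncomputable def cM0 (n : ℕ) : ℝ≥0∞ := ENNReal.ofReal (Cv ^ 2 * Real.pi) ^ n * 4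
theorem cM0_top (n : ℕ) : cM0 n ≠ ⊤ := by
  unfold cM0; exact ENNReal.mul_ne_top (ENNReal.pow_ne_top ENNReal.ofReal_ne_top) (by norm_num)

variable {m : Measure Ω} {Y : Ω → Fin n → ℝ} {F : Fin n → Ω → ℂ}

theorem MR [SFinite m] (hY : Measurable Y) {B : ℝ} (J : Finset (Fin n)) (hJ : J.Nonempty)
    (hF : ∀ j ∈ J, Integrable (F j) m)
    (hB : ∀ j ∈ J, ∀ ω, F j ω ≠ 0 → ∀ i, |Y ω i| ≤ B)
    {M : ℝ} (hM : 1 ≤ M) {N : ℕ} (hN : 1 ≤ N)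
    (hoff : ∀ j ∈ J, ∀ ω ω', F j ω ≠ 0 → F j ω' ≠ 0 → ∀ i, i ∉ J → |Y ω i - Y ω' i| ≤ 1 / M ^ N)
    (hcv : ∀ j ∈ J, ∀ ω ω' D, F j ω ≠ 0 → F j ω' ≠ 0 → (∀ i, |Y ω i - Y ω' i| ≤ D) → |Y ω j - Y ω' j| ≤ D / M + 1 / M ^ N)
    (hsp : ∀ j ∈ J, ∀ ω ω', F j ω ≠ 0 → F j ω' ≠ 0 → ∀ i, |Y ω i - Y ω' i| ≤ 1)
    {K : ℝ≥0∞}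
    (hK : ∀ j ∈ J, ∀ F' : Ω → ℂ, Integrable F' m → (∀ ω, ‖F' ω‖ ≤ ‖F j ω‖) → ∫⁻ t, SQ m Y F' t ≤ K * ∫⁻ ω, ‖F' ω‖ₑ ^ 2 ∂m)
    (H : Measure (Fin n → ℝ)) [SFinite H] {A : ℝ≥0∞} {γ : ℝ}
    (hH : ∀ x r, 1 ≤ r → H (closedBall x r) ≤ A * ENNReal.ofReal (r ^ ((n : ℝ) - γ))) :
    ∃ b : Fin n → (Fin n → ℝ) → ℝ≥0∞, (∀ j, Measurable (b j)) ∧ (∀ j ∈ J, ∀ t, SQ m Y (F j) t ≤ cM0 n * b j t) ∧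
      (∀ j ∈ J, ∀ t h, b j (t + h) ≤ (∏ i, ENNReal.ofReal (2 * (1 + (h i) ^ 2))) * b j t) ∧
      ∫⁻ x, ∏ j ∈ J, b j x ^ (1 / (J.card : ℝ)) ∂H ≤
        cMR n J.card N * A * ENNReal.ofReal ((M ^ N) ^ (-(γ / (2 * J.card)))) * K * ∏ j ∈ J, (∫⁻ ω, ‖F j ω‖ₑ ^ 2 ∂m) ^ (1 / (J.card : ℝ)) := by
  classical
  set L := M ^ N with hLdef
  have hL : 1 ≤ L := one_le_pow₀ hM
  have hML : M ≤ L := by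
    calc M = M ^ 1 := by simp
      _ ≤ M ^ N := pow_le_pow_right₀ hM hN
  have hk : 1 ≤ J.card := hJ.card_pos
  have hk' : (1:ℝ) ≤ J.card := by exact_mod_cast hk
  have ha := aJ_nonneg hk
  have hst := fun j hj => lev_start hY (hF j hj) hM hML J (hoff j hj) (hcv j hj) (hsp j hj)
  choose! b0 l1 l2 using hst
  set b : Fin n → (Fin n → ℝ) → ℝ≥0∞ := fun j => if j ∈ J then b0 j else 0 with hb
  have hbJ : ∀ j ∈ J, b j = b0 j := fun j hj => by simp only [hb, hj, if_true]
  have hbm : ∀ j, Measurable (b j) := by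
    intro j
    by_cases hj : j ∈ J
    · rw [hbJ j hj]; exact (l1 j hj).meas hY
    · simp only [hb, hj, if_false]; exact measurable_const
  have hbs : ∀ j ∈ J, ∀ t h, b j (t + h) ≤ (∏ i, ENNReal.ofReal (2 * (1 + (h i) ^ 2))) * b j t := by
    intro j hj t h
    rw [hbJ j hj]
    refine ((l1 j hj).shift (av_pos hM hL J j 0) t h).trans ?_
    refine mul_le_mul_left (Finset.prod_le_prod' fun i _ => ENNReal.ofReal_le_ofReal ?_) _
    have h1 : 1 ≤ av M L J j 0 i := by
      unfold av
      split_ifs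
      · exact le_min (by simpa using hM) hL
      · simp
      · exact hL
    have h2 : (h i / av M L J j 0 i) ^ 2 ≤ h i ^ 2 := by
      rw [div_pow]
      exact div_le_self (sq_nonneg _) (one_le_pow₀ h1)
    linarith
  obtain ⟨b', k1, k2, k3⟩ := chain (m := m) hY J hB hM hoff hcv ha (by
    unfold aJ
    rw [div_mul_eq_mul_div, div_le_one (by linarith)]; linarith) hbm (fun j hj => by rw [hbJ j hj]; exact l1 j hj) N le_rfl
  have hav : ∀ j, av M L J j N = fun _ => L := by
    intro j; ext i; unfold av
    split_ifs
    · exact min_eq_right (pow_le_pow_right₀ hM (by omega))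
    · rfl
    · rfl
  have hL0 : 0 < L := by linarith
  refine ⟨b, hbm, ?_, hbs, ?_⟩
  · intro j hj t
    rw [hbJ j hj]
    refine (l2 j hj t).trans (le_of_eq ?_)
    unfold cM0; ring
  have E := endgame H (D := (N:ℝ) * n) hL hH J hJ (a := aJ J.card) rfl hbm k1 (c0 := ENNReal.ofReal 4 ^ n) (c1 := ENNReal.ofReal (2 * (1 + (2 + (N : ℝ) * n) ^ 2)) ^ n)
    (c2 := cC n J.card (aJ J.card) ^ N) (by positivity) (by
      intro j hj t h hh
      refine (hbs j hj t h).trans ?_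
      gcongr
      refine (Finset.prod_le_prod' (g := fun _ => ENNReal.ofReal 4) ?_).trans (by simp)
      intro i _
      apply ENNReal.ofReal_le_ofReal
      have h1 : |h i| ≤ 1 := (norm_le_pi_norm h i).trans hh
      have h2 : (h i) ^ 2 ≤ 1 := by rw [← sq_abs]; exact pow_le_one₀ (abs_nonneg _) h1
      linarith) (by
      intro j hj t h hh
      refine ((k2 j hj).shift (av_pos hM hL J j N) t h).trans ?_
      gcongr
      refine (Finset.prod_le_prod' (g := fun _ => ENNReal.ofReal (2 * (1 + (2 + (N : ℝ) * n) ^ 2))) ?_).trans (by simp)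
      intro i _
      apply ENNReal.ofReal_le_ofReal
      rw [hav j]
      have h1 : |h i| ≤ (2 + (N:ℝ) * n) * L := (norm_le_pi_norm h i).trans hh
      have h2 : (h i / L) ^ 2 ≤ (2 + (N : ℝ) * n) ^ 2 := by
        rw [← sq_abs, abs_div, abs_of_pos hL0]
        gcongr
        rwa [div_le_iff₀ hL0]
      linarith) (by
      intro x ρ
      have := k3 x ρ
      rwa [← mul_assoc] at this)
  refine E.trans ?_
  have hp : ∏ j ∈ J, (∫⁻ t, b' j t) ^ (1 / (J.card : ℝ)) ≤ ENNReal.ofReal Real.pi ^ n * K * ∏ j ∈ J, (∫⁻ ω, ‖F j ω‖ₑ ^ 2 ∂m) ^ (1 / (J.card : ℝ)) := by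
    calc _ ≤ ∏ j ∈ J, ((ENNReal.ofReal Real.pi ^ n * K) * ∫⁻ ω, ‖F j ω‖ₑ ^ 2 ∂m) ^ (1 / (J.card : ℝ)) := by
          gcongr with j hj
          rw [mul_assoc]
          exact (k2 j hj).lint hY (av_pos hM hL J j N) (hK j hj)
      _ = _ := by
          simp_rw [ENNReal.mul_rpow_of_nonneg _ _ (by positivity : 0 ≤ 1 / (J.card : ℝ)), Finset.prod_mul_distrib, Finset.prod_const]
          have hr : ∀ x : ℝ≥0∞, (x ^ (1 / (J.card : ℝ))) ^ J.card = x := by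
            intro x
            rw [← ENNReal.rpow_natCast _ J.card, ← ENNReal.rpow_mul, one_div_mul_cancel (by positivity), ENNReal.rpow_one]
          rw [hr, hr]
  refine (mul_le_mul_right hp _).trans (le_of_eq ?_)
  unfold cMR
  ring

end S17

open MeasureTheory Metric Set
open scoped ENNReal
namespace S17

variable {n : ℕ}

abbrev EE (n : ℕ) := EuclideanSpace ℝ (Fin n)

theorem exists_unit_perp (v : Fin n → EE n) (d : ℕ) (hd : d < n) :
    ∃ u : EE n, ‖u‖ = 1 ∧ ∀ i : Fin n, (i : ℕ) < d → inner ℝ (v i) u = (0:ℝ) := by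
  classical
  set s : Finset (EE n) := (Finset.univ.filter (fun i : Fin n => (i:ℕ) < d)).image v with hs
  have hc : s.card ≤ d := by
    refine Finset.card_image_le.trans ?_
    rw [Fin.card_filter_val_lt]; exact min_le_right _ _
  have hne : Submodule.span ℝ (s : Set (EE n)) ≠ ⊤ := by
    intro h
    have h1 := finrank_span_finset_le_card (R := ℝ) s
    rw [Set.finrank, h, finrank_top, finrank_euclideanSpace, Fintype.card_fin] at h1
    omega
  have h2 : (Submodule.span ℝ (s : Set (EE n)))ᗮ ≠ ⊥ := by
    rwa [Ne, Submodule.orthogonal_eq_bot_iff]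
  obtain ⟨u, hu, hu0⟩ := Submodule.exists_mem_ne_zero_of_ne_bot h2
  refine ⟨(‖u‖⁻¹ : ℝ) • u, ?_, ?_⟩
  · rw [norm_smul, norm_inv, norm_norm, inv_mul_cancel₀ (norm_ne_zero_iff.2 hu0)]
  · intro i hi
    rw [inner_smul_right]
    have := (Submodule.mem_orthogonal _ u).1 hu (v i) (Submodule.subset_span (by
      rw [hs]; simp only [Finset.coe_image, Finset.coe_filter, Finset.mem_univ, true_and]
      exact ⟨i, hi, rfl⟩))
    rw [this, mul_zero]

theorem greedy {k : ℕ} (hk : k ≤ n) {M : ℝ} (hM : 1 ≤ M) (w : Fin n → EE n)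
    (hw : ∀ i j : Fin n, (i:ℕ) < k → (j:ℕ) < k → inner ℝ (w i) (w j) = if i = j then (1:ℝ) else 0)
    (S : Set (EE n)) (hS : ∀ ξ ∈ S, ‖ξ‖ ≤ 2)
    (hbr : ∀ u : EE n, ‖u‖ = 1 → (∀ i : Fin n, (i:ℕ) < k → inner ℝ (w i) u = (0:ℝ)) → ∃ ξ ∈ S, 1 / M < |inner ℝ ξ u|) :
    ∃ v : Fin n → EE n, (∀ i : Fin n, (i:ℕ) < k → v i = w i) ∧ (∀ i : Fin n, k ≤ (i:ℕ) → v i ∈ S) ∧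
      ∀ c : Fin n → ℝ, ∀ i, |c i| ≤ (3 * M) ^ n * ‖∑ i, c i • v i‖ := by
  have main : ∀ e : ℕ, k + e ≤ n → ∃ v : Fin n → EE n, (∀ i : Fin n, (i:ℕ) < k → v i = w i) ∧
      (∀ i : Fin n, k ≤ (i:ℕ) → (i:ℕ) < k + e → v i ∈ S) ∧
      ∀ c : Fin n → ℝ, (∀ i : Fin n, k + e ≤ (i:ℕ) → c i = 0) → ∀ i, |c i| ≤ (3 * M) ^ e * ‖∑ i, c i • v i‖ := by
    intro e
    induction e with
    | zero =>
      intro _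
      refine ⟨w, fun _ _ => rfl, fun i h1 h2 => by omega, ?_⟩
      intro c hc i
      rw [pow_zero, one_mul]
      by_cases hi : (i:ℕ) < k
      · have h1 : inner ℝ (w i) (∑ j, c j • w j) = c i := by
          rw [inner_sum]
          simp_rw [inner_smul_right]
          rw [Finset.sum_eq_single i]
          · rw [hw i i hi hi]; simp
          · intro j _ hj
            by_cases hjk : (j:ℕ) < k
            · rw [hw i j hi hjk, if_neg (Ne.symm hj), mul_zero]
            · rw [hc j (by omega), zero_mul]
          · simp
        have hn : ‖w i‖ = 1 := by
          have := hw i i hi hi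
          rw [if_pos rfl, real_inner_self_eq_norm_sq] at this
          nlinarith [norm_nonneg (w i)]
        calc |c i| = |inner ℝ (w i) (∑ j, c j • w j)| := by rw [h1]
          _ ≤ ‖w i‖ * ‖∑ j, c j • w j‖ := abs_real_inner_le_norm _ _
          _ = _ := by rw [hn, one_mul]
      · rw [hc i (by omega), abs_zero]; exact norm_nonneg _
    | succ e ih =>
      intro he
      obtain ⟨v, h1, h2, h3⟩ := ih (by omega)
      obtain ⟨u, hu, hperp⟩ := exists_unit_perp v (k + e) (by omega)
      obtain ⟨ξ, hξ, hξu⟩ := hbr u hu (fun i hi => by rw [← h1 i hi]; exact hperp i (by omega))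
      set d : Fin n := ⟨k + e, by omega⟩ with hd
      have hne : ∀ i : Fin n, i ≠ d → (i:ℕ) ≠ k + e := fun i hi h => hi (Fin.ext h)
      refine ⟨Function.update v d ξ, ?_, ?_, ?_⟩
      · intro i hi
        rw [Function.update_of_ne]
        · exact h1 i hi
        · intro h; rw [h, hd] at hi; simp at hi
      · intro i hi1 hi2
        by_cases hid : i = d
        · rw [hid, Function.update_self]; exact hξ
        · rw [Function.update_of_ne hid]; exact h2 i hi1 (by have := hne i hid; omega)
      · intro c hc i
        set x := ∑ i, c i • Function.update v d ξ i with hx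
        have hsum : x = c d • ξ + ∑ i, (Function.update c d 0) i • v i := by
          rw [hx, ← Finset.add_sum_erase _ _ (Finset.mem_univ d), ← Finset.add_sum_erase (a := d) Finset.univ (fun i => (Function.update c d 0) i • v i) (Finset.mem_univ d)]
          simp only [Function.update_self, zero_smul, zero_add]
          congr 1
          apply Finset.sum_congr rfl
          intro j hj
          rw [Function.update_of_ne (Finset.ne_of_mem_erase hj), Function.update_of_ne (Finset.ne_of_mem_erase hj)]
        have hzero : ∀ i : Fin n, k + e ≤ (i:ℕ) → Function.update c d 0 i = 0 := by
          intro i hi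
          by_cases hid : i = d
          · rw [hid, Function.update_self]
          · rw [Function.update_of_ne hid]; exact hc i (by have := hne i hid; omega)
        have hin : inner ℝ x u = c d * inner ℝ ξ u := by
          rw [hsum, inner_add_left, inner_smul_left, sum_inner, Finset.sum_eq_zero, add_zero]
          · simp
          · intro i _
            rw [inner_smul_left]
            by_cases hi : (i:ℕ) < k + e
            · rw [hperp i hi, mul_zero]
            · rw [hzero i (by omega)]; simp
        have hcd : |c d| ≤ M * ‖x‖ := by
          have q1 : |c d| * (1 / M) ≤ ‖x‖ := by
            calc |c d| * (1 / M) ≤ |c d| * |inner ℝ ξ u| := by gcongr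
              _ = |inner ℝ x u| := by rw [hin, abs_mul]
              _ ≤ ‖x‖ * ‖u‖ := abs_real_inner_le_norm _ _
              _ = ‖x‖ := by rw [hu, mul_one]
          rw [mul_one_div, div_le_iff₀ (by linarith)] at q1
          linarith
        have hp : 1 ≤ (3 * M) ^ e := one_le_pow₀ (by linarith)
        have hx0 := norm_nonneg x
        by_cases hid : i = d
        · rw [hid]
          refine hcd.trans ?_
          rw [pow_succ]
          gcongr
          nlinarith
        · have q := h3 (Function.update c d 0) hzero i
          rw [Function.update_of_ne hid] at q
          have q2 : ‖∑ i, (Function.update c d 0) i • v i‖ ≤ (3 * M) * ‖x‖ := by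
            have : ∑ i, (Function.update c d 0) i • v i = x - c d • ξ := by rw [hsum]; abel
            rw [this]
            calc _ ≤ ‖x‖ + ‖c d • ξ‖ := norm_sub_le _ _
              _ ≤ ‖x‖ + (M * ‖x‖) * 2 := by
                rw [norm_smul, Real.norm_eq_abs]
                gcongr
                exact hS ξ hξ
              _ ≤ _ := by nlinarith
          refine q.trans ?_
          rw [pow_succ, mul_assoc]
          gcongr
  obtain ⟨v, h1, h2, h3⟩ := main (n - k) (by omega)
  refine ⟨v, h1, fun i hi => h2 i hi (by omega), ?_⟩
  intro c i
  refine (h3 c (fun i hi => by omega) i).trans ?_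
  gcongr
  · linarith
  · omega

end S17

open MeasureTheory Metric Set
open scoped ENNReal
namespace S17

variable {n : ℕ} {Ω : Type*} [MeasurableSpace Ω]

section
variable {m : Measure Ω} {Y : Ω → Fin n → ℝ}

/-- pieces localized in all the coordinates of `s` -/
noncomputable def pcs (Y : Ω → Fin n → ℝ) (a : ℝ) (s : Finset (Fin n)) (p : Fin n → ℤ) (F : Ω → ℂ) : Ω → ℂ :=
  {ω | ∀ i ∈ s, ⌊a * Y ω i⌋ = p i}.indicator F

theorem pcs_set_meas (hY : Measurable Y) (a : ℝ) (s : Finset (Fin n)) (p : Fin n → ℤ) :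
    MeasurableSet {ω | ∀ i ∈ s, ⌊a * Y ω i⌋ = p i} := by
  have : {ω | ∀ i ∈ s, ⌊a * Y ω i⌋ = p i} = ⋂ i ∈ s, {ω | ⌊a * Y ω i⌋ = p i} := by ext; simp
  rw [this]
  exact Finset.measurableSet_biInter _ (fun i _ => pc_set_meas hY i a (p i))

theorem pcs_integrable (hY : Measurable Y) {F : Ω → ℂ} (hF : Integrable F m) (a : ℝ) (s : Finset (Fin n)) (p : Fin n → ℤ) :
    Integrable (pcs Y a s p F) m := hF.indicator (pcs_set_meas hY a s p)

theorem pcs_orth_aux [SFinite m] (hY : Measurable Y) {F : Ω → ℂ} (hF : Integrable F m) {B : ℝ}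
    (hB : ∀ ω, F ω ≠ 0 → ∀ i, |Y ω i| ≤ B) {a : ℝ} (ha : 0 < a) (s : Finset (Fin n)) (t : Fin n → ℝ) :
    TT (fun _ => a) (SQ m Y F) t ≤ cO n ^ s.card * ∑' p : {p : Fin n → ℤ // ∀ i ∉ s, p i = 0}, TT (fun _ => a) (SQ m Y (pcs Y a s p F)) t := by
  induction s using Finset.induction_on with
  | empty =>
    simp only [Finset.card_empty, pow_zero, one_mul]
    refine le_trans (le_of_eq ?_) (ENNReal.le_tsum ⟨0, fun i _ => rfl⟩)
    simp [pcs]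
  | insert i s his ih =>
    refine ih.trans ?_
    rw [Finset.card_insert_of_notMem his, pow_succ, mul_assoc]
    refine mul_le_mul_right ?_ _
    have h1 : ∀ p : {p : Fin n → ℤ // ∀ i ∉ s, p i = 0}, TT (fun _ => a) (SQ m Y (pcs Y a s p F)) t ≤
        cO n * ∑' q : ℤ, TT (fun _ => a) (SQ m Y (pc Y i a q (pcs Y a s p F))) t := by
      intro p
      refine TT_orth hY (pcs_integrable hY hF a s p) i (fun _ => ha) (B := B) (fun ω hω => hB ω ?_ i) t
      intro h; apply hω; simp [pcs, indicator_apply, h]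
    refine (ENNReal.tsum_le_tsum h1).trans ?_
    rw [ENNReal.tsum_mul_left]
    refine mul_le_mul_right ?_ _
    rw [← ENNReal.tsum_prod (f := fun (p : {p : Fin n → ℤ // ∀ i ∉ s, p i = 0}) (q : ℤ) => TT (fun _ => a) (SQ m Y (pc Y i a q (pcs Y a s p F))) t)]
    set Φ : {p : Fin n → ℤ // ∀ i ∉ s, p i = 0} × ℤ → {p : Fin n → ℤ // ∀ j ∉ insert i s, p j = 0} := fun x =>
      ⟨Function.update x.1.1 i x.2, by
        intro j hj
        rw [Finset.mem_insert, not_or] at hj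
        rw [Function.update_of_ne hj.1]; exact x.1.2 j hj.2⟩ with hΦ
    have hinj : Function.Injective Φ := by
      rintro ⟨⟨p, hp⟩, q⟩ ⟨⟨p', hp'⟩, q'⟩ h
      simp only [hΦ, Subtype.mk.injEq] at h
      have hq : q = q' := by simpa using congrFun h i
      subst hq
      congr 2
      ext j
      by_cases hj : j = i
      · subst hj; rw [hp _ his, hp' _ his]
      · have := congrFun h j
        rw [Function.update_of_ne hj, Function.update_of_ne hj] at this
        exact this
    refine le_trans (le_of_eq ?_) (ENNReal.tsum_comp_le_tsum_of_injective hinj _)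
    congr 1; ext x
    congr 2
    obtain ⟨⟨p, hp⟩, q⟩ := x
    simp only [hΦ, pc, pcs]
    rw [indicator_indicator]
    congr 1
    ext ω
    simp only [mem_inter_iff, mem_setOf_eq, Finset.forall_mem_insert, Function.update_self]
    refine and_congr_right fun _ => forall₂_congr fun j hj => ?_
    rw [Function.update_of_ne (by rintro rfl; exact his hj)]

/-- the full cube pieces -/
noncomputable abbrev cub (Y : Ω → Fin n → ℝ) (a : ℝ) (p : Fin n → ℤ) (F : Ω → ℂ) : Ω → ℂ := pcs Y a Finset.univ p F

theorem cub_orth [SFinite m] (hY : Measurable Y) {F : Ω → ℂ} (hF : Integrable F m) {B : ℝ}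
    (hB : ∀ ω, F ω ≠ 0 → ∀ i, |Y ω i| ≤ B) {a : ℝ} (ha : 0 < a) (t : Fin n → ℝ) :
    TT (fun _ => a) (SQ m Y F) t ≤ cO n ^ n * ∑' p : Fin n → ℤ, TT (fun _ => a) (SQ m Y (cub Y a p F)) t := by
  refine (pcs_orth_aux hY hF hB ha Finset.univ t).trans ?_
  rw [Finset.card_univ, Fintype.card_fin]
  refine mul_le_mul_right ?_ _
  exact ENNReal.tsum_comp_le_tsum_of_injective Subtype.val_injective (fun p => TT (fun _ => a) (SQ m Y (cub Y a p F)) t)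

theorem cub_ne {a : ℝ} {p : Fin n → ℤ} {F : Ω → ℂ} {ω : Ω} (h : cub Y a p F ω ≠ 0) :
    F ω ≠ 0 ∧ ∀ i, ⌊a * Y ω i⌋ = p i := by
  have h1 : ω ∈ {ω | ∀ i ∈ Finset.univ, ⌊a * Y ω i⌋ = p i} := by
    by_contra hc; exact h (indicator_of_notMem hc _)
  refine ⟨?_, fun i => h1 i (Finset.mem_univ i)⟩
  intro h0; apply h; simp [pcs, indicator_apply, h0]

noncomputable def cL (n : ℕ) : ℝ≥0∞ := ENNReal.ofReal (Cv ^ 2 * Real.pi) ^ n * ENNReal.ofReal 4 ^ n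
theorem cL_top (n : ℕ) : cL n ≠ ⊤ := by
  unfold cL; exact ENNReal.mul_ne_top (ENNReal.pow_ne_top ENNReal.ofReal_ne_top) (ENNReal.pow_ne_top ENNReal.ofReal_ne_top)

theorem TT_shift_le {a : ℝ} (ha : 0 < a) (u : (Fin n → ℝ) → ℝ≥0∞) (t x : Fin n → ℝ) (h : x ∈ closedBall t a) :
    TT (fun _ => a) u x ≤ ENNReal.ofReal 4 ^ n * TT (fun _ => a) u t := by
  have := TT_shift (a := fun _ : Fin n => a) (fun _ => ha) u t (x - t)
  rw [add_sub_cancel] at this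
  refine this.trans (mul_le_mul_left ?_ _)
  rw [← Fin.prod_const]
  refine Finset.prod_le_prod' fun i _ => ENNReal.ofReal_le_ofReal ?_
  rw [mem_closedBall, dist_pi_le_iff ha.le] at h
  have h1 := h i
  rw [Real.dist_eq] at h1
  have : ((x - t) i / a) ^ 2 ≤ 1 := by
    rw [div_pow, div_le_one (by positivity), ← sq_abs]
    exact pow_le_pow_left₀ (abs_nonneg _) h1 2
  linarith

theorem locbd [SFinite m] (hY : Measurable Y) {F : Ω → ℂ} (hF : Integrable F m) {a : ℝ} (ha : 0 < a) {c : Fin n → ℝ}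
    (hs : ∀ ω, F ω ≠ 0 → ∀ i, |a * (Y ω i - c i)| ≤ 1) (t x : Fin n → ℝ) (h : x ∈ closedBall t a) :
    SQ m Y F x ≤ cL n * TT (fun _ => a) (SQ m Y F) t := by
  refine (repron hY hF (A := fun _ => a) (fun _ => ha) hs x).trans ?_
  unfold cL
  rw [mul_assoc]
  exact mul_le_mul_right (TT_shift_le ha _ t x h) _

theorem cub_loc [SFinite m] (hY : Measurable Y) {F : Ω → ℂ} (hF : Integrable F m) {a : ℝ} (ha : 0 < a) (p : Fin n → ℤ)
    (t x : Fin n → ℝ) (h : x ∈ closedBall t a) :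
    SQ m Y (cub Y a p F) x ≤ cL n * TT (fun _ => a) (SQ m Y (cub Y a p F)) t := by
  refine locbd hY (pcs_integrable hY hF a _ p) ha (c := fun i => p i / a) ?_ t x h
  intro ω hω i
  have h1 := (cub_ne hω).2 i
  have h2 := Int.floor_le (a * Y ω i)
  have h3 := Int.lt_floor_add_one (a * Y ω i)
  rw [h1] at h2 h3
  rw [mul_sub, mul_div_cancel₀ _ ha.ne', abs_le]
  constructor <;> linarith

end

/-! frequency space -/
def Y0 (ξ : EE n) : Fin n → ℝ := fun i => ξ i

theorem Y0_meas : Measurable (Y0 (n := n)) := by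
  unfold Y0
  exact measurable_pi_lambda _ (fun i => by fun_prop)

theorem inner_toLp (t : Fin n → ℝ) (ξ : EE n) : inner ℝ ξ (WithLp.toLp 2 t) = t ⬝ᵥ Y0 ξ := by
  simp [PiLp.inner_apply, dotProduct, Y0]

open FourierTransform in
theorem GG_fourier (F : EE n → ℂ) (t : Fin n → ℝ) : GG volume Y0 F t = 𝓕 F (-(WithLp.toLp 2 t)) := by
  rw [Real.fourier_eq]
  unfold GG
  congr 1; ext ξ
  rw [fourierChar_smul, inner_neg_right, neg_neg, inner_toLp, mul_comm]

open FourierTransform in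
theorem planch {F : EE n → ℂ} (hF : Integrable F) (hF2 : MemLp F 2) :
    ∫⁻ t, SQ volume Y0 F t = ∫⁻ ξ, ‖F ξ‖ₑ ^ 2 := by
  rw [← plancherel F hF hF2]
  unfold SQ
  simp_rw [GG_fourier]
  rw [← lintegral_neg_eq_self (fun x => ‖𝓕 F x‖ₑ ^ 2)]
  exact (PiLp.volume_preserving_toLp (Fin n)).lintegral_comp_emb (MeasurableEquiv.toLp 2 (Fin n → ℝ)).measurableEmbedding (fun x => ‖𝓕 F (-x)‖ₑ ^ 2)

theorem memLp2 {F : EE n → ℂ} (hF : Integrable F) (h : ∫⁻ ξ, ‖F ξ‖ₑ ^ 2 ≠ ⊤) : MemLp F 2 := by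
  refine ⟨hF.aestronglyMeasurable, ?_⟩
  rw [eLpNorm_lt_top_iff_lintegral_rpow_enorm_lt_top (by norm_num) (by norm_num)]
  simpa using h.lt_top

theorem planch_le {F : EE n → ℂ} (hF : Integrable F) :
    ∫⁻ t, SQ volume Y0 F t ≤ ∫⁻ ξ, ‖F ξ‖ₑ ^ 2 := by
  by_cases h : ∫⁻ ξ, ‖F ξ‖ₑ ^ 2 = ⊤
  · rw [h]; exact le_top
  · exact (planch hF (memLp2 hF h)).le

end S17

open MeasureTheory Metric Set
open scoped ENNReal
namespace S17

variable {n : ℕ}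

noncomputable def Yv (v : Fin n → EE n) (ξ : EE n) : Fin n → ℝ := fun i => inner ℝ (v i) ξ

theorem Yv_meas (v : Fin n → EE n) : Measurable (Yv v) := by
  unfold Yv
  exact measurable_pi_lambda _ (fun i => by fun_prop)

theorem norm2_le (x : Fin n → ℝ) : ‖(WithLp.toLp 2 x : EE n)‖ ≤ n * ‖x‖ := by
  have h : (WithLp.toLp 2 x : EE n) = ∑ i, x i • EuclideanSpace.single i (1:ℝ) := by
    ext j
    simp [Finset.sum_apply, Pi.single_apply]
  rw [h]
  refine (norm_sum_le _ _).trans ?_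
  calc _ ≤ ∑ i : Fin n, ‖x‖ := by
        refine Finset.sum_le_sum fun i _ => ?_
        rw [norm_smul, EuclideanSpace.norm_single, norm_one, mul_one]
        exact norm_le_pi_norm x i
    _ = _ := by simp

theorem lin_pack (v : Fin n → EE n) {B : ℝ} (hB : 0 ≤ B) (hv : ∀ c : Fin n → ℝ, ∀ i, |c i| ≤ B * ‖∑ i, c i • v i‖)
    (hv2 : ∀ i, ‖v i‖ ≤ 2) :
    ∃ T Ti : (Fin n → ℝ) → (Fin n → ℝ), Continuous T ∧ Continuous Ti ∧ (∀ x, T (Ti x) = x) ∧ (∀ t, Ti (T t) = t) ∧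
      (∀ x y i, |Ti x i - Ti y i| ≤ n * B * ‖x - y‖) ∧ (∀ x y, ‖T x - T y‖ ≤ 2 * n * ‖x - y‖) ∧
      (∀ ξ D, (∀ i, |inner ℝ (v i) ξ| ≤ D) → ‖ξ‖ ≤ n * B * D) ∧
      (∀ F t, GG volume (Yv v) F t = GG volume Y0 F (T t)) ∧
      (∀ F : EE n → ℂ, Integrable F → ∫⁻ t, SQ volume (Yv v) F t ≤ ENNReal.ofReal (n.factorial * B ^ n) * ∫⁻ ξ, ‖F ξ‖ₑ ^ 2) := by
  classical
  set A : Matrix (Fin n) (Fin n) ℝ := Matrix.of fun a i => v i a with hA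
  have hAt : ∀ t : Fin n → ℝ, (WithLp.toLp 2 (A.mulVec t) : EE n) = ∑ i, t i • v i := by
    intro t
    ext a
    simp [Matrix.mulVec, dotProduct, hA, Finset.sum_apply, mul_comm]
  have hinj : Function.Injective A.mulVec := by
    intro t t' h
    have h1 : A.mulVec (t - t') = 0 := by rw [Matrix.mulVec_sub, h, sub_self]
    have h2 := hAt (t - t')
    rw [h1] at h2
    ext i
    have h3 := hv (t - t') i
    rw [← h2] at h3
    simp only [WithLp.toLp_zero, norm_zero, mul_zero, Pi.sub_apply] at h3
    exact sub_eq_zero.1 (abs_nonpos_iff.1 h3)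
  have hu : IsUnit A := Matrix.mulVec_injective_iff_isUnit.1 hinj
  have hdet : IsUnit A.det := (Matrix.isUnit_iff_isUnit_det A).1 hu
  have h1 : ∀ x, A.mulVec (A⁻¹.mulVec x) = x := fun x => by
    rw [Matrix.mulVec_mulVec, Matrix.mul_nonsing_inv A hdet, Matrix.one_mulVec]
  have h2 : ∀ x, A⁻¹.mulVec (A.mulVec x) = x := fun x => by
    rw [Matrix.mulVec_mulVec, Matrix.nonsing_inv_mul A hdet, Matrix.one_mulVec]
  have hc : ∀ (A : Matrix (Fin n) (Fin n) ℝ), Continuous A.mulVec := fun A =>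
    A.mulVecLin.continuous_of_finiteDimensional
  have hTi : ∀ x i, |A⁻¹.mulVec x i| ≤ B * ‖(WithLp.toLp 2 x : EE n)‖ := by
    intro x i
    have := hv (A⁻¹.mulVec x) i
    rwa [← hAt, h1] at this
  have hent : ∀ i a, |A⁻¹ i a| ≤ B := by
    intro i a
    have := hTi (Pi.single a 1) i
    rw [Matrix.mulVec_single_one] at this
    have e : (WithLp.toLp 2 (Pi.single a 1) : EE n) = EuclideanSpace.single a (1:ℝ) := rfl
    rw [e, EuclideanSpace.norm_single, norm_one, mul_one] at this
    exact this
  have hdi : |A.det⁻¹| ≤ n.factorial * B ^ n := by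
    have := Matrix.det_le (A := A⁻¹) (abv := (AbsoluteValue.abs : AbsoluteValue ℝ ℝ)) (x := B) hent
    rw [Matrix.det_nonsing_inv, Ring.inverse_eq_inv'] at this
    simpa using this
  have hG : ∀ F t, GG volume (Yv v) F t = GG volume Y0 F (A.mulVec t) := by
    intro F t
    unfold GG
    congr 1; ext ξ
    congr 2
    rw [← inner_toLp, hAt, inner_sum]
    simp only [dotProduct, Yv, inner_smul_right]
    exact Finset.sum_congr rfl fun i _ => by rw [real_inner_comm]
  refine ⟨A.mulVec, A⁻¹.mulVec, hc _, hc _, h1, h2, ?_, ?_, ?_, hG, ?_⟩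
  · intro x y i
    rw [← Pi.sub_apply, ← Matrix.mulVec_sub]
    refine (hTi _ i).trans ?_
    calc _ ≤ B * (n * ‖x - y‖) := by gcongr; exact norm2_le _
      _ = _ := by ring
  · intro x y
    rw [← Matrix.mulVec_sub]
    rw [pi_norm_le_iff_of_nonneg (by positivity)]
    intro a
    have e : ‖A.mulVec (x - y) a‖ ≤ ‖(WithLp.toLp 2 (A.mulVec (x - y)) : EE n)‖ :=
      PiLp.norm_apply_le (WithLp.toLp 2 (A.mulVec (x - y)) : EE n) a
    refine e.trans ?_
    rw [hAt]
    refine (norm_sum_le _ _).trans ?_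
    calc _ ≤ ∑ i : Fin n, ‖x - y‖ * 2 := by
          refine Finset.sum_le_sum fun i _ => ?_
          rw [norm_smul]
          exact mul_le_mul (norm_le_pi_norm _ i) (hv2 i) (norm_nonneg _) (norm_nonneg _)
      _ = _ := by simp; ring
  · intro ξ D hD
    by_cases hξ : ξ = 0
    · rw [hξ, norm_zero]
      rcases Nat.eq_zero_or_pos n with h0 | h0
      · subst h0; simp
      · have : 0 ≤ D := (abs_nonneg _).trans (hD ⟨0, h0⟩)
        positivity
    have hpos : 0 < ‖ξ‖ := norm_pos_iff.2 hξ
    set c := A⁻¹.mulVec (Y0 ξ) with hcdef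
    have hs : ξ = ∑ i, c i • v i := by
      rw [← hAt, hcdef, h1]; rfl
    have hcb : ∀ i, |c i| ≤ B * ‖ξ‖ := by
      intro i; have := hv c i; rwa [← hs] at this
    have : ‖ξ‖ ^ 2 ≤ n * B * D * ‖ξ‖ := by
      calc ‖ξ‖ ^ 2 = inner ℝ (∑ i, c i • v i) ξ := by rw [← hs, real_inner_self_eq_norm_sq]
        _ = ∑ i, c i * inner ℝ (v i) ξ := by
            rw [sum_inner]; simp_rw [real_inner_smul_left]
        _ ≤ ∑ i : Fin n, (B * ‖ξ‖) * D := by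
            refine Finset.sum_le_sum fun i _ => (le_abs_self _).trans ?_
            rw [abs_mul]
            exact mul_le_mul (hcb i) (hD i) (abs_nonneg _) (by positivity)
        _ = _ := by simp; ring
    nlinarith
  · intro F hF
    have hm : Measurable (SQ volume Y0 F) := GG_meas Y0_meas hF
    have e : ∀ t, SQ volume (Yv v) F t = SQ volume Y0 F (Matrix.toLin' A t) := by
      intro t; unfold SQ; rw [hG, Matrix.toLin'_apply]
    simp_rw [e]
    have hcm : Measurable (Matrix.toLin' A) := (hc A).measurable
    rw [← lintegral_map hm hcm, Real.map_matrix_volume_pi_eq_smul_volume_pi hdet.ne_zero, lintegral_smul_measure, smul_eq_mul]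
    refine mul_le_mul' (ENNReal.ofReal_le_ofReal hdi) (planch_le hF)

end S17

open MeasureTheory Metric Set
open scoped ENNReal
namespace S17

variable {n : ℕ}

noncomputable def Jk (n k : ℕ) : Finset (Fin n) := Finset.univ.filter (fun i : Fin n => k ≤ (i:ℕ))

theorem mem_Jk {k : ℕ} {i : Fin n} : i ∈ Jk n k ↔ k ≤ (i:ℕ) := by simp [Jk]

theorem Jk_ne {k : ℕ} (hk : k < n) : (Jk n k).Nonempty := ⟨⟨k, hk⟩, mem_Jk.2 le_rfl⟩

noncomputable def cB (n : ℕ) (B Z : ℝ) : ℝ≥0∞ := cM0 n * ENNReal.ofReal (2 * (1 + (2 * n * B * Z) ^ 2)) ^ n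

theorem coord_norm {ξ : EE n} {Z : ℝ} (h : ∀ a, |ξ a| ≤ Z) (hn : 0 < n) : ‖ξ‖ ≤ n * Z := by
  have hZ : 0 ≤ Z := (abs_nonneg _).trans (h ⟨0, hn⟩)
  refine (norm2_le (fun a => ξ a)).trans ?_
  gcongr
  rw [pi_norm_le_iff_of_nonneg hZ]
  exact h

theorem prod_const_mul_rpow {ι : Type*} (J : Finset ι) (hJ : J.Nonempty) (c : ℝ≥0∞) (u : ι → ℝ≥0∞) :
    ∏ j ∈ J, (c * u j) ^ (1 / (J.card : ℝ)) = c * ∏ j ∈ J, u j ^ (1 / (J.card : ℝ)) := by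
  have hc : (J.card : ℝ) ≠ 0 := by exact_mod_cast hJ.card_pos.ne'
  simp_rw [ENNReal.mul_rpow_of_nonneg c _ (by positivity : (0:ℝ) ≤ 1 / (J.card : ℝ))]
  rw [Finset.prod_mul_distrib, Finset.prod_const, ← ENNReal.rpow_natCast, ← ENNReal.rpow_mul, one_div_mul_cancel hc, ENNReal.rpow_one]

theorem broad_one {k : ℕ} (hk : k < n) {M L Z B γ : ℝ} {N : ℕ} (hM : 1 ≤ M) (hN : 1 ≤ N) (hL : 1 ≤ L) (hML : M ^ N = L / 2)
    (hB1 : 1 ≤ B) (hZ : 2 * n ^ 2 * B * M ≤ Z)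
    (v : Fin n → EE n) (hv : ∀ c : Fin n → ℝ, ∀ i, |c i| ≤ B * ‖∑ i, c i • v i‖) (hv2 : ∀ i, ‖v i‖ ≤ 2)
    (f : Fin n → EE n → ℂ) (hf : ∀ j, Integrable (f j))
    (hsh : ∀ j ξ, f j ξ ≠ 0 → |‖ξ‖ ^ 2 - 1| ≤ 1 / L)
    (hw : ∀ j ξ, f j ξ ≠ 0 → ∀ i : Fin n, (i:ℕ) < k → |inner ℝ (v i) ξ| ≤ 1 / L)
    (hd : ∀ (j : Fin n) ξ, k ≤ (j:ℕ) → f j ξ ≠ 0 → ∀ a, |(ξ - v j) a| ≤ 1 / Z)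
    (hd2 : ∀ j ξ ξ', f j ξ ≠ 0 → f j ξ' ≠ 0 → ∀ a, |(ξ - ξ') a| ≤ 1 / Z)
    (H : Measure (Fin n → ℝ)) [SFinite H]
    (hH : ∀ x r, 1 ≤ r → H (closedBall x r) ≤ ENNReal.ofReal (r ^ ((n : ℝ) - γ))) :
    ∃ Bd : (Fin n → ℝ) → ℝ≥0∞, Measurable Bd ∧
      (∀ (x : Fin n → ℝ) (y : Fin n → Fin n → ℝ), (∀ j, ‖y j - x‖ ≤ 2 * Z) →
        ∏ j ∈ Jk n k, SQ volume Y0 (f j) (y j) ^ (1 / ((Jk n k).card : ℝ)) ≤ cB n B Z * Bd x) ∧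
      ∫⁻ x, Bd x ∂H ≤ cMR n (Jk n k).card N * ENNReal.ofReal ((2 * n) ^ ((n : ℝ) - γ)) *
        ENNReal.ofReal ((M ^ N) ^ (-(γ / (2 * (Jk n k).card)))) * ENNReal.ofReal (n.factorial * B ^ n) *
        ∏ j ∈ Jk n k, (∫⁻ ξ, ‖f j ξ‖ₑ ^ 2) ^ (1 / ((Jk n k).card : ℝ)) := by
  have hn : 0 < n := by omega
  have hn1 : (1:ℝ) ≤ n := by exact_mod_cast hn
  obtain ⟨T, Ti, hTc, hTic, hT1, hT2, hTi, hTl, hD, hG, hK⟩ := lin_pack v (by linarith) hv hv2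
  have hZn : 2 * n ≤ Z := by
    refine le_trans ?_ hZ
    have : (1:ℝ) ≤ n * B * M := by
      calc (1:ℝ) = 1 * 1 * 1 := by norm_num
        _ ≤ _ := by gcongr
    nlinarith
  have hZ0 : 0 < Z := by linarith
  have hMN : 1 / M ^ N = 2 / L := by rw [hML, one_div_div]
  have hpos : 0 < M ^ N := by positivity
  have hdiff : ∀ j ξ ξ', f j ξ ≠ 0 → f j ξ' ≠ 0 → ‖ξ - ξ'‖ ≤ n / Z := by
    intro j ξ ξ' h1 h2
    have := coord_norm (hd2 j ξ ξ' h1 h2) hn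
    rwa [mul_one_div] at this
  have hnZ : n / Z ≤ 1 / 2 := by rw [div_le_iff₀ hZ0]; linarith
  have hmr := MR (m := (volume : Measure (EE n))) (Y := Yv v) (F := f) (Yv_meas v) (B := 4) (Jk n k) (Jk_ne hk) (fun j _ => hf j)
    (by
      intro j _ ξ hξ i
      have h1 := abs_le.1 (hsh j ξ hξ)
      have h2 : 1 / L ≤ 1 := by rw [div_le_one (by linarith)]; exact hL
      have h3 : ‖ξ‖ ≤ 2 := by nlinarith [norm_nonneg ξ]
      unfold Yv
      refine (abs_real_inner_le_norm _ _).trans ?_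
      nlinarith [hv2 i, norm_nonneg ξ, norm_nonneg (v i)])
    hM hN
    (by
      intro j _ ξ ξ' h1 h2 i hi
      rw [mem_Jk, not_le] at hi
      unfold Yv
      have a1 := hw j ξ h1 i hi
      have a2 := hw j ξ' h2 i hi
      rw [hMN]
      calc _ ≤ _ := abs_sub _ _
        _ ≤ 1 / L + 1 / L := add_le_add a1 a2
        _ = _ := by ring)
    (by
      intro j hj ξ ξ' D h1 h2 hDD
      rw [mem_Jk] at hj
      unfold Yv at hDD ⊢
      simp_rw [← inner_sub_right] at hDD ⊢
      have b1 := hD _ D hDD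
      have hD0 : 0 ≤ D := (abs_nonneg _).trans (hDD j)
      have b2 := coord_norm (hd j ξ hj h1) hn
      have b3 := coord_norm (hd j ξ' hj h2) hn
      have e : 2 * inner ℝ (v j) (ξ - ξ') = ((‖ξ‖ ^ 2 - 1) - (‖ξ'‖ ^ 2 - 1)) - inner ℝ (ξ - ξ') ((ξ - v j) + (ξ' - v j)) := by
        rw [← real_inner_self_eq_norm_sq, ← real_inner_self_eq_norm_sq]
        simp only [inner_sub_left, inner_sub_right, inner_add_right]
        rw [real_inner_comm ξ (v j), real_inner_comm ξ' (v j), real_inner_comm ξ' ξ]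
        ring
      have e2 : |inner ℝ (ξ - ξ') ((ξ - v j) + (ξ' - v j))| ≤ (n * B * D) * (2 * (n * (1 / Z))) := by
        refine (abs_real_inner_le_norm _ _).trans ?_
        refine mul_le_mul b1 ?_ (norm_nonneg _) (by positivity)
        refine (norm_add_le _ _).trans ?_
        linarith
      have e3 : 2 * |inner ℝ (v j) (ξ - ξ')| ≤ 2 / L + (n * B * D) * (2 * (n * (1 / Z))) := by
        have := congrArg abs e
        rw [abs_mul, abs_two] at this
        rw [this]
        refine (abs_sub _ _).trans ?_
        refine add_le_add ((abs_sub _ _).trans ?_) e2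
        have a1 := hsh j ξ h1
        have a2 := hsh j ξ' h2
        calc _ ≤ 1 / L + 1 / L := add_le_add a1 a2
          _ = _ := by ring
      have e4 : (n * B * D) * (n * (1 / Z)) ≤ D / M := by
        rw [mul_one_div, mul_div_assoc', div_le_div_iff₀ hZ0 (by linarith)]
        have : 0 ≤ (n:ℝ) ^ 2 * B * M := by positivity
        nlinarith
      rw [hMN]
      have e5 : 0 ≤ 1 / L := by positivity
      have e6 : 2 / L = 2 * (1 / L) := by ring
      rw [e6] at e3 ⊢
      nlinarith)
    (by
      intro j _ ξ ξ' h1 h2 i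
      unfold Yv
      rw [← inner_sub_right]
      refine (abs_real_inner_le_norm _ _).trans ?_
      have := hdiff j ξ ξ' h1 h2
      nlinarith [hv2 i, norm_nonneg (v i), norm_nonneg (ξ - ξ')])
    (K := ENNReal.ofReal (n.factorial * B ^ n))
    (fun j _ F' hF' _ => hK F' hF')
    (H.map Ti) (A := ENNReal.ofReal ((2 * n) ^ ((n : ℝ) - γ))) (γ := γ)
    (by
      intro t r hr
      rw [Measure.map_apply hTic.measurable isClosed_closedBall.measurableSet]
      calc _ ≤ H (closedBall (T t) (2 * n * r)) := by
            apply measure_mono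
            intro x hx
            rw [mem_preimage, mem_closedBall, dist_eq_norm] at hx
            rw [mem_closedBall, dist_eq_norm]
            have := hTl (Ti x) t
            rw [hT1] at this
            refine this.trans ?_
            gcongr
        _ ≤ _ := hH _ _ (by nlinarith)
        _ = _ := by
            rw [Real.mul_rpow (by positivity) (by linarith), ENNReal.ofReal_mul (by positivity)])
  obtain ⟨b, hbm, hb1, hb2, hb3⟩ := hmr
  have hPm : Measurable (fun x => ∏ j ∈ Jk n k, b j x ^ (1 / ((Jk n k).card : ℝ))) := by
    apply Finset.measurable_fun_prod
    intro j _
    exact (hbm j).pow_const _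
  refine ⟨fun x => ∏ j ∈ Jk n k, b j (Ti x) ^ (1 / ((Jk n k).card : ℝ)), hPm.comp hTic.measurable, ?_, ?_⟩
  · intro x y hy
    rw [← prod_const_mul_rpow _ (Jk_ne hk)]
    refine Finset.prod_le_prod' fun j hj => ENNReal.rpow_le_rpow ?_ (by positivity)
    have c1 : SQ volume Y0 (f j) (y j) = SQ volume (Yv v) (f j) (Ti (y j)) := by
      unfold SQ; rw [hG, hT1]
    rw [c1]
    refine (hb1 j hj _).trans ?_
    have c2 := hb2 j hj (Ti x) (Ti (y j) - Ti x)
    rw [add_sub_cancel] at c2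
    unfold cB
    rw [mul_assoc]
    refine mul_le_mul_right (c2.trans ?_) _
    refine mul_le_mul_left ?_ _
    rw [← Fin.prod_const]
    refine Finset.prod_le_prod' fun i _ => ENNReal.ofReal_le_ofReal ?_
    have c3 : |(Ti (y j) - Ti x) i| ≤ 2 * n * B * Z := by
      refine (hTi (y j) x i).trans ?_
      calc _ ≤ n * B * (2 * Z) := by gcongr; exact hy j
        _ = _ := by ring
    have : ((Ti (y j) - Ti x) i) ^ 2 ≤ (2 * n * B * Z) ^ 2 := by
      rw [← sq_abs]; exact pow_le_pow_left₀ (abs_nonneg _) c3 2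
    linarith
  · rw [lintegral_map hPm hTic.measurable] at hb3
    exact hb3

end S17

open MeasureTheory Metric Set
open scoped ENNReal
namespace S17

variable {n : ℕ}

noncomputable def tz (Z c η : ℝ) : ℂ := ((Z * trap (1/4) (1/4) (Z * η) : ℝ) : ℂ) * ee (-(c * η))

theorem SS_neg (a x : ℝ) : SS a (-x) = SS a x := by
  unfold SS; rw [mul_neg, Real.sinc_neg]

open FourierTransform in
theorem trap_int (l : ℝ) : ∫ x, ee (x * l) * (trap (1/4) (1/4) x : ℂ) = ((SS (1/4) l ^ 2 : ℝ) : ℂ) := by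
  have h := fourier_trap (1/4) (1/4) (by norm_num) (by norm_num) (-l)
  rw [Real.fourier_real_eq, SS_neg] at h
  rw [sq, ← h]
  congr 1; ext v
  rw [fourierChar_smul]
  congr 2; ring

theorem tz_int {Z : ℝ} (hZ : 0 < Z) (c x : ℝ) : ∫ η, tz Z c η * ee (x * η) = ((SS (1/4) ((x - c) / Z) ^ 2 : ℝ) : ℂ) := by
  have h := scale_int (a := Z⁻¹) (by positivity) (trap (1/4) (1/4)) (x - c)
  rw [trap_int] at h
  rw [show (x - c) / Z = Z⁻¹ * (x - c) by rw [div_eq_inv_mul], ← h]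
  congr 1; ext η
  unfold tz
  rw [inv_inv, div_inv_eq_mul, mul_comm η Z, show η * (x - c) = -(c * η) + x * η by ring, ee_add]
  ring

theorem tz_integrable {Z : ℝ} (hZ : 0 < Z) (c : ℝ) : Integrable (tz Z c) := by
  unfold tz
  apply Integrable.mul_bdd (c := 1)
  · have h1 := (trap_integrable (1/4) (1/4) (by norm_num) (by norm_num)).comp_mul_left' hZ.ne'
    have := h1.const_mul (Z : ℂ)
    simpa using this
  · have := ee_continuous
    exact Continuous.aestronglyMeasurable (by fun_prop)
  · exact Filter.Eventually.of_forall fun ω => by simp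

theorem trap_bd (x : ℝ) : |trap (1/4) (1/4) x| ≤ 1 := by
  unfold trap
  rw [abs_of_nonneg (le_max_left _ _)]
  refine max_le (by norm_num) ?_
  have h1 := min_le_left (1/4) (x + 1/4)
  have h2 := le_max_left (-(1/4)) (x - 1/4)
  linarith

theorem tz_bd {Z : ℝ} (hZ : 0 < Z) (c η : ℝ) : ‖tz Z c η‖ ≤ Z := by
  unfold tz
  rw [norm_mul, norm_ee, mul_one, Complex.norm_real, Real.norm_eq_abs, abs_mul, abs_of_pos hZ]
  have := trap_bd (Z * η)
  nlinarith

theorem tz_supp {Z : ℝ} (hZ : 0 < Z) (c η : ℝ) (h : tz Z c η ≠ 0) : |η| ≤ 1 / Z := by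
  by_contra hc
  push Not at hc
  apply h
  unfold tz
  rw [trap_zero]
  · simp
  · rw [abs_mul, abs_of_pos hZ]
    rw [div_lt_iff₀ hZ] at hc
    linarith

noncomputable def PZ (Z : ℝ) (c : Fin n → ℝ) (η : EE n) : ℂ := ∏ i, tz Z (c i) (η i)

theorem PZ_integrable {Z : ℝ} (hZ : 0 < Z) (c : Fin n → ℝ) : Integrable (PZ Z c) := by
  have h : Integrable (fun s : Fin n → ℝ => ∏ i, tz Z (c i) (s i)) :=
    Integrable.fintype_prod (fun i => tz_integrable hZ (c i))
  exact ((PiLp.volume_preserving_ofLp (Fin n)).integrable_comp_emb (MeasurableEquiv.toLp 2 (Fin n → ℝ)).symm.measurableEmbedding).2 h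

theorem PZ_bd {Z : ℝ} (hZ : 0 < Z) (c : Fin n → ℝ) (η : EE n) : ‖PZ Z c η‖ ≤ Z ^ n := by
  unfold PZ
  rw [norm_prod]
  calc _ ≤ ∏ i : Fin n, Z := Finset.prod_le_prod (fun i _ => norm_nonneg _) (fun i _ => tz_bd hZ _ _)
    _ = _ := by simp

theorem GG_PZ {Z : ℝ} (hZ : 0 < Z) (c x : Fin n → ℝ) :
    GG volume Y0 (PZ Z c) x = ((∏ i, SS (1/4) ((x i - c i) / Z) ^ 2 : ℝ) : ℂ) := by
  unfold GG
  have e : ∀ η : EE n, PZ Z c η * ee (x ⬝ᵥ Y0 η) = (fun s : Fin n → ℝ => ∏ i, (tz Z (c i) (s i) * ee (x i * s i))) (WithLp.ofLp η) := by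
    intro η
    have h : ∀ (s : Finset (Fin n)), ee (∑ i ∈ s, x i * η i) = ∏ i ∈ s, ee (x i * η i) := by
      intro s
      induction s using Finset.induction_on with
      | empty => simp
      | insert a s ha ih => rw [Finset.sum_insert ha, Finset.prod_insert ha, ee_add, ih]
    simp only [PZ, dotProduct, Y0, h, Finset.prod_mul_distrib]
  simp_rw [e]
  rw [(PiLp.volume_preserving_ofLp (Fin n)).integral_comp (MeasurableEquiv.toLp 2 (Fin n → ℝ)).symm.measurableEmbedding
    (fun s : Fin n → ℝ => ∏ i, (tz Z (c i) (s i) * ee (x i * s i)))]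
  rw [integral_fintype_prod_volume_eq_prod (fun i (s : ℝ) => tz Z (c i) s * ee (x i * s))]
  simp_rw [tz_int hZ]
  push_cast
  rfl

theorem SS_lower {y : ℝ} (h : |y| ≤ 1) : 1 / 16 ≤ SS (1/4) y ^ 2 := by
  have h1 : ∀ y : ℝ, 0 ≤ y → y ≤ 1 → 1 / 4 ≤ SS (1/4) y := by
    intro y h0 h1
    unfold SS
    rcases h0.eq_or_lt with h0 | h0
    · rw [← h0]; norm_num
    have hp := Real.pi_pos
    rw [Real.sinc_of_ne_zero (by positivity)]
    have h3 := Real.mul_le_sin (x := 2 * Real.pi * (1/4) * y) (by positivity) (by nlinarith)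
    have h4 : 2 / Real.pi ≤ Real.sin (2 * Real.pi * (1/4) * y) / (2 * Real.pi * (1/4) * y) := by
      rw [le_div_iff₀ (by positivity)]; exact h3
    have h5 : 1 / 2 ≤ 2 / Real.pi := by
      rw [div_le_div_iff₀ (by norm_num) hp]; linarith [Real.pi_lt_four]
    linarith
  have h2 : 1 / 4 ≤ SS (1/4) y := by
    rcases abs_cases y with ⟨e, h'⟩ | ⟨e, h'⟩
    · exact h1 y h' (by linarith)
    · rw [← SS_neg]; exact h1 (-y) (by linarith) (by linarith)
  nlinarith

theorem SS_four : ∃ C, 0 < C ∧ ∀ x, (SS (1/4) x ^ 2) ^ 2 ≤ C * pp x := by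
  obtain ⟨C, hC, h⟩ := SS_sq_le (1/4) (by norm_num)
  refine ⟨C ^ 2, by positivity, fun x => ?_⟩
  have h1 : pp x ≤ 1 := by unfold pp; rw [div_le_one (by positivity)]; nlinarith [sq_nonneg x]
  have h2 := pp_pos x
  calc (SS (1/4) x ^ 2) ^ 2 ≤ (C * pp x) ^ 2 := pow_le_pow_left₀ (sq_nonneg _) (h x) 2
    _ = C ^ 2 * (pp x * pp x) := by ring
    _ ≤ C ^ 2 * (pp x * 1) := by gcongr
    _ = _ := by ring

noncomputable def CS : ℝ := SS_four.choose
theorem CS_pos : 0 < CS := SS_four.choose_spec.1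
theorem CS_le (x : ℝ) : (SS (1/4) x ^ 2) ^ 2 ≤ CS * pp x := SS_four.choose_spec.2 x

open FourierTransform in
theorem narrow_conv {Z : ℝ} (hZ : 0 < Z) {F : EE n → ℂ} (hF : Integrable F) (c : Fin n → ℝ) :
    ∃ F' : EE n → ℂ, Integrable F' ∧ (∀ ζ, F' ζ ≠ 0 → ∃ ξ, F ξ ≠ 0 ∧ ∀ i, |(ζ - ξ) i| ≤ 1 / Z) ∧
      (∀ x ∈ closedBall c Z, SQ volume Y0 F x ≤ ENNReal.ofReal (256 ^ n) * SQ volume Y0 F' x) ∧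
      ∫⁻ ξ, ‖F' ξ‖ₑ ^ 2 ≤ ENNReal.ofReal (CS ^ n * Z ^ n) * TT (fun _ => Z) (SQ volume Y0 F) c := by
  have hP := PZ_integrable hZ c
  set F' : EE n → ℂ := convolution F (PZ Z c) (ContinuousLinearMap.mul ℂ ℂ) volume with hF'
  have hFi : Integrable F' := hF.integrable_convolution _ hP
  have hGG : ∀ x, GG volume Y0 F' x = GG volume Y0 F x * ((∏ i, SS (1/4) ((x i - c i) / Z) ^ 2 : ℝ) : ℂ) := by
    intro x
    rw [← GG_PZ hZ, GG_fourier, GG_fourier, GG_fourier, hF', Real.fourier_mul_convolution_eq hF hP]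
  have hSQ : ∀ x, SQ volume Y0 F' x = ENNReal.ofReal ((∏ i, SS (1/4) ((x i - c i) / Z) ^ 2) ^ 2) * SQ volume Y0 F x := by
    intro x
    unfold SQ
    rw [hGG, enorm_mul, mul_pow, mul_comm]
    congr 1
    rw [← ofReal_norm, Complex.norm_real, ← ENNReal.ofReal_pow (norm_nonneg _), Real.norm_eq_abs, sq_abs]
  have hbd : ∀ ζ, ‖F' ζ‖ ≤ (∫ ξ, ‖F ξ‖) * Z ^ n := by
    intro ζ
    rw [hF', convolution_def]
    refine (norm_integral_le_integral_norm _).trans ?_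
    rw [← integral_mul_const]
    refine integral_mono_of_nonneg (Filter.Eventually.of_forall fun _ => norm_nonneg _) (hF.norm.mul_const _) (Filter.Eventually.of_forall fun ξ => ?_)
    simp only [ContinuousLinearMap.mul_apply', norm_mul]
    gcongr
    exact PZ_bd hZ c _
  have hL2 : ∫⁻ ξ, ‖F' ξ‖ₑ ^ 2 ≠ ⊤ := by
    have : ∫⁻ ξ, ‖F' ξ‖ₑ ^ 2 ≤ ENNReal.ofReal ((∫ ξ, ‖F ξ‖) * Z ^ n) * ∫⁻ ξ, ‖F' ξ‖ₑ := by
      rw [← lintegral_const_mul' _ _ ENNReal.ofReal_ne_top]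
      refine lintegral_mono fun ξ => ?_
      rw [sq]
      gcongr
      rw [← ofReal_norm]
      exact ENNReal.ofReal_le_ofReal (hbd ξ)
    exact (this.trans_lt (ENNReal.mul_lt_top ENNReal.ofReal_lt_top hFi.2)).ne
  refine ⟨F', hFi, ?_, ?_, ?_⟩
  · intro ζ hζ
    by_contra hc
    push Not at hc
    apply hζ
    rw [hF', convolution_def]
    have : ∀ ξ, (ContinuousLinearMap.mul ℂ ℂ) (F ξ) (PZ Z c (ζ - ξ)) = 0 := by
      intro ξ
      simp only [ContinuousLinearMap.mul_apply', mul_eq_zero]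
      by_cases h : F ξ = 0
      · exact Or.inl h
      · right
        obtain ⟨i, hi⟩ := hc ξ h
        unfold PZ
        rw [Finset.prod_eq_zero (Finset.mem_univ i)]
        by_contra h'
        exact absurd (tz_supp hZ _ _ h') (not_le.2 hi)
    simp [this]
  · intro x hx
    rw [hSQ, ← mul_assoc, ← ENNReal.ofReal_mul (by positivity)]
    have : 1 ≤ 256 ^ n * (∏ i, SS (1/4) ((x i - c i) / Z) ^ 2) ^ 2 := by
      have h1 : (1/16 : ℝ) ^ n ≤ ∏ i, SS (1/4) ((x i - c i) / Z) ^ 2 := by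
        rw [← Fin.prod_const]
        refine Finset.prod_le_prod (fun _ _ => by norm_num) fun i _ => SS_lower ?_
        rw [abs_div, abs_of_pos hZ, div_le_one hZ]
        rw [mem_closedBall, dist_pi_le_iff hZ.le] at hx
        exact hx i
      calc (1:ℝ) = 256 ^ n * ((1/16 : ℝ) ^ n) ^ 2 := by
            rw [← pow_mul, mul_comm n 2, pow_mul, ← mul_pow]; norm_num
        _ ≤ _ := by gcongr
    calc SQ volume Y0 F x = ENNReal.ofReal 1 * SQ volume Y0 F x := by simp
      _ ≤ _ := by gcongr
  · rw [← planch hFi (memLp2 hFi hL2)]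
    have ht := TT_shift_eq (fun _ : Fin n => Z) (SQ volume Y0 F) 0 c
    rw [zero_add] at ht
    rw [ht, ← lintegral_const_mul' _ _ ENNReal.ofReal_ne_top]
    refine lintegral_mono fun x => ?_
    rw [hSQ, zero_add, mul_comm (SQ volume Y0 F x), ← mul_assoc]
    refine mul_le_mul_left ?_ _
    unfold kk
    rw [← ENNReal.ofReal_prod_of_nonneg (fun i _ => by unfold kr; have := pp_pos ((x i - c i) / Z); positivity), ← ENNReal.ofReal_mul (by have := CS_pos; positivity)]
    apply ENNReal.ofReal_le_ofReal
    rw [← Finset.prod_pow, ← mul_pow, ← Fin.prod_const, ← Finset.prod_mul_distrib]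
    refine Finset.prod_le_prod (fun _ _ => by positivity) fun i _ => ?_
    unfold kr
    rw [mul_assoc, mul_inv_cancel_left₀ hZ.ne']
    exact CS_le _

end S17

open MeasureTheory Metric Set
open scoped ENNReal
namespace S17

variable {n : ℕ}

def CoreP (n : ℕ) (γ : ℝ) (k : ℕ) (κ : ℝ) (C : ℝ≥0∞) : Prop :=
  ∀ L : ℝ, 1 ≤ L → ∀ w : Fin n → EE n,
    (∀ i j : Fin n, (i:ℕ) < k → (j:ℕ) < k → inner ℝ (w i) (w j) = if i = j then (1:ℝ) else 0) →
    ∀ (H : Measure (Fin n → ℝ)), SFinite H → (∀ x r, 1 ≤ r → H (closedBall x r) ≤ ENNReal.ofReal (r ^ ((n : ℝ) - γ))) →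
    ∀ F : EE n → ℂ, Integrable F → (∀ ξ, F ξ ≠ 0 → |‖ξ‖ ^ 2 - 1| ≤ 1 / L) →
    (∀ ξ, F ξ ≠ 0 → ∀ i : Fin n, (i:ℕ) < k → |inner ℝ (w i) ξ| ≤ 1 / L) →
    ∫⁻ x, SQ volume Y0 F x ∂H ≤ C * ENNReal.ofReal (L ^ (-κ)) * ∫⁻ ξ, ‖F ξ‖ₑ ^ 2

noncomputable def cT (n : ℕ) : ℝ≥0∞ := ENNReal.ofReal (Cv ^ 2 * Real.pi) ^ n * (ENNReal.ofReal 10 ^ n * ENNReal.ofReal Real.pi ^ n)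
theorem cT_top (n : ℕ) : cT n ≠ ⊤ := by
  unfold cT
  exact ENNReal.mul_ne_top (ENNReal.pow_ne_top ENNReal.ofReal_ne_top) (ENNReal.mul_ne_top (ENNReal.pow_ne_top ENNReal.ofReal_ne_top) (ENNReal.pow_ne_top ENNReal.ofReal_ne_top))

theorem norm_le_two {ξ : EE n} {L : ℝ} (hL : 1 ≤ L) (h : |‖ξ‖ ^ 2 - 1| ≤ 1 / L) : ‖ξ‖ ≤ 3 / 2 := by
  have h1 := abs_le.1 h
  have h2 : 1 / L ≤ 1 := by rw [div_le_one (by linarith)]; exact hL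
  nlinarith [norm_nonneg ξ]

theorem coord_le (ξ : EE n) (i : Fin n) : |ξ i| ≤ ‖ξ‖ := PiLp.norm_apply_le ξ i

theorem trivial_bound {γ : ℝ} (H : Measure (Fin n → ℝ)) [SFinite H]
    (hH : ∀ x r, 1 ≤ r → H (closedBall x r) ≤ ENNReal.ofReal (r ^ ((n : ℝ) - γ)))
    {F : EE n → ℂ} (hF : Integrable F) (hs : ∀ ξ, F ξ ≠ 0 → ‖ξ‖ ≤ 2) :
    ∫⁻ x, SQ volume Y0 F x ∂H ≤ cT n * ∫⁻ ξ, ‖F ξ‖ₑ ^ 2 := by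
  set P := TT (fun _ : Fin n => (1/2:ℝ)) (SQ volume Y0 F) with hP
  have hm : Measurable (SQ volume Y0 F) := GG_meas Y0_meas hF
  have hPm : Measurable P := TT_measurable _ hm
  have h1 : ∀ x, SQ volume Y0 F x ≤ ENNReal.ofReal (Cv ^ 2 * Real.pi) ^ n * P x := by
    intro x
    refine repron Y0_meas hF (A := fun _ => (1/2:ℝ)) (c := 0) (fun _ => by norm_num) ?_ x
    intro ξ hξ i
    have a1 := coord_le ξ i
    have a2 := hs ξ hξ
    simp only [Pi.zero_apply, sub_zero, abs_mul, Y0]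
    rw [abs_of_pos (by norm_num : (0:ℝ) < 1/2)]
    linarith
  have h2 : ∀ c x, x ∈ closedBall c (1/2) → P x ≤ ENNReal.ofReal 10 ^ n * P c := by
    intro c x hx
    have := TT_shift_le (n := n) (a := 1/2) (by norm_num) (SQ volume Y0 F) c x hx
    refine this.trans ?_
    gcongr
    norm_num
  have h3 := avg_ball H hPm (r := 1/2) (by norm_num)
  norm_num at h3
  have h4 : ∫⁻ x, P x ∂H ≤ ENNReal.ofReal 10 ^ n * ∫⁻ x, P x := by
    rw [h3, ← lintegral_const_mul _ hPm]
    refine lintegral_mono fun c => ?_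
    calc _ ≤ ∫⁻ x in closedBall c (1/2), ENNReal.ofReal 10 ^ n * P c ∂H := by
          refine setLIntegral_mono' isClosed_closedBall.measurableSet fun x hx => h2 c x hx
      _ = ENNReal.ofReal 10 ^ n * P c * H (closedBall c (1/2)) := by rw [setLIntegral_const]
      _ ≤ ENNReal.ofReal 10 ^ n * P c * 1 := by
          gcongr
          refine (measure_mono (closedBall_subset_closedBall (by norm_num))).trans ((hH c 1 le_rfl).trans ?_)
          simp
      _ = _ := by rw [mul_one]
  calc ∫⁻ x, SQ volume Y0 F x ∂H ≤ ∫⁻ x, ENNReal.ofReal (Cv ^ 2 * Real.pi) ^ n * P x ∂H := lintegral_mono h1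
    _ = ENNReal.ofReal (Cv ^ 2 * Real.pi) ^ n * ∫⁻ x, P x ∂H := lintegral_const_mul _ hPm
    _ ≤ ENNReal.ofReal (Cv ^ 2 * Real.pi) ^ n * (ENNReal.ofReal 10 ^ n * (ENNReal.ofReal Real.pi ^ n * ∫⁻ ξ, ‖F ξ‖ₑ ^ 2)) := by
        refine mul_le_mul_right (h4.trans (mul_le_mul_right ?_ _)) _
        rw [hP, lintegral_TT (fun _ => by norm_num) hm]
        exact mul_le_mul_right (planch_le hF) _
    _ = _ := by unfold cT; ring

/-- sub-sum of cube pieces -/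
noncomputable def FS (Z : ℝ) (S : Finset (Fin n → ℤ)) (F : EE n → ℂ) : EE n → ℂ := fun ξ => ∑ p ∈ S, cub Y0 Z p F ξ

theorem cub_apply (Z : ℝ) (p : Fin n → ℤ) (F : EE n → ℂ) (ξ : EE n) :
    cub Y0 Z p F ξ = if p = (fun i => ⌊Z * Y0 ξ i⌋) then F ξ else 0 := by
  unfold cub pcs
  rw [indicator_apply]
  congr 1
  simp only [mem_setOf_eq, Finset.mem_univ, true_imp_iff, eq_iff_iff]
  constructor
  · intro h; ext i; exact (h i).symm
  · intro h i; rw [h]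

theorem FS_apply (Z : ℝ) (S : Finset (Fin n → ℤ)) (F : EE n → ℂ) (ξ : EE n) :
    FS Z S F ξ = if (fun i => ⌊Z * Y0 ξ i⌋) ∈ S then F ξ else 0 := by
  unfold FS
  simp_rw [cub_apply]
  rw [Finset.sum_ite_eq']

theorem cub_FS (Z : ℝ) (S : Finset (Fin n → ℤ)) (F : EE n → ℂ) (p : Fin n → ℤ) :
    cub Y0 Z p (FS Z S F) = if p ∈ S then cub Y0 Z p F else fun _ => 0 := by
  ext ξ
  rw [cub_apply, FS_apply]
  by_cases h : p = fun i => ⌊Z * Y0 ξ i⌋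
  · rw [if_pos h, ← h]
    split_ifs
    · rw [cub_apply, if_pos h]
    · rfl
  · rw [if_neg h]
    split_ifs
    · rw [cub_apply, if_neg h]
    · rfl

theorem SQ_zero : SQ volume (Y0 (n := n)) (fun _ => 0) = fun _ => 0 := by
  ext t; unfold SQ GG; simp

theorem FS_orth {F : EE n → ℂ} (hF : Integrable F) (hs : ∀ ξ, F ξ ≠ 0 → ‖ξ‖ ≤ 2) {Z : ℝ} (hZ : 0 < Z) (S : Finset (Fin n → ℤ))
    (c : Fin n → ℝ) : TT (fun _ => Z) (SQ volume Y0 (FS Z S F)) c ≤ cO n ^ n * ∑ p ∈ S, TT (fun _ => Z) (SQ volume Y0 (cub Y0 Z p F)) c := by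
  have hFS : Integrable (FS Z S F) := integrable_finsetSum _ fun p _ => pcs_integrable Y0_meas hF _ _ _
  refine (cub_orth Y0_meas hFS (B := 2) ?_ hZ c).trans ?_
  · intro ξ hξ i
    rw [FS_apply] at hξ
    have : F ξ ≠ 0 := by intro h; apply hξ; simp [h]
    exact (coord_le ξ i).trans (hs ξ this)
  · refine mul_le_mul_right ?_ _
    rw [tsum_eq_sum (s := S)]
    · refine le_of_eq (Finset.sum_congr rfl fun p hp => ?_)
      rw [cub_FS, if_pos hp]
    · intro p hp
      rw [cub_FS, if_neg hp, SQ_zero]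
      simp [TT]

theorem cell_narrow {γ κ : ℝ} {k : ℕ} (hk : k < n) {C : ℝ≥0∞} (hcore : CoreP n γ (k+1) κ C) {L M Z : ℝ} (hL : 1 ≤ L) (hM : 2 ≤ M)
    (hML : M ≤ L / 2) (hZ : 4 * n * M ≤ Z) (w : Fin n → EE n)
    (hw : ∀ i j : Fin n, (i:ℕ) < k → (j:ℕ) < k → inner ℝ (w i) (w j) = if i = j then (1:ℝ) else 0)
    (H : Measure (Fin n → ℝ)) [SFinite H] (hH : ∀ x r, 1 ≤ r → H (closedBall x r) ≤ ENNReal.ofReal (r ^ ((n : ℝ) - γ)))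
    {F : EE n → ℂ} (hF : Integrable F) (hsh : ∀ ξ, F ξ ≠ 0 → |‖ξ‖ ^ 2 - 1| ≤ 1 / L)
    (hwF : ∀ ξ, F ξ ≠ 0 → ∀ i : Fin n, (i:ℕ) < k → |inner ℝ (w i) ξ| ≤ 1 / L)
    (S : Finset (Fin n → ℤ)) (rp : (Fin n → ℤ) → EE n) (hrp : ∀ p ∈ S, ∀ ξ, cub Y0 Z p F ξ ≠ 0 → ∀ a, |(ξ - rp p) a| ≤ 1 / Z)
    (u : EE n) (hu : ‖u‖ = 1) (huw : ∀ i : Fin n, (i:ℕ) < k → inner ℝ (w i) u = (0:ℝ)) (huS : ∀ p ∈ S, |inner ℝ (rp p) u| ≤ 1 / M)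
    (c : Fin n → ℝ) :
    ∫⁻ x in closedBall c Z, SQ volume Y0 (FS Z S F) x ∂H ≤
      ENNReal.ofReal (256 ^ n) * (C * ENNReal.ofReal ((M / 2) ^ (-κ)) * (ENNReal.ofReal (CS ^ n * Z ^ n) *
        (cO n ^ n * ∑ p ∈ S, TT (fun _ => Z) (SQ volume Y0 (cub Y0 Z p F)) c))) := by
  have hn : 0 < n := by omega
  have hn1 : (1:ℝ) ≤ n := by exact_mod_cast hn
  have hZ0 : 0 < Z := by nlinarith
  have hFS : Integrable (FS Z S F) := integrable_finsetSum _ fun p _ => pcs_integrable Y0_meas hF _ _ _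
  obtain ⟨F', h1, h2, h3, h4⟩ := narrow_conv hZ0 hFS c
  have hnZ : n * (1 / Z) ≤ 1 / (4 * M) := by
    rw [mul_one_div, div_le_div_iff₀ hZ0 (by linarith)]; linarith
  have hM4 : 1 / (4 * M) = (1 / M) / 4 := by field_simp
  have hMi : 0 < 1 / M := by positivity
  have hMi2 : 1 / M ≤ 1 / 2 := one_div_le_one_div_of_le (by norm_num) hM
  have hLi : 1 / L ≤ (1 / M) / 2 := by
    rw [div_div]; exact one_div_le_one_div_of_le (by linarith) (by linarith)
  have hM2 : 1 / (M / 2) = 2 * (1 / M) := by field_simp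
  have hFne : ∀ ξ, FS Z S F ξ ≠ 0 → F ξ ≠ 0 ∧ ∃ p ∈ S, cub Y0 Z p F ξ ≠ 0 := by
    intro ξ h
    have h0 : F ξ ≠ 0 := by
      rw [FS_apply] at h; intro h'; apply h; simp [h']
    refine ⟨h0, ?_⟩
    by_contra hc
    push Not at hc
    exact h (Finset.sum_eq_zero hc)
  set d : Fin n := ⟨k, hk⟩ with hd
  have hcr := hcore (M / 2) (by linarith) (Function.update w d u) (by
      intro i j hi hj
      have hne : ∀ i : Fin n, i ≠ d → (i:ℕ) < k + 1 → (i:ℕ) < k := fun i h h' => by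
        have : (i:ℕ) ≠ k := fun e => h (Fin.ext e)
        omega
      by_cases h1 : i = d
      · by_cases h2 : j = d
        · rw [h1, h2, Function.update_self, if_pos rfl, real_inner_self_eq_norm_sq, hu]; norm_num
        · rw [h1, Function.update_self, Function.update_of_ne h2, if_neg (Ne.symm h2), real_inner_comm]
          exact huw j (hne j h2 hj)
      · by_cases h2 : j = d
        · rw [h2, Function.update_self, Function.update_of_ne h1, if_neg h1]
          exact huw i (hne i h1 hi)
        · rw [Function.update_of_ne h1, Function.update_of_ne h2]
          exact hw i j (hne i h1 hi) (hne j h2 hj))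
    H inferInstance hH F' h1 (by
      intro ζ hζ
      obtain ⟨ξ, hξ, hd⟩ := h2 ζ hζ
      have a1 := (coord_norm hd hn).trans hnZ
      have a2 := hsh ξ (hFne ξ hξ).1
      have a3 := norm_le_two hL a2
      have a4 := abs_norm_sub_norm_le ζ ξ
      have a6 : |‖ζ‖ - ‖ξ‖| ≤ 1 / M / 4 := by rw [← hM4]; linarith
      have a7 : ‖ζ‖ + ‖ξ‖ ≤ 4 := by have := abs_le.1 a6; linarith
      have a8 : |‖ζ‖ ^ 2 - ‖ξ‖ ^ 2| ≤ 1 / M / 4 * 4 := by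
        rw [show ‖ζ‖ ^ 2 - ‖ξ‖ ^ 2 = (‖ζ‖ - ‖ξ‖) * (‖ζ‖ + ‖ξ‖) by ring, abs_mul, abs_of_nonneg (by positivity : 0 ≤ ‖ζ‖ + ‖ξ‖)]
        exact mul_le_mul a6 a7 (by positivity) (by positivity)
      rw [hM2]
      have := abs_le.1 a8
      have := abs_le.1 a2
      rw [abs_le]; constructor <;> linarith)
    (by
      intro ζ hζ i hi
      obtain ⟨ξ, hξ, hd'⟩ := h2 ζ hζ
      have a1 := (coord_norm hd' hn).trans hnZ
      obtain ⟨b1, p, hp, b2⟩ := hFne ξ hξ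
      rw [hM2]
      by_cases hid : i = d
      · rw [hid, Function.update_self]
        have a2 := (coord_norm (hrp p hp ξ b2) hn).trans hnZ
        have a3 := huS p hp
        have e : inner ℝ u ζ = inner ℝ u (ζ - ξ) + inner ℝ u (ξ - rp p) + inner ℝ (rp p) u := by
          rw [real_inner_comm u (rp p)]; simp only [inner_sub_right]; ring
        have c1 := abs_real_inner_le_norm u (ζ - ξ)
        have c2 := abs_real_inner_le_norm u (ξ - rp p)
        rw [hu, one_mul] at c1 c2
        rw [e]
        refine (abs_add_three _ _ _).trans ?_
        linarith
      · have hik : (i:ℕ) < k := by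
          have : (i:ℕ) ≠ k := fun e => hid (Fin.ext e)
          omega
        rw [Function.update_of_ne hid]
        have hn' : ‖w i‖ = 1 := by
          have := hw i i hik hik
          rw [if_pos rfl, real_inner_self_eq_norm_sq] at this
          nlinarith [norm_nonneg (w i)]
        have c1 := abs_real_inner_le_norm (w i) (ζ - ξ)
        rw [hn', one_mul] at c1
        have e : inner ℝ (w i) ζ = inner ℝ (w i) (ζ - ξ) + inner ℝ (w i) ξ := by
          rw [inner_sub_right]; ring
        rw [e]
        refine (abs_add_le _ _).trans ?_
        have := hwF ξ b1 i hik
        linarith)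
  calc ∫⁻ x in closedBall c Z, SQ volume Y0 (FS Z S F) x ∂H
      ≤ ∫⁻ x in closedBall c Z, ENNReal.ofReal (256 ^ n) * SQ volume Y0 F' x ∂H :=
        setLIntegral_mono' isClosed_closedBall.measurableSet h3
    _ ≤ ∫⁻ x, ENNReal.ofReal (256 ^ n) * SQ volume Y0 F' x ∂H := setLIntegral_le_lintegral _ _
    _ = ENNReal.ofReal (256 ^ n) * ∫⁻ x, SQ volume Y0 F' x ∂H := lintegral_const_mul' _ _ ENNReal.ofReal_ne_top
    _ ≤ _ := by
        refine mul_le_mul_right (hcr.trans (mul_le_mul_right (h4.trans (mul_le_mul_right ?_ _)) _)) _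
        exact FS_orth hF (fun ξ h => (norm_le_two hL (hsh ξ h)).trans (by norm_num)) hZ0 S c

end S17

open MeasureTheory Metric Set
open scoped ENNReal
namespace S17

variable {n : ℕ}

theorem add_sq_le2 (a b : ℂ) : ‖a + b‖ₑ ^ 2 ≤ 2 * ‖a‖ₑ ^ 2 + 2 * ‖b‖ₑ ^ 2 := by
  have h : ‖a + b‖ ^ 2 ≤ 2 * ‖a‖ ^ 2 + 2 * ‖b‖ ^ 2 := by
    have := norm_add_le a b
    have h2 : ‖a + b‖ ^ 2 ≤ (‖a‖ + ‖b‖) ^ 2 := pow_le_pow_left₀ (norm_nonneg _) this 2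
    nlinarith [sq_nonneg (‖a‖ - ‖b‖)]
  have := ENNReal.ofReal_le_ofReal h
  rwa [ENNReal.ofReal_add (by positivity) (by positivity), ENNReal.ofReal_mul (by norm_num), ENNReal.ofReal_mul (by norm_num),
    ENNReal.ofReal_pow (norm_nonneg _), ENNReal.ofReal_pow (norm_nonneg _), ENNReal.ofReal_pow (norm_nonneg _),
    ofReal_norm_eq_enorm, ofReal_norm_eq_enorm, ofReal_norm_eq_enorm, ENNReal.ofReal_ofNat] at this

theorem sum_sq_le {ι : Type*} (S : Finset ι) (a : ι → ℂ) (K : ℝ≥0∞) (h : ∀ p ∈ S, ‖a p‖ₑ ^ 2 ≤ K) :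
    ‖∑ p ∈ S, a p‖ₑ ^ 2 ≤ (S.card : ℝ≥0∞) ^ 2 * K := by
  have e : (K ^ (1/2:ℝ)) ^ 2 = K := by
    rw [← ENNReal.rpow_natCast, ← ENNReal.rpow_mul]; norm_num
  have h1 : ∀ p ∈ S, ‖a p‖ₑ ≤ K ^ (1/2:ℝ) := by
    intro p hp
    have := ENNReal.rpow_le_rpow (h p hp) (by norm_num : (0:ℝ) ≤ 1/2)
    refine le_trans (le_of_eq ?_) this
    rw [← ENNReal.rpow_natCast, ← ENNReal.rpow_mul]; norm_num
  have h2 : ‖∑ p ∈ S, a p‖ₑ ≤ S.card * K ^ (1/2:ℝ) := by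
    refine (enorm_sum_le _ _).trans ?_
    refine (Finset.sum_le_sum h1).trans ?_
    rw [Finset.sum_const, nsmul_eq_mul]
  calc _ ≤ (S.card * K ^ (1/2:ℝ)) ^ 2 := by gcongr
    _ = _ := by rw [mul_pow, e]

theorem SQ_FS {F : EE n → ℂ} (hF : Integrable F) (Z : ℝ) (S : Finset (Fin n → ℤ)) (x : Fin n → ℝ) :
    GG volume Y0 (FS Z S F) x = ∑ p ∈ S, GG volume Y0 (cub Y0 Z p F) x :=
  GG_sum Y0_meas S (fun p _ => pcs_integrable Y0_meas hF _ _ _) x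

theorem SQ_cont {F : EE n → ℂ} (hF : Integrable F) : Continuous (SQ volume Y0 F) := by
  unfold SQ
  exact (ENNReal.continuous_pow 2).comp (GG_continuous Y0_meas hF).enorm

theorem cell {γ κ : ℝ} (hγ : 0 < γ) {k : ℕ} (hk : k < n) {C : ℝ≥0∞} (hcore : CoreP n γ (k+1) κ C) {L M Z : ℝ} (hL : 1 ≤ L) (hM : 2 ≤ M)
    (hML : M ≤ L / 2) (hZ : 4 * n * M ≤ Z) (w : Fin n → EE n)
    (hw : ∀ i j : Fin n, (i:ℕ) < k → (j:ℕ) < k → inner ℝ (w i) (w j) = if i = j then (1:ℝ) else 0)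
    (H : Measure (Fin n → ℝ)) [SFinite H] (hH : ∀ x r, 1 ≤ r → H (closedBall x r) ≤ ENNReal.ofReal (r ^ ((n : ℝ) - γ)))
    {F : EE n → ℂ} (hF : Integrable F) (hsh : ∀ ξ, F ξ ≠ 0 → |‖ξ‖ ^ 2 - 1| ≤ 1 / L)
    (hwF : ∀ ξ, F ξ ≠ 0 → ∀ i : Fin n, (i:ℕ) < k → |inner ℝ (w i) ξ| ≤ 1 / L)
    (T : Finset (Fin n → ℤ)) (hT : FS Z T F = F)
    (rp : (Fin n → ℤ) → EE n) (hrp : ∀ p ∈ T, ∀ ξ, cub Y0 Z p F ξ ≠ 0 → ∀ a, |(ξ - rp p) a| ≤ 1 / Z)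
    (hrp2 : ∀ p ∈ T, ‖rp p‖ ≤ 2) {cBB : ℝ≥0∞}
    (Bd : (Fin n → Fin n → ℤ) → (Fin n → ℝ) → ℝ≥0∞)
    (hBd : ∀ q ∈ Fintype.piFinset (fun _ : Fin n => T), (∀ c : Fin n → ℝ, ∀ i, |c i| ≤ (3 * M) ^ n * ‖∑ i, c i • (if (i:ℕ) < k then w i else rp (q i))‖) →
      ∀ (x : Fin n → ℝ) (y : Fin n → Fin n → ℝ), (∀ j, ‖y j - x‖ ≤ 2 * Z) →
        ∏ j ∈ Jk n k, SQ volume Y0 (cub Y0 Z (q j) F) (y j) ^ (1 / ((Jk n k).card : ℝ)) ≤ cBB * Bd q x)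
    (c : Fin n → ℝ) :
    ∫⁻ x in closedBall c Z, SQ volume Y0 F x ∂H ≤
      ENNReal.ofReal (Z ^ n) * (2 * (ENNReal.ofReal (256 ^ n) * (C * ENNReal.ofReal ((M / 2) ^ (-κ)) * (ENNReal.ofReal (CS ^ n) * cO n ^ n)))
        + 2 * ((T.card : ℝ≥0∞) ^ 2 * (ENNReal.ofReal (Z ^ (4 * n))⁻¹ * cL n))) * (∑ p ∈ T, TT (fun _ => Z) (SQ volume Y0 (cub Y0 Z p F)) c)
      + ∫⁻ x in closedBall c Z, (T.card : ℝ≥0∞) ^ 2 * (ENNReal.ofReal (Z ^ (4 * n)) * (cBB * ∑ q ∈ Fintype.piFinset (fun _ : Fin n => T), Bd q x)) ∂H := by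
  classical
  have hn : 0 < n := by omega
  have hn1 : (1:ℝ) ≤ n := by exact_mod_cast hn
  have hZ1 : 1 ≤ Z := by nlinarith
  have hZ0 : 0 < Z := by linarith
  have hmax : ∀ p, ∃ y ∈ closedBall c Z, ∀ x ∈ closedBall c Z, SQ volume Y0 (cub Y0 Z p F) x ≤ SQ volume Y0 (cub Y0 Z p F) y := by
    intro p
    obtain ⟨y, hy, h⟩ := (isCompact_closedBall c Z).exists_isMaxOn (nonempty_closedBall.2 hZ0.le)
      (SQ_cont (pcs_integrable Y0_meas hF Z Finset.univ p)).continuousOn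
    exact ⟨y, hy, fun x hx => h hx⟩
  choose y hy hmx using hmax
  set A : (Fin n → ℤ) → ℝ≥0∞ := fun p => SQ volume Y0 (cub Y0 Z p F) (y p) with hA
  set S : Finset (Fin n → ℤ) := T.filter (fun p => ∀ σ ∈ T, ENNReal.ofReal (Z ^ (4 * n))⁻¹ * A σ ≤ A p) with hS
  have hST : S ⊆ T := Finset.filter_subset _ _
  set a : ℝ≥0∞ := ∑ p ∈ T, TT (fun _ => Z) (SQ volume Y0 (cub Y0 Z p F)) c with ha
  by_cases hnar : ∃ u : EE n, ‖u‖ = 1 ∧ (∀ i : Fin n, (i:ℕ) < k → inner ℝ (w i) u = (0:ℝ)) ∧ ∀ p ∈ S, |inner ℝ (rp p) u| ≤ 1 / M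
  · refine le_trans ?_ le_self_add
    obtain ⟨u, hu, huw, huS⟩ := hnar
    have hcn := cell_narrow hk hcore hL hM hML hZ w hw H hH hF hsh hwF S rp (fun p hp => hrp p (hST hp)) u hu huw huS c
    have hin : ∀ x ∈ closedBall c Z, SQ volume Y0 (FS Z (T \ S) F) x ≤ (T.card : ℝ≥0∞) ^ 2 * (ENNReal.ofReal (Z ^ (4 * n))⁻¹ * cL n * a) := by
      intro x hx
      unfold SQ
      rw [SQ_FS hF]
      refine (sum_sq_le _ _ (ENNReal.ofReal (Z ^ (4 * n))⁻¹ * cL n * a) ?_).trans ?_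
      · intro p hp
        rw [Finset.mem_sdiff, hS, Finset.mem_filter, not_and] at hp
        have h2 := hp.2 hp.1
        push Not at h2
        obtain ⟨σ, hσ, hlt⟩ := h2
        refine (hmx p x hx).trans (hlt.le.trans ?_)
        rw [mul_assoc]
        refine mul_le_mul_right ?_ _
        refine (cub_loc Y0_meas hF hZ0 σ c (y σ) (hy σ)).trans ?_
        refine mul_le_mul_right ?_ _
        exact Finset.single_le_sum (f := fun p => TT (fun _ => Z) (SQ volume Y0 (cub Y0 Z p F)) c) (fun _ _ => zero_le) hσ
      · gcongr
        exact Finset.sdiff_subset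
    have hsum : ∀ x ∈ closedBall c Z, SQ volume Y0 F x ≤ 2 * SQ volume Y0 (FS Z S F) x + 2 * ((T.card : ℝ≥0∞) ^ 2 * (ENNReal.ofReal (Z ^ (4 * n))⁻¹ * cL n * a)) := by
      intro x hx
      refine le_trans ?_ (add_le_add_right (mul_le_mul_right (hin x hx) 2) _)
      rw [show SQ volume Y0 F x = SQ volume Y0 (FS Z T F) x by rw [hT]]
      unfold SQ
      rw [SQ_FS hF Z T, ← Finset.sum_sdiff hST, SQ_FS hF, SQ_FS hF, add_comm]
      exact add_sq_le2 _ _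
    have hSm : Measurable (SQ volume Y0 (FS Z S F)) :=
      GG_meas Y0_meas (integrable_finsetSum _ fun p _ => pcs_integrable Y0_meas hF _ _ _)
    have hHQ : H (closedBall c Z) ≤ ENNReal.ofReal (Z ^ n) := by
      refine (hH c Z hZ1).trans (ENNReal.ofReal_le_ofReal ?_)
      rw [← Real.rpow_natCast]
      exact Real.rpow_le_rpow_of_exponent_le hZ1 (by linarith)
    have hsub : ∑ p ∈ S, TT (fun _ => Z) (SQ volume Y0 (cub Y0 Z p F)) c ≤ a := Finset.sum_le_sum_of_subset hST
    calc ∫⁻ x in closedBall c Z, SQ volume Y0 F x ∂H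
        ≤ ∫⁻ x in closedBall c Z, (2 * SQ volume Y0 (FS Z S F) x + 2 * ((T.card : ℝ≥0∞) ^ 2 * (ENNReal.ofReal (Z ^ (4 * n))⁻¹ * cL n * a))) ∂H :=
          setLIntegral_mono' isClosed_closedBall.measurableSet hsum
      _ = 2 * ∫⁻ x in closedBall c Z, SQ volume Y0 (FS Z S F) x ∂H + 2 * ((T.card : ℝ≥0∞) ^ 2 * (ENNReal.ofReal (Z ^ (4 * n))⁻¹ * cL n * a)) * H (closedBall c Z) := by
          rw [lintegral_add_right _ measurable_const, lintegral_const_mul _ hSm, setLIntegral_const]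
      _ ≤ 2 * (ENNReal.ofReal (256 ^ n) * (C * ENNReal.ofReal ((M / 2) ^ (-κ)) * (ENNReal.ofReal (CS ^ n * Z ^ n) *
        (cO n ^ n * a)))) + 2 * ((T.card : ℝ≥0∞) ^ 2 * (ENNReal.ofReal (Z ^ (4 * n))⁻¹ * cL n * a)) * ENNReal.ofReal (Z ^ n) := by
          refine add_le_add (mul_le_mul_right (hcn.trans ?_) 2) (mul_le_mul_right hHQ _)
          gcongr
      _ = _ := by
          rw [ENNReal.ofReal_mul (by have := CS_pos; positivity)]
          ring
  · refine le_trans ?_ le_add_self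
    refine setLIntegral_mono' isClosed_closedBall.measurableSet fun x hx => ?_
    push Not at hnar
    obtain ⟨v, hv1, hv2, hv3⟩ := greedy hk.le (by linarith : 1 ≤ M) w hw (rp '' (S : Set (Fin n → ℤ)))
      (by rintro _ ⟨p, hp, rfl⟩; exact hrp2 p (hST hp))
      (by
        intro u hu huw
        obtain ⟨p, hp, h⟩ := hnar u hu huw
        exact ⟨rp p, ⟨p, hp, rfl⟩, h⟩)
    obtain ⟨p0, hp0, -⟩ := hv2 ⟨k, hk⟩ le_rfl
    have hq : ∀ i : Fin n, ∃ p ∈ S, k ≤ (i:ℕ) → rp p = v i := by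
      intro i
      by_cases h : k ≤ (i:ℕ)
      · obtain ⟨p, hp, e⟩ := hv2 i h
        exact ⟨p, hp, fun _ => e⟩
      · exact ⟨p0, hp0, fun h' => absurd h' h⟩
    choose q hqS hqv using hq
    have hvq : ∀ i : Fin n, (if (i:ℕ) < k then w i else rp (q i)) = v i := by
      intro i
      split_ifs with h
      · exact (hv1 i h).symm
      · exact hqv i (not_lt.1 h)
    have hqT : q ∈ Fintype.piFinset (fun _ : Fin n => T) := Fintype.mem_piFinset.2 fun i => hST (hqS i)
    have hB := hBd q hqT (by simp_rw [hvq]; exact hv3) x (fun j => y (q j)) (by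
      intro j
      have h1 := mem_closedBall.1 (hy (q j))
      have h2 := mem_closedBall'.1 hx
      rw [← dist_eq_norm]
      linarith [dist_triangle (y (q j)) c x])
    rw [show SQ volume Y0 F x = SQ volume Y0 (FS Z T F) x by rw [hT]]
    unfold SQ
    rw [SQ_FS hF]
    refine sum_sq_le _ _ _ fun σ hσ => (hmx σ x hx).trans ?_
    have hJ := Jk_ne hk
    have hAσ : ∀ j, A σ ≤ ENNReal.ofReal (Z ^ (4 * n)) * A (q j) := by
      intro j
      have h1 := (Finset.mem_filter.1 (hqS j)).2 σ hσ
      calc A σ = ENNReal.ofReal (Z ^ (4 * n)) * (ENNReal.ofReal (Z ^ (4 * n))⁻¹ * A σ) := by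
            rw [← mul_assoc, ← ENNReal.ofReal_mul (by positivity), mul_inv_cancel₀ (by positivity), ENNReal.ofReal_one, one_mul]
        _ ≤ _ := mul_le_mul_right h1 _
    have e1 := prod_const_mul_rpow (Jk n k) hJ (A σ) (fun _ => 1)
    have e2 := prod_const_mul_rpow (Jk n k) hJ (ENNReal.ofReal (Z ^ (4 * n))) (fun j => A (q j))
    simp only [mul_one, ENNReal.one_rpow, Finset.prod_const_one] at e1
    have h3 : A σ ≤ ENNReal.ofReal (Z ^ (4 * n)) * ∏ j ∈ Jk n k, A (q j) ^ (1 / ((Jk n k).card : ℝ)) := by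
      rw [← e2, ← e1]
      exact Finset.prod_le_prod' fun j _ => ENNReal.rpow_le_rpow (hAσ j) (by positivity)
    refine h3.trans (mul_le_mul_right (hB.trans (mul_le_mul_right ?_ _)) _)
    exact Finset.single_le_sum (f := fun q => Bd q x) (fun _ _ => zero_le) hqT

end S17

open MeasureTheory Metric Set
open scoped ENNReal
namespace S17

variable {n : ℕ}

theorem sum_cub_le {F : EE n → ℂ} (hF : Integrable F) (Z : ℝ) (T : Finset (Fin n → ℤ)) :
    ∑ p ∈ T, ∫⁻ ξ, ‖cub Y0 Z p F ξ‖ₑ ^ 2 ≤ ∫⁻ ξ, ‖F ξ‖ₑ ^ 2 := by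
  rw [← lintegral_finsetSum' T (fun p _ => by
    have := (pcs_integrable Y0_meas hF Z Finset.univ p).aestronglyMeasurable.enorm
    exact this.pow_const 2)]
  refine lintegral_mono fun ξ => ?_
  simp only [cub_apply]
  have : ∀ p : Fin n → ℤ, ‖(if p = (fun i => ⌊Z * Y0 ξ i⌋) then F ξ else 0)‖ₑ ^ 2 = if p = (fun i => ⌊Z * Y0 ξ i⌋) then ‖F ξ‖ₑ ^ 2 else 0 := by
    intro p; split_ifs <;> simp
  simp only [this]
  rw [Finset.sum_ite_eq']
  split_ifs
  · exact le_rfl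
  · exact zero_le

theorem grid {F : EE n → ℂ} (hs : ∀ ξ, F ξ ≠ 0 → ‖ξ‖ ≤ 2) {Z : ℝ} (hZ : 1 ≤ Z) :
    ∃ (T : Finset (Fin n → ℤ)) (rp : (Fin n → ℤ) → EE n), FS Z T F = F ∧
      (∀ p, ∀ ξ ξ', cub Y0 Z p F ξ ≠ 0 → cub Y0 Z p F ξ' ≠ 0 → ∀ a, |(ξ - ξ') a| ≤ 1 / Z) ∧
      (∀ p ∈ T, ∀ ξ, cub Y0 Z p F ξ ≠ 0 → ∀ a, |(ξ - rp p) a| ≤ 1 / Z) ∧ (∀ p ∈ T, ‖rp p‖ ≤ 2) ∧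
      (T.card : ℝ≥0∞) ≤ ENNReal.ofReal ((6 * Z) ^ n) := by
  classical
  set rp : (Fin n → ℤ) → EE n := fun p => if h : ∃ ξ, cub Y0 Z p F ξ ≠ 0 then h.choose else 0 with hrp
  have hZ0 : 0 < Z := by linarith
  have hsame : ∀ p, ∀ ξ ξ', cub Y0 Z p F ξ ≠ 0 → cub Y0 Z p F ξ' ≠ 0 → ∀ a, |(ξ - ξ') a| ≤ 1 / Z := by
    intro p ξ ξ' h h' a
    have h1 := (cub_ne h).2 a
    have h2 := (cub_ne h').2 a
    have h3 := Int.abs_sub_lt_one_of_floor_eq_floor (h1.trans h2.symm)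
    rw [← mul_sub, abs_mul, abs_of_pos hZ0] at h3
    rw [le_div_iff₀ hZ0]
    have : (ξ - ξ') a = Y0 ξ a - Y0 ξ' a := rfl
    rw [this]; linarith
  refine ⟨Fintype.piFinset (fun _ => Finset.Icc ⌊-(2 * Z)⌋ ⌊2 * Z⌋), rp, ?_, hsame, ?_, ?_, ?_⟩
  · ext ξ
    rw [FS_apply]
    by_cases h : F ξ = 0
    · simp [h]
    · rw [if_pos]
      rw [Fintype.mem_piFinset]
      intro i
      have h1 := abs_le.1 ((coord_le ξ i).trans (hs ξ h))
      rw [Finset.mem_Icc]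
      constructor
      · apply Int.floor_le_floor
        have : Y0 ξ i = ξ i := rfl
        rw [this]; nlinarith
      · apply Int.floor_le_floor
        have : Y0 ξ i = ξ i := rfl
        rw [this]; nlinarith
  · intro p _ ξ h
    have hex : ∃ ξ, cub Y0 Z p F ξ ≠ 0 := ⟨ξ, h⟩
    simp only [hrp, dif_pos hex]
    exact hsame p ξ _ h hex.choose_spec
  · intro p _
    simp only [hrp]
    split_ifs with h
    · exact hs _ (cub_ne h.choose_spec).1
    · simp
  · rw [Fintype.card_piFinset_const, Int.card_Icc, Nat.cast_pow, ENNReal.ofReal_pow (by positivity)]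
    gcongr
    rw [← ENNReal.ofReal_natCast]
    apply ENNReal.ofReal_le_ofReal
    have h1 := Int.floor_le (2 * Z)
    have h2 := Int.lt_floor_add_one (-(2 * Z))
    have h3 : (((⌊2 * Z⌋ + 1 - ⌊-(2 * Z)⌋).toNat : ℤ) : ℝ) = ((⌊2 * Z⌋ + 1 - ⌊-(2 * Z)⌋ : ℤ) : ℝ) := by
      rw [Int.toNat_of_nonneg]
      have : ⌊-(2 * Z)⌋ ≤ ⌊2 * Z⌋ := Int.floor_le_floor (by linarith)
      omega
    rw [Int.cast_natCast] at h3
    rw [h3]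
    push_cast
    linarith

theorem step_one {γ κ : ℝ} (hγ : 0 < γ) {k : ℕ} (hk : k < n) {C : ℝ≥0∞} (hcore : CoreP n γ (k+1) κ C) {L M Z : ℝ} {N : ℕ} (hN : 1 ≤ N)
    (hL : 1 ≤ L) (hM : 2 ≤ M)
    (hMN : M ^ N = L / 2) (hZ : 2 * n ^ 2 * (3 * M) ^ n * M ≤ Z) (w : Fin n → EE n)
    (hw : ∀ i j : Fin n, (i:ℕ) < k → (j:ℕ) < k → inner ℝ (w i) (w j) = if i = j then (1:ℝ) else 0)
    (H : Measure (Fin n → ℝ)) [SFinite H] (hH : ∀ x r, 1 ≤ r → H (closedBall x r) ≤ ENNReal.ofReal (r ^ ((n : ℝ) - γ)))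
    {F : EE n → ℂ} (hF : Integrable F) (hsh : ∀ ξ, F ξ ≠ 0 → |‖ξ‖ ^ 2 - 1| ≤ 1 / L)
    (hwF : ∀ ξ, F ξ ≠ 0 → ∀ i : Fin n, (i:ℕ) < k → |inner ℝ (w i) ξ| ≤ 1 / L) :
    ∫⁻ x, SQ volume Y0 F x ∂H ≤
      ((2 * (ENNReal.ofReal (256 ^ n) * (C * ENNReal.ofReal ((M / 2) ^ (-κ)) * (ENNReal.ofReal (CS ^ n) * cO n ^ n)))
        + 2 * ((ENNReal.ofReal ((6 * Z) ^ n)) ^ 2 * (ENNReal.ofReal (Z ^ (4 * n))⁻¹ * cL n))) * ENNReal.ofReal Real.pi ^ n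
      + (ENNReal.ofReal ((6 * Z) ^ n)) ^ 2 * (ENNReal.ofReal (Z ^ (4 * n)) * (cB n ((3 * M) ^ n) Z * ((ENNReal.ofReal ((6 * Z) ^ n)) ^ n *
        (cMR n (Jk n k).card N * ENNReal.ofReal ((2 * n) ^ ((n : ℝ) - γ)) *
        ENNReal.ofReal ((M ^ N) ^ (-(γ / (2 * (Jk n k).card)))) * ENNReal.ofReal (n.factorial * ((3 * M) ^ n) ^ n)))))) * ∫⁻ ξ, ‖F ξ‖ₑ ^ 2 := by
  classical
  have hn : 0 < n := by omega
  have hn1 : (1:ℝ) ≤ n := by exact_mod_cast hn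
  have hB1 : 1 ≤ (3 * M) ^ n := one_le_pow₀ (by linarith)
  have hB3 : 3 * M ≤ (3 * M) ^ n := le_self_pow₀ (by linarith) hn.ne'
  have hZ4 : 4 * n * M ≤ Z := by
    refine le_trans ?_ hZ
    have h1 : (n:ℝ) * M * 2 ≤ n * M * (n * (3 * M) ^ n) := by
      refine mul_le_mul_of_nonneg_left ?_ (by positivity)
      nlinarith
    nlinarith
  have hZ1 : 1 ≤ Z := by nlinarith
  have hZ0 : 0 < Z := by linarith
  have hML : M ≤ L / 2 := by rw [← hMN]; exact le_self_pow₀ (by linarith) (by omega)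
  have hs : ∀ ξ, F ξ ≠ 0 → ‖ξ‖ ≤ 2 := fun ξ h => (norm_le_two hL (hsh ξ h)).trans (by norm_num)
  obtain ⟨T, rp, hT, hsame, hrp, hrp2, hcard⟩ := grid hs hZ1
  set E := ∫⁻ ξ, ‖F ξ‖ₑ ^ 2 with hE
  set good : (Fin n → Fin n → ℤ) → Prop := fun q => ∀ c : Fin n → ℝ, ∀ i, |c i| ≤ (3 * M) ^ n * ‖∑ i, c i • (if (i:ℕ) < k then w i else rp (q i))‖ with hgood
  set KB : ℝ≥0∞ := cMR n (Jk n k).card N * ENNReal.ofReal ((2 * n) ^ ((n : ℝ) - γ)) *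
        ENNReal.ofReal ((M ^ N) ^ (-(γ / (2 * (Jk n k).card)))) * ENNReal.ofReal (n.factorial * ((3 * M) ^ n) ^ n) with hKB
  have hcubF : ∀ p, Integrable (cub Y0 Z p F) := fun p => pcs_integrable Y0_meas hF Z Finset.univ p
  have hcubE : ∀ p, ∫⁻ ξ, ‖cub Y0 Z p F ξ‖ₑ ^ 2 ≤ E := by
    intro p
    have := sum_cub_le hF Z {p}
    rwa [Finset.sum_singleton] at this
  have hex : ∀ q, ∃ Bd : (Fin n → ℝ) → ℝ≥0∞, Measurable Bd ∧ (q ∈ Fintype.piFinset (fun _ : Fin n => T) → good q →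
      ∀ (x : Fin n → ℝ) (y : Fin n → Fin n → ℝ), (∀ j, ‖y j - x‖ ≤ 2 * Z) →
        ∏ j ∈ Jk n k, SQ volume Y0 (cub Y0 Z (q j) F) (y j) ^ (1 / ((Jk n k).card : ℝ)) ≤ cB n ((3 * M) ^ n) Z * Bd x) ∧
      ∫⁻ x, Bd x ∂H ≤ KB * E := by
    intro q
    by_cases hq : q ∈ Fintype.piFinset (fun _ : Fin n => T) ∧ good q
    · obtain ⟨hqT, hg⟩ := hq
      rw [Fintype.mem_piFinset] at hqT
      have hfne : ∀ (j : Fin n) ξ, (if k ≤ (j:ℕ) then cub Y0 Z (q j) F else fun _ => 0) ξ ≠ 0 → k ≤ (j:ℕ) ∧ cub Y0 Z (q j) F ξ ≠ 0 := by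
        intro j ξ h
        split_ifs at h with h1
        · exact ⟨h1, h⟩
        · exact absurd rfl h
      obtain ⟨Bd, b1, b2, b3⟩ := broad_one hk (by linarith : 1 ≤ M) hN hL hMN hB1 hZ
        (fun i => if (i:ℕ) < k then w i else rp (q i)) hg (by
          intro i
          split_ifs with h
          · have := hw i i h h
            rw [if_pos rfl, real_inner_self_eq_norm_sq] at this
            nlinarith [norm_nonneg (w i)]
          · exact hrp2 _ (hqT i))
        (fun j => if k ≤ (j:ℕ) then cub Y0 Z (q j) F else fun _ => 0)
        (by intro j; split_ifs; exacts [hcubF _, integrable_zero _ _ _])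
        (fun j ξ h => hsh ξ (cub_ne (hfne j ξ h).2).1)
        (by
          intro j ξ h i hi
          rw [if_pos hi]
          exact hwF ξ (cub_ne (hfne j ξ h).2).1 i hi)
        (by
          intro j ξ hj h
          rw [if_neg (not_lt.2 hj)]
          exact hrp _ (hqT j) ξ (hfne j ξ h).2)
        (fun j ξ ξ' h h' => hsame _ ξ ξ' (hfne j ξ h).2 (hfne j ξ' h').2) H hH
      refine ⟨Bd, b1, fun _ _ x y hy => ?_, b3.trans ?_⟩
      · refine le_trans (le_of_eq ?_) (b2 x y hy)
        refine Finset.prod_congr rfl fun j hj => ?_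
        rw [if_pos (mem_Jk.1 hj)]
      · refine mul_le_mul_right ?_ _
        have e1 := prod_const_mul_rpow (Jk n k) (Jk_ne hk) E (fun _ => 1)
        simp only [mul_one, ENNReal.one_rpow, Finset.prod_const_one] at e1
        conv_rhs => rw [← e1]
        refine Finset.prod_le_prod' fun j hj => ENNReal.rpow_le_rpow ?_ (by positivity)
        rw [if_pos (mem_Jk.1 hj)]
        exact hcubE _
    · exact ⟨fun _ => 0, measurable_const, fun h1 h2 => absurd ⟨h1, h2⟩ hq, by simp⟩
  choose Bd hBm hB1' hB2 using hex
  have hcell := fun c => cell hγ hk hcore hL hM hML hZ4 w hw H hH hF hsh hwF T hT rp hrp hrp2 Bd (fun q h1 h2 => hB1' q h1 h2) c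
  have hm : Measurable (SQ volume Y0 F) := GG_meas Y0_meas hF
  have hav := avg_ball H hm (r := Z) hZ0.le
  set W : (Fin n → ℝ) → ℝ≥0∞ := fun x => (T.card : ℝ≥0∞) ^ 2 * (ENNReal.ofReal (Z ^ (4 * n)) * (cB n ((3 * M) ^ n) Z * ∑ q ∈ Fintype.piFinset (fun _ : Fin n => T), Bd q x)) with hW
  have hsm : Measurable (fun x => ∑ q ∈ Fintype.piFinset (fun _ : Fin n => T), Bd q x) := Finset.measurable_sum _ fun q _ => hBm q
  have hWm : Measurable W := by
    rw [hW]
    exact ((hsm.const_mul _).const_mul _).const_mul _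
  have havW := avg_ball H hWm (r := Z) hZ0.le
  set α : ℝ≥0∞ := (2 * (ENNReal.ofReal (256 ^ n) * (C * ENNReal.ofReal ((M / 2) ^ (-κ)) * (ENNReal.ofReal (CS ^ n) * cO n ^ n)))
        + 2 * ((T.card : ℝ≥0∞) ^ 2 * (ENNReal.ofReal (Z ^ (4 * n))⁻¹ * cL n))) with hα
  have hTTm : ∀ p, Measurable (fun c => TT (fun _ => Z) (SQ volume Y0 (cub Y0 Z p F)) c) := fun p => TT_measurable _ (GG_meas Y0_meas (hcubF p))
  have hsumTm : Measurable (fun c => ∑ p ∈ T, TT (fun _ => Z) (SQ volume Y0 (cub Y0 Z p F)) c) := Finset.measurable_sum _ fun p _ => hTTm p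
  have hsumT : ∫⁻ c, ∑ p ∈ T, TT (fun _ => Z) (SQ volume Y0 (cub Y0 Z p F)) c ≤ ENNReal.ofReal Real.pi ^ n * E := by
    rw [lintegral_finsetSum _ fun p _ => hTTm p]
    calc ∑ p ∈ T, ∫⁻ c, TT (fun _ => Z) (SQ volume Y0 (cub Y0 Z p F)) c
        ≤ ∑ p ∈ T, ENNReal.ofReal Real.pi ^ n * ∫⁻ ξ, ‖cub Y0 Z p F ξ‖ₑ ^ 2 := by
          refine Finset.sum_le_sum fun p _ => ?_
          have hmp : Measurable (SQ volume Y0 (cub Y0 Z p F)) := GG_meas Y0_meas (hcubF p)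
          rw [lintegral_TT (fun _ => hZ0) hmp]
          exact mul_le_mul_right (planch_le (hcubF p)) _
      _ = ENNReal.ofReal Real.pi ^ n * ∑ p ∈ T, ∫⁻ ξ, ‖cub Y0 Z p F ξ‖ₑ ^ 2 := by rw [Finset.mul_sum]
      _ ≤ _ := mul_le_mul_right (sum_cub_le hF Z T) _
  have hWI : ∫⁻ x, W x ∂H ≤ (T.card : ℝ≥0∞) ^ 2 * (ENNReal.ofReal (Z ^ (4 * n)) * (cB n ((3 * M) ^ n) Z * ((T.card : ℝ≥0∞) ^ n * (KB * E)))) := by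
    rw [hW, lintegral_const_mul _ ((hsm.const_mul _).const_mul _), lintegral_const_mul _ (hsm.const_mul _), lintegral_const_mul _ hsm]
    refine mul_le_mul_right (mul_le_mul_right (mul_le_mul_right ?_ _) _) _
    rw [lintegral_finsetSum _ fun q _ => hBm q]
    refine (Finset.sum_le_sum fun q _ => hB2 q).trans ?_
    rw [Finset.sum_const, Fintype.card_piFinset_const, nsmul_eq_mul, Nat.cast_pow]
  have hmain : ENNReal.ofReal ((2 * Z) ^ n) * ∫⁻ x, SQ volume Y0 F x ∂H ≤
      ENNReal.ofReal ((2 * Z) ^ n) * (α * (ENNReal.ofReal Real.pi ^ n * E) + ∫⁻ x, W x ∂H) := by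
    rw [hav, mul_add, havW]
    calc _ ≤ ∫⁻ c, (ENNReal.ofReal (Z ^ n) * α * (∑ p ∈ T, TT (fun _ => Z) (SQ volume Y0 (cub Y0 Z p F)) c) + ∫⁻ x in closedBall c Z, W x ∂H) :=
          lintegral_mono hcell
      _ = ENNReal.ofReal (Z ^ n) * α * (∫⁻ c, ∑ p ∈ T, TT (fun _ => Z) (SQ volume Y0 (cub Y0 Z p F)) c) + ∫⁻ c, ∫⁻ x in closedBall c Z, W x ∂H := by
          rw [lintegral_add_left (hsumTm.const_mul _), lintegral_const_mul _ hsumTm]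
      _ ≤ _ := by
          refine add_le_add ?_ le_rfl
          rw [mul_assoc]
          refine mul_le_mul' (ENNReal.ofReal_le_ofReal ?_) (mul_le_mul_right hsumT _)
          exact pow_le_pow_left₀ hZ0.le (by linarith) n
  have h0 : ENNReal.ofReal ((2 * Z) ^ n) ≠ 0 := by
    rw [ne_eq, ENNReal.ofReal_eq_zero, not_le]; positivity
  rw [ENNReal.mul_le_mul_iff_right h0 ENNReal.ofReal_ne_top] at hmain
  refine hmain.trans ((add_le_add_right hWI _).trans ?_)
  rw [add_mul _ _ E]
  refine add_le_add ?_ ?_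
  · rw [mul_assoc _ _ E]
    exact mul_le_mul_left (add_le_add_right (mul_le_mul_right (mul_le_mul_left (pow_le_pow_left' hcard 2) _) 2) _) _
  · simp only [mul_assoc]
    gcongr

end S17

open MeasureTheory Metric Set
open scoped ENNReal
namespace S17

variable {n : ℕ}

def KK (n : ℕ) : ℕ := (n + 1) * (2 * n) + (n + 1) * (4 * n) + (2 * n + 2 * (n + 1)) * n + (n + 1) * (n * n) + n * n
noncomputable def cK (n : ℕ) : ℝ :=
  (12 * n ^ 2) ^ (2 * n) * (2 * n ^ 2) ^ (4 * n) * (64 * n ^ 6) ^ n * (12 * n ^ 2) ^ (n * n) * 3 ^ (KK n)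

theorem num_bound (hn : 1 ≤ n) {M : ℝ} (hM : 1 ≤ M) {Z : ℝ} (hZ : Z = 2 * n ^ 2 * (3 * M) ^ (n + 1)) :
    ((6 * Z) ^ n) ^ 2 * (Z ^ (4 * n) * ((2 * (1 + (2 * n * (3 * M) ^ n * Z) ^ 2)) ^ n * (((6 * Z) ^ n) ^ n * ((3 * M) ^ n) ^ n))) ≤ cK n * M ^ (KK n) := by
  have hn1 : (1:ℝ) ≤ n := by exact_mod_cast hn
  set T := 3 * M with hT
  have hT1 : 1 ≤ T := by linarith
  have hZ1 : 1 ≤ Z := by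
    rw [hZ]
    calc (1:ℝ) ≤ 2 * 1 ^ 2 * 1 ^ (n+1) := by norm_num
      _ ≤ _ := by gcongr
  have h1 : 1 ≤ (2 * n * T ^ n * Z) ^ 2 := by
    apply one_le_pow₀
    calc (1:ℝ) ≤ 2 * 1 * 1 ^ n * 1 := by norm_num
      _ ≤ _ := by gcongr
  have h2 : 2 * (1 + (2 * n * T ^ n * Z) ^ 2) ≤ 64 * n ^ 6 * T ^ (2 * n + 2 * (n + 1)) := by
    calc _ ≤ 4 * (2 * n * T ^ n * Z) ^ 2 := by linarith
      _ = _ := by rw [hZ]; ring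
  calc _ ≤ ((6 * Z) ^ n) ^ 2 * (Z ^ (4 * n) * ((64 * n ^ 6 * T ^ (2 * n + 2 * (n + 1))) ^ n * (((6 * Z) ^ n) ^ n * (T ^ n) ^ n))) := by gcongr
    _ = (12 * n ^ 2 * T ^ (n+1)) ^ (2 * n) * ((2 * n ^ 2 * T ^ (n+1)) ^ (4 * n) * ((64 * n ^ 6 * T ^ (2 * n + 2 * (n + 1))) ^ n * ((12 * n ^ 2 * T ^ (n+1)) ^ (n * n) * T ^ (n * n)))) := by
        rw [← pow_mul, ← pow_mul, ← pow_mul, mul_comm n 2, hZ]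
        congr 2
        · ring
        · congr 2
          ring
    _ = (12 * n ^ 2) ^ (2 * n) * (2 * n ^ 2) ^ (4 * n) * (64 * n ^ 6) ^ n * (12 * n ^ 2) ^ (n * n) * T ^ (KK n) := by
        rw [mul_pow _ (T ^ (n+1)) (2*n), mul_pow _ (T ^ (n+1)) (4*n), mul_pow _ (T ^ (n+1)) (n*n), mul_pow _ (T ^ (2 * n + 2 * (n+1))) n]
        rw [← pow_mul T, ← pow_mul T, ← pow_mul T, ← pow_mul T]
        unfold KK
        rw [pow_add T _ (n * n), pow_add T _ ((n+1) * (n * n)), pow_add T _ ((2 * n + 2 * (n + 1)) * n), pow_add T]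
        generalize T ^ ((n+1) * (2*n)) = t1
        generalize T ^ ((n+1) * (4*n)) = t2
        generalize T ^ ((2 * n + 2 * (n + 1)) * n) = t3
        generalize T ^ ((n+1) * (n*n)) = t4
        generalize T ^ (n*n) = t5
        generalize (12 * (n:ℝ) ^ 2) ^ (2 * n) = t6
        generalize (12 * (n:ℝ) ^ 2) ^ (n * n) = t7
        generalize (2 * (n:ℝ) ^ 2) ^ (4 * n) = t8
        generalize (64 * (n:ℝ) ^ 6) ^ n = t9
        ring
    _ = _ := by
        rw [hT, mul_pow 3 M]; unfold cK; ring

theorem step {γ κ : ℝ} (hγ : 0 < γ) {k : ℕ} (hk : k < n) {C : ℝ≥0∞} (hcore : CoreP n γ (k+1) κ C) (hκ : 0 < κ) (hC : C ≠ ⊤) :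
    ∃ (κ' : ℝ) (C' : ℝ≥0∞), 0 < κ' ∧ C' ≠ ⊤ ∧ CoreP n γ k κ' C' := by
  have hn : 1 ≤ n := by omega
  have hn1 : (1:ℝ) ≤ n := by exact_mod_cast hn
  obtain ⟨N, hNl⟩ := exists_nat_ge (2 * n * (KK n + 1) / γ + 1)
  have hN1 : (1:ℝ) ≤ N := by
    refine le_trans ?_ hNl
    have : 0 ≤ 2 * n * (KK n + 1) / γ := by positivity
    linarith
  have hN : 1 ≤ N := by exact_mod_cast hN1
  have hNγ : (KK n : ℝ) + 1 ≤ N * (γ / (2 * n)) := by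
    have h1 : 2 * n * (KK n + 1) / γ ≤ N := by linarith
    rw [div_le_iff₀ hγ] at h1
    rw [mul_div_assoc', le_div_iff₀ (by positivity)]
    linarith
  set κ0 := min κ 1 with hκ0
  have hκ0p : 0 < κ0 := lt_min hκ one_pos
  set m := (Jk n k).card with hm
  have hm1 : 1 ≤ m := (Jk_ne hk).card_pos
  have hmn : m ≤ n := by
    have := Finset.card_le_univ (Jk n k)
    simpa using this
  have hm1' : (1:ℝ) ≤ m := by exact_mod_cast hm1
  have hmn' : (m:ℝ) ≤ n := by exact_mod_cast hmn
  set C1 : ℝ≥0∞ := (2 * (ENNReal.ofReal (256 ^ n) * (C * ENNReal.ofReal (2 ^ κ) * (ENNReal.ofReal (CS ^ n) * cO n ^ n)))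
        + 2 * (ENNReal.ofReal (36 ^ n) * cL n)) * ENNReal.ofReal Real.pi ^ n
      + cM0 n * (cMR n m N * ENNReal.ofReal ((2 * n) ^ ((n : ℝ) - γ)) * ENNReal.ofReal n.factorial * ENNReal.ofReal (cK n)) with hC1
  have hC1t : C1 ≠ ⊤ := by
    have := cM0_top n
    have := cMR_top n N hm1
    have := cL_top n
    have := ENNReal.pow_ne_top (n := n) (cO_top n)
    have : ENNReal.ofReal Real.pi ^ n ≠ ⊤ := ENNReal.pow_ne_top ENNReal.ofReal_ne_top
    have h2 : (2:ℝ≥0∞) ≠ ⊤ := by norm_num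
    rw [hC1]
    refine ENNReal.add_ne_top.2 ⟨ENNReal.mul_ne_top (ENNReal.add_ne_top.2 ⟨?_, ?_⟩) this, ?_⟩
    · apply_rules [ENNReal.mul_ne_top, ENNReal.ofReal_ne_top]
    · apply_rules [ENNReal.mul_ne_top, ENNReal.ofReal_ne_top]
    · apply_rules [ENNReal.mul_ne_top, ENNReal.ofReal_ne_top]
  refine ⟨κ0 / N, max (C1 * ENNReal.ofReal (2 ^ (κ0 / N))) (cT n * ENNReal.ofReal ((2 ^ (N+1) : ℝ) ^ (κ0 / N))), by positivity, ?_, ?_⟩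
  · exact (max_lt (ENNReal.mul_lt_top hC1t.lt_top ENNReal.ofReal_lt_top) (ENNReal.mul_lt_top (cT_top n).lt_top ENNReal.ofReal_lt_top)).ne
  intro L hL w hw H _ hH F hF hsh hwF
  have hL0 : 0 < L := by linarith
  by_cases hLb : L < 2 ^ (N + 1)
  · refine (trivial_bound H hH hF (fun ξ h => (norm_le_two hL (hsh ξ h)).trans (by norm_num))).trans ?_
    refine mul_le_mul_left ?_ _
    refine le_trans ?_ (mul_le_mul_left (le_max_right _ _) _)
    rw [mul_assoc, ← ENNReal.ofReal_mul (by positivity)]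
    refine le_mul_of_one_le_right' ?_
    rw [← ENNReal.ofReal_one]
    apply ENNReal.ofReal_le_ofReal
    rw [Real.rpow_neg hL0.le, ← div_eq_mul_inv, ← Real.div_rpow (by positivity) hL0.le]
    apply Real.one_le_rpow
    · rw [le_div_iff₀ hL0]; linarith
    · positivity
  · push Not at hLb
    set M : ℝ := (L / 2) ^ (1 / (N:ℝ)) with hMd
    have hMN : M ^ N = L / 2 := by
      rw [hMd, ← Real.rpow_natCast, ← Real.rpow_mul (by positivity), one_div_mul_cancel (by positivity), Real.rpow_one]
    have hM : 2 ≤ M := by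
      by_contra hc
      push Not at hc
      have hM0 : 0 ≤ M := by positivity
      have : M ^ N < 2 ^ N := pow_lt_pow_left₀ hc hM0 (by omega)
      rw [hMN, pow_succ] at *
      linarith
    have hM0 : 0 < M := by linarith
    have hM1 : 1 ≤ M := by linarith
    set Z : ℝ := 2 * n ^ 2 * (3 * M) ^ (n + 1) with hZd
    have hZ : 2 * n ^ 2 * (3 * M) ^ n * M ≤ Z := by
      have : 0 ≤ 2 * n ^ 2 * (3 * M) ^ n * M := by positivity
      have h2 : Z = 3 * (2 * n ^ 2 * (3 * M) ^ n * M) := by rw [hZd]; ring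
      linarith
    have hZM : M ≤ Z := by
      refine le_trans ?_ hZ
      have : 1 ≤ 2 * (n:ℝ) ^ 2 * (3 * M) ^ n := by
        calc (1:ℝ) ≤ 2 * 1 ^ 2 * 1 ^ n := by norm_num
          _ ≤ _ := by gcongr; linarith
      nlinarith
    have hZ0 : 0 < Z := by linarith
    have hstep := step_one hγ hk hcore hN hL hM hMN hZ w hw H hH hF hsh hwF
    refine hstep.trans (mul_le_mul_left ?_ _)
    refine le_trans ?_ (mul_le_mul_left (le_max_left _ _) _)
    have hLM : ENNReal.ofReal (2 ^ (κ0 / N)) * ENNReal.ofReal (L ^ (-(κ0 / N))) = ENNReal.ofReal (M ^ (-κ0)) := by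
      rw [← ENNReal.ofReal_mul (by positivity)]
      congr 1
      rw [hMd, ← Real.rpow_mul (by positivity), Real.div_rpow hL0.le (by norm_num)]
      rw [show 1 / (N:ℝ) * -κ0 = -(κ0 / N) by ring, Real.rpow_neg (by norm_num : (0:ℝ) ≤ 2), div_inv_eq_mul, mul_comm]
    rw [mul_assoc C1, hLM, hC1]
    have hM1κ : M⁻¹ ≤ M ^ (-κ0) := by
      rw [← Real.rpow_neg_one]
      exact Real.rpow_le_rpow_of_exponent_le hM1 (by have := min_le_right κ 1; linarith)
    have hb1 : ENNReal.ofReal ((M / 2) ^ (-κ)) ≤ ENNReal.ofReal (2 ^ κ) * ENNReal.ofReal (M ^ (-κ0)) := by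
      rw [← ENNReal.ofReal_mul (by positivity)]
      apply ENNReal.ofReal_le_ofReal
      rw [Real.div_rpow hM0.le (by norm_num), Real.rpow_neg (by norm_num : (0:ℝ) ≤ 2), div_inv_eq_mul, mul_comm]
      refine mul_le_mul_of_nonneg_left (Real.rpow_le_rpow_of_exponent_le hM1 ?_) (by positivity)
      have := min_le_left κ 1
      linarith
    have hb2 : ENNReal.ofReal ((6 * Z) ^ n) ^ 2 * ENNReal.ofReal (Z ^ (4 * n))⁻¹ ≤ ENNReal.ofReal (36 ^ n) * ENNReal.ofReal (M ^ (-κ0)) := by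
      rw [← ENNReal.ofReal_pow (by positivity), ← ENNReal.ofReal_mul (by positivity), ← ENNReal.ofReal_mul (by positivity)]
      apply ENNReal.ofReal_le_ofReal
      have h1 : ((6 * Z) ^ n) ^ 2 * (Z ^ (4 * n))⁻¹ = 36 ^ n * (Z ^ (2 * n))⁻¹ := by
        rw [show 4 * n = 2 * n + 2 * n by ring, pow_add, ← pow_mul, mul_comm n 2, mul_pow, pow_mul 6 2 n]
        have : Z ^ (2 * n) ≠ 0 := by positivity
        field_simp
        norm_num
      rw [h1]
      refine mul_le_mul_of_nonneg_left (le_trans ?_ hM1κ) (by positivity)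
      rw [inv_le_inv₀ (by positivity) hM0]
      exact hZM.trans (le_self_pow₀ (by linarith) (by omega))
    have hb3 : ENNReal.ofReal ((6 * Z) ^ n) ^ 2 * (ENNReal.ofReal (Z ^ (4 * n)) * (ENNReal.ofReal (2 * (1 + (2 * n * (3 * M) ^ n * Z) ^ 2)) ^ n * (ENNReal.ofReal ((6 * Z) ^ n) ^ n * ENNReal.ofReal (((3 * M) ^ n) ^ n))))
        * ENNReal.ofReal ((M ^ N) ^ (-(γ / (2 * m)))) ≤ ENNReal.ofReal (cK n) * ENNReal.ofReal (M ^ (-κ0)) := by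
      rw [← ENNReal.ofReal_pow (by positivity), ← ENNReal.ofReal_pow (by positivity), ← ENNReal.ofReal_pow (by positivity),
        ← ENNReal.ofReal_mul (by positivity), ← ENNReal.ofReal_mul (by positivity), ← ENNReal.ofReal_mul (by positivity), ← ENNReal.ofReal_mul (by positivity),
        ← ENNReal.ofReal_mul (by positivity), ← ENNReal.ofReal_mul (by unfold cK; positivity)]
      apply ENNReal.ofReal_le_ofReal
      refine (mul_le_mul_of_nonneg_right (num_bound hn hM1 hZd) (by positivity)).trans ?_
      rw [mul_assoc]
      refine mul_le_mul_of_nonneg_left (le_trans ?_ hM1κ) (by unfold cK; positivity)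
      rw [← Real.rpow_natCast M N, ← Real.rpow_mul hM0.le, ← Real.rpow_natCast M (KK n), ← Real.rpow_add hM0, ← Real.rpow_neg_one]
      apply Real.rpow_le_rpow_of_exponent_le hM1
      have : N * (γ / (2 * n)) ≤ N * (γ / (2 * m)) := by gcongr
      linarith
    rw [add_mul _ _ (ENNReal.ofReal (M ^ (-κ0)))]
    refine add_le_add ?_ ?_
    · calc _ ≤ (2 * (ENNReal.ofReal (256 ^ n) * (C * (ENNReal.ofReal (2 ^ κ) * ENNReal.ofReal (M ^ (-κ0))) * (ENNReal.ofReal (CS ^ n) * cO n ^ n)))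
          + 2 * (ENNReal.ofReal (36 ^ n) * ENNReal.ofReal (M ^ (-κ0)) * cL n)) * ENNReal.ofReal Real.pi ^ n := by
            rw [← mul_assoc (ENNReal.ofReal ((6 * Z) ^ n) ^ 2)]
            exact mul_le_mul_left (add_le_add (mul_le_mul_right (mul_le_mul_right (mul_le_mul_left (mul_le_mul_right hb1 _) _) _) _)
              (mul_le_mul_right (mul_le_mul_left hb2 _) _)) _
        _ = _ := by ring
    · rw [ENNReal.ofReal_mul (by positivity)]
      unfold cB
      calc _ = cM0 n * (cMR n m N * ENNReal.ofReal ((2 * n) ^ ((n : ℝ) - γ)) * ENNReal.ofReal n.factorial) *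
            (ENNReal.ofReal ((6 * Z) ^ n) ^ 2 * (ENNReal.ofReal (Z ^ (4 * n)) * (ENNReal.ofReal (2 * (1 + (2 * n * (3 * M) ^ n * Z) ^ 2)) ^ n * (ENNReal.ofReal ((6 * Z) ^ n) ^ n * ENNReal.ofReal (((3 * M) ^ n) ^ n))))
        * ENNReal.ofReal ((M ^ N) ^ (-(γ / (2 * m))))) := by ring
        _ ≤ cM0 n * (cMR n m N * ENNReal.ofReal ((2 * n) ^ ((n : ℝ) - γ)) * ENNReal.ofReal n.factorial) *
            (ENNReal.ofReal (cK n) * ENNReal.ofReal (M ^ (-κ0))) := mul_le_mul_right hb3 _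
        _ = _ := by ring

theorem base (hn : 1 ≤ n) (γ : ℝ) : CoreP n γ n 1 (cT n * ENNReal.ofReal (n + 1)) := by
  intro L hL w hw H _ hH F hF hsh hwF
  have hL0 : 0 < L := by linarith
  by_cases hLb : L ≤ n + 1
  · refine (trivial_bound H hH hF (fun ξ h => (norm_le_two hL (hsh ξ h)).trans (by norm_num))).trans ?_
    refine mul_le_mul_left ?_ _
    rw [mul_assoc, ← ENNReal.ofReal_mul (by positivity)]
    refine le_mul_of_one_le_right' ?_
    rw [← ENNReal.ofReal_one]
    apply ENNReal.ofReal_le_ofReal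
    rw [Real.rpow_neg_one, ← div_eq_mul_inv, le_div_iff₀ hL0]
    linarith
  · push Not at hLb
    have hF0 : F = fun _ => 0 := by
      ext ξ
      by_contra hne
      have h1 := hsh ξ hne
      have h2 := hwF ξ hne
      have hon : Orthonormal ℝ w := by
        rw [orthonormal_iff_ite]
        exact fun i j => hw i j i.2 j.2
      let b := OrthonormalBasis.mk hon (by
        rw [← hon.linearIndependent.span_eq_top_of_card_eq_finrank' (by simp)])
      have hb : ∀ i, b i = w i := fun i => by simp [b]
      have h3 := b.sum_sq_norm_inner_right ξ
      have h4 : ‖ξ‖ ^ 2 ≤ n * (1 / L) ^ 2 := by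
        rw [← h3]
        calc _ ≤ ∑ i : Fin n, (1 / L) ^ 2 := by
              refine Finset.sum_le_sum fun i _ => ?_
              rw [hb, Real.norm_eq_abs]
              exact pow_le_pow_left₀ (abs_nonneg _) (h2 i i.2) 2
          _ = _ := by simp
      have h5 := (abs_le.1 h1).1
      have h6 : 1 / L < 1 / (n + 1) := one_div_lt_one_div_of_lt (by positivity) hLb
      have h7 : (0:ℝ) < 1 / L := by positivity
      have h8 : (n + 1 : ℝ) * (1 / L) < 1 := by
        rw [mul_one_div, div_lt_one hL0]; exact hLb
      have h9 : (1:ℝ) / L ≤ 1 := by rw [div_le_one hL0]; exact hL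
      nlinarith
    rw [hF0, SQ_zero]
    simp

theorem core (hn : 1 ≤ n) {γ : ℝ} (hγ : 0 < γ) : ∃ (κ : ℝ) (C : ℝ≥0∞), 0 < κ ∧ C ≠ ⊤ ∧ CoreP n γ 0 κ C := by
  have h : ∀ j, j ≤ n → ∃ (κ : ℝ) (C : ℝ≥0∞), 0 < κ ∧ C ≠ ⊤ ∧ CoreP n γ (n - j) κ C := by
    intro j
    induction j with
    | zero => intro _; exact ⟨1, _, one_pos, ENNReal.mul_ne_top (cT_top n) ENNReal.ofReal_ne_top, by simpa using base hn γ⟩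
    | succ j ih =>
      intro hj
      obtain ⟨κ, C, h1, h2, h3⟩ := ih (by omega)
      rw [show n - j = (n - (j+1)) + 1 by omega] at h3
      exact step hγ (by omega) h3 h1 h2
  simpa using h n le_rfl

end S17

open MeasureTheory Metric Set
open scoped ENNReal
namespace S17
variable {n : ℕ}

noncomputable def hat (μ : Measure (EE n)) (ξ : EE n) : ℂ := ∫ x, ee (-(inner ℝ x ξ)) ∂μ

noncomputable def EI (s : ℝ) (μ : Measure (EE n)) : ℝ≥0∞ := ∫⁻ x, ∫⁻ y, edist x y ^ (-s) ∂μ ∂μ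

theorem hat_norm_le (μ : Measure (EE n)) [IsFiniteMeasure μ] (ξ : EE n) : ‖hat μ ξ‖ ≤ μ.real univ := by
  unfold hat
  refine (norm_integral_le_of_norm_le_const (C := 1) (Filter.Eventually.of_forall fun x => (norm_ee _).le)).trans ?_
  simp

theorem hat_continuous (μ : Measure (EE n)) [IsFiniteMeasure μ] : Continuous (hat μ) := by
  unfold hat
  refine continuous_of_dominated (bound := fun _ => 1) ?_ ?_ (integrable_const _) ?_
  · intro ξ
    exact (ee_continuous.comp (by fun_prop)).aestronglyMeasurable
  · intro ξ
    exact Filter.Eventually.of_forall fun x => (norm_ee _).le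
  · exact Filter.Eventually.of_forall fun x => (ee_continuous.comp (by fun_prop))

theorem rpow_anti {s : ℝ} (hs : 0 ≤ s) {a b : ℝ≥0∞} (h : a ≤ b) : b ^ (-s) ≤ a ^ (-s) := by
  rw [ENNReal.rpow_neg, ENNReal.rpow_neg]
  exact ENNReal.inv_le_inv.2 (ENNReal.rpow_le_rpow h hs)

theorem kern_meas (s : ℝ) : Measurable (fun p : EE n × EE n => edist p.1 p.2 ^ (-s)) := by
  fun_prop

theorem U_meas (s : ℝ) (μ : Measure (EE n)) [SFinite μ] : Measurable (fun x => ∫⁻ y, edist x y ^ (-s) ∂μ) :=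
  Measurable.lintegral_prod_right' (f := fun p : EE n × EE n => edist p.1 p.2 ^ (-s)) (kern_meas s)

theorem U_pos {s : ℝ} (hs : 0 < s) (μ : Measure (EE n)) (hμ : μ ≠ 0) (x : EE n) :
    (∫⁻ y, edist x y ^ (-s) ∂μ) ≠ 0 := by
  intro h
  rw [lintegral_eq_zero_iff (by fun_prop)] at h
  apply hμ
  rw [← Measure.measure_univ_eq_zero]
  have : ∀ᵐ y ∂μ, False := by
    filter_upwards [h] with y hy
    simp only [Pi.zero_apply, ENNReal.rpow_eq_zero_iff] at hy
    rcases hy with ⟨_, h2⟩ | ⟨h1, _⟩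
    · linarith
    · exact edist_ne_top _ _ h1
  have h2 := ae_iff.1 this
  simpa using h2

theorem hden_le {s : ℝ} (hs : 0 < s) (μ : Measure (EE n)) [IsFiniteMeasure μ] {D : ℝ≥0∞} (hD : D ≠ ⊤) (hD0 : D ≠ 0)
    {B : Set (EE n)} (hB : MeasurableSet B) (hd : ∀ a ∈ B, ∀ b ∈ B, edist a b ≤ D) :
    μ.withDensity (fun x => (∫⁻ y, edist x y ^ (-s) ∂μ)⁻¹) B ≤ D ^ s := by
  rw [withDensity_apply _ hB]
  by_cases h0 : μ B = 0
  · rw [setLIntegral_measure_zero _ _ h0]; exact zero_le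
  have key : ∀ a ∈ B, (∫⁻ y, edist a y ^ (-s) ∂μ)⁻¹ ≤ D ^ s * (μ B)⁻¹ := by
    intro a ha
    have h1 : D ^ (-s) * μ B ≤ ∫⁻ y, edist a y ^ (-s) ∂μ := by
      calc D ^ (-s) * μ B = ∫⁻ y in B, D ^ (-s) ∂μ := by simp
        _ ≤ ∫⁻ y in B, edist a y ^ (-s) ∂μ := by
          refine setLIntegral_mono' hB fun y hy => ?_
          exact rpow_anti hs.le (hd a ha y hy)
        _ ≤ _ := setLIntegral_le_lintegral _ _
    have h2 := ENNReal.inv_le_inv.2 h1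
    rwa [ENNReal.mul_inv (Or.inr (measure_ne_top _ _)) (Or.inr h0), ← ENNReal.rpow_neg, neg_neg] at h2
  calc _ ≤ ∫⁻ a in B, D ^ s * (μ B)⁻¹ ∂μ := setLIntegral_mono' hB key
    _ = D ^ s * ((μ B)⁻¹ * μ B) := by simp [mul_assoc]
    _ = D ^ s := by rw [ENNReal.inv_mul_cancel h0 (measure_ne_top _ _), mul_one]

theorem ofLp_meas : Measurable (fun x : EE n => (WithLp.ofLp x : Fin n → ℝ)) := Y0_meas

/-- the mass identity -/
theorem mass_le (μ : Measure (EE n)) [IsFiniteMeasure μ] {A : Set (EE n)} (hA : MeasurableSet A) (hAv : volume A ≠ ⊤) :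
    Integrable (A.indicator (hat μ)) ∧ (∫⁻ ξ, ‖A.indicator (hat μ) ξ‖ₑ ^ 2) ≠ ⊤ ∧
    ∫⁻ ξ, ‖A.indicator (hat μ) ξ‖ₑ ^ 2 ≤ ∫⁻ x, ‖GG volume Y0 (A.indicator (hat μ)) (WithLp.ofLp x)‖ₑ ∂μ := by
  have hb : ∀ ξ, ‖A.indicator (hat μ) ξ‖ₑ ≤ A.indicator (fun _ => ENNReal.ofReal (μ.real univ)) ξ := by
    intro ξ
    by_cases h : ξ ∈ A
    · rw [indicator_of_mem h, indicator_of_mem h, ← ofReal_norm]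
      exact ENNReal.ofReal_le_ofReal (hat_norm_le μ ξ)
    · simp [h]
  have hi : Integrable (A.indicator (hat μ)) := by
    refine ⟨((hat_continuous μ).measurable.indicator hA).aestronglyMeasurable, ?_⟩
    refine (lintegral_mono hb).trans_lt ?_
    rw [lintegral_indicator hA, setLIntegral_const]
    exact ENNReal.mul_lt_top ENNReal.ofReal_lt_top (lt_top_iff_ne_top.2 hAv)
  have hfin : (∫⁻ ξ, ‖A.indicator (hat μ) ξ‖ₑ ^ 2) ≠ ⊤ := by
    have h2 : ∀ ξ, ‖A.indicator (hat μ) ξ‖ₑ ^ 2 ≤ A.indicator (fun _ => ENNReal.ofReal (μ.real univ) ^ 2) ξ := by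
      intro ξ
      have := hb ξ
      by_cases h : ξ ∈ A
      · rw [indicator_of_mem h] at this ⊢
        rw [indicator_of_mem h] at this ⊢
        exact pow_le_pow_left₀ zero_le this 2
      · simp [h]
    refine ((lintegral_mono h2).trans_lt ?_).ne
    rw [lintegral_indicator hA, setLIntegral_const]
    exact ENNReal.mul_lt_top (by simp) (lt_top_iff_ne_top.2 hAv)
  refine ⟨hi, hfin, ?_⟩
  set F := A.indicator (hat μ) with hF
  have e1 : ∫ x, GG volume Y0 F (WithLp.ofLp x) ∂μ = ∫ ξ, ((‖F ξ‖ ^ 2 : ℝ) : ℂ) := by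
    unfold GG
    rw [integral_integral_swap]
    · refine integral_congr_ae (Filter.Eventually.of_forall fun ξ => ?_)
      simp only
      rw [integral_const_mul]
      by_cases h : ξ ∈ A
      · have : F ξ = hat μ ξ := by rw [hF, indicator_of_mem h]
        have h3 : ∫ x : EE n, ee (WithLp.ofLp x ⬝ᵥ Y0 ξ) ∂μ = (starRingEnd ℂ) (hat μ ξ) := by
          unfold hat
          rw [← integral_conj]
          refine integral_congr_ae (Filter.Eventually.of_forall fun x => ?_)
          simp only
          rw [conj_ee, neg_neg, real_inner_comm]
          first | done | exact congrArg ee (inner_toLp (WithLp.ofLp x) ξ).symm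
        rw [h3, this, Complex.mul_conj, Complex.normSq_eq_norm_sq]
      · have : F ξ = 0 := by rw [hF, indicator_of_notMem h]
        simp [this]
    · have hFp : Integrable (fun p : EE n × EE n => F p.2) (μ.prod volume) := hi.comp_snd μ
      refine hFp.mul_bdd (c := 1) ?_ ?_
      · refine (ee_continuous.measurable.comp ?_).aestronglyMeasurable
        refine Continuous.measurable ?_
        have : (fun p : EE n × EE n => WithLp.ofLp p.1 ⬝ᵥ Y0 p.2) = fun p => inner ℝ p.2 p.1 := by
          funext p; exact (inner_toLp (WithLp.ofLp p.1) p.2).symm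
        rw [this]; fun_prop
      · exact Filter.Eventually.of_forall fun x => (norm_ee _).le
  have e2 : ∫⁻ ξ, ‖F ξ‖ₑ ^ 2 = ENNReal.ofReal (∫ ξ, ‖F ξ‖ ^ 2) := by
    have hm : AEStronglyMeasurable (fun ξ => ‖F ξ‖ ^ 2) volume := hi.1.norm.pow 2
    rw [integral_eq_lintegral_of_nonneg_ae (Filter.Eventually.of_forall fun _ => sq_nonneg _) hm]
    have : ∀ ξ, ENNReal.ofReal (‖F ξ‖ ^ 2) = ‖F ξ‖ₑ ^ 2 := fun ξ => by
      rw [ENNReal.ofReal_pow (norm_nonneg _), ofReal_norm]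
    simp only [this]
    rw [ENNReal.ofReal_toReal hfin]
  rw [e2]
  have e3 : ENNReal.ofReal (∫ ξ, ‖F ξ‖ ^ 2) = ‖∫ x, GG volume Y0 F (WithLp.ofLp x) ∂μ‖ₑ := by
    rw [e1, integral_complex_ofReal, ← ofReal_norm, Complex.norm_real, Real.norm_of_nonneg]
    exact integral_nonneg fun _ => by positivity
  rw [e3]
  exact enorm_integral_le_lintegral_enorm _

end S17

open MeasureTheory Metric Set
open scoped ENNReal
namespace S17
variable {n : ℕ}

def shell (n : ℕ) (δ : ℝ) : Set (EE n) := {ξ | |‖ξ‖ - 1| < δ}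

theorem shell_meas (δ : ℝ) : MeasurableSet (shell n δ) :=
  (isOpen_lt (by fun_prop) continuous_const).measurableSet

theorem shell_vol (δ : ℝ) : volume (shell n δ) ≠ ⊤ := by
  have : shell n δ ⊆ closedBall 0 (1 + δ) := by
    intro ξ h
    have := (abs_lt.1 (show |‖ξ‖ - 1| < δ from h)).2
    simp; linarith
  exact ((measure_mono this).trans_lt measure_closedBall_lt_top).ne

theorem prop1 {s : ℝ} (hs : 0 < s) (hsn : s < n) (hn : 1 ≤ n) :
    ∃ (κ : ℝ) (C : ℝ≥0∞), 0 < κ ∧ C ≠ ⊤ ∧ ∀ (μ : Measure (EE n)), IsFiniteMeasure μ → EI s μ < ⊤ →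
      ∀ δ : ℝ, 0 < δ → δ ≤ 1/3 →
      ∫⁻ ξ in shell n δ, ‖hat μ ξ‖ₑ ^ 2 ≤ C * ENNReal.ofReal (δ ^ κ) * EI s μ := by
  obtain ⟨κ, C, hκ, hC, hcore⟩ := core (n := n) hn (γ := n - s) (by linarith)
  have hn0 : (0:ℝ) < n := by exact_mod_cast hn
  set c : ℝ≥0∞ := ENNReal.ofReal (2 * n) ^ (-s) with hc
  have h2n : ENNReal.ofReal (2 * n) ≠ 0 := by
    rw [Ne, ENNReal.ofReal_eq_zero, not_le]; positivity
  have hc0 : c ≠ 0 := by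
    rw [hc, Ne, ENNReal.rpow_eq_zero_iff]
    push Not
    exact ⟨fun h => absurd h h2n, fun h => absurd h ENNReal.ofReal_ne_top⟩
  have hct : c ≠ ⊤ := by
    rw [hc, Ne, ENNReal.rpow_eq_top_iff]
    push Not
    exact ⟨fun h => absurd h h2n, fun h => absurd h ENNReal.ofReal_ne_top⟩
  refine ⟨κ, c⁻¹ * C * ENNReal.ofReal (3 ^ κ), hκ,
    ENNReal.mul_ne_top (ENNReal.mul_ne_top (ENNReal.inv_ne_top.2 hc0) hC) ENNReal.ofReal_ne_top, ?_⟩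
  intro μ hμ hE δ hδ hδ3
  by_cases hμ0 : μ = 0
  · subst hμ0
    simp [hat]
  set A := shell n δ
  obtain ⟨hFi, hB, hmass⟩ := mass_le μ (shell_meas (n := n) δ) (shell_vol δ)
  set F := (shell n δ).indicator (hat μ) with hF
  have hBe : ∫⁻ ξ in shell n δ, ‖hat μ ξ‖ₑ ^ 2 = ∫⁻ ξ, ‖F ξ‖ₑ ^ 2 := by
    rw [← lintegral_indicator (shell_meas δ)]
    refine lintegral_congr fun ξ => ?_
    by_cases h : ξ ∈ shell n δ <;> simp [hF, h]
  rw [hBe]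
  set B := ∫⁻ ξ, ‖F ξ‖ₑ ^ 2 with hBdef
  set U : EE n → ℝ≥0∞ := fun x => ∫⁻ y, edist x y ^ (-s) ∂μ with hU
  have hUm : Measurable U := U_meas s μ
  have hU0 : ∀ x, U x ≠ 0 := U_pos hs μ hμ0
  have hUt : ∀ᵐ x ∂μ, U x < ⊤ := ae_lt_top hUm hE.ne
  set g : EE n → ℝ≥0∞ := fun x => ‖GG volume Y0 F (WithLp.ofLp x)‖ₑ with hg
  have hgm : Measurable g := by
    have := (GG_continuous (m := volume) (Y := Y0 (n := n)) Y0_meas hFi).measurable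
    exact (this.comp ofLp_meas).enorm
  set H : Measure (Fin n → ℝ) := c • (μ.withDensity (fun x => (U x)⁻¹)).map (fun x : EE n => WithLp.ofLp x) with hH
  have hSF : SFinite H := by infer_instance
  have hball : ∀ x r, 1 ≤ r → H (closedBall x r) ≤ ENNReal.ofReal (r ^ ((n : ℝ) - (n - s))) := by
    intro x r hr
    have hr0 : 0 < r := by linarith
    rw [hH, Measure.smul_apply, Measure.map_apply ofLp_meas measurableSet_closedBall, smul_eq_mul]
    have h1 := hden_le hs μ (D := ENNReal.ofReal (2 * n * r)) ENNReal.ofReal_ne_top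
      (by rw [Ne, ENNReal.ofReal_eq_zero, not_le]; positivity)
      (B := (fun x : EE n => (WithLp.ofLp x : Fin n → ℝ)) ⁻¹' closedBall x r)
      (ofLp_meas measurableSet_closedBall) (by
        intro a ha b hb
        rw [edist_dist, dist_eq_norm]
        apply ENNReal.ofReal_le_ofReal
        have : ∀ i, |(a - b) i| ≤ 2 * r := by
          intro i
          have h1 : |a i - x i| ≤ r := (dist_le_pi_dist (WithLp.ofLp a) x i).trans ha
          have h2 : |b i - x i| ≤ r := (dist_le_pi_dist (WithLp.ofLp b) x i).trans hb
          have : (a - b) i = (a i - x i) - (b i - x i) := by simp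
          rw [this]
          exact (abs_sub _ _).trans (by linarith)
        have := coord_norm this (by omega)
        linarith)
    calc _ ≤ c * ENNReal.ofReal (2 * n * r) ^ s := mul_le_mul_right h1 c
      _ = ENNReal.ofReal (r ^ ((n : ℝ) - (n - s))) := by
        rw [ENNReal.ofReal_mul (by positivity), ENNReal.mul_rpow_of_nonneg _ _ hs.le, ← mul_assoc, hc,
          ← ENNReal.rpow_add _ _ h2n ENNReal.ofReal_ne_top]
        simp only [neg_add_cancel, ENNReal.rpow_zero, one_mul, sub_sub_cancel]
        rw [ENNReal.ofReal_rpow_of_pos hr0]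
  have hcr := hcore (1 / (3 * δ)) (by rw [le_div_iff₀ (by positivity)]; linarith) (fun _ => 0)
    (fun i j h => absurd h (by omega)) H hSF hball F hFi (by
      intro ξ hξ
      have hm : ξ ∈ shell n δ := by
        by_contra h
        exact hξ (by simp [hF, h])
      have h1 : |‖ξ‖ - 1| < δ := hm
      have h2 := abs_lt.1 h1
      rw [one_div_one_div, abs_le]
      constructor <;> nlinarith [norm_nonneg ξ]) (fun ξ _ i h => absurd h (by omega))
  have hm : Measurable (SQ volume (Y0 (n := n)) F) := GG_meas Y0_meas hFi
  have hI : ∫⁻ x, SQ volume Y0 F x ∂H = c * ∫⁻ x, (U x)⁻¹ * g x ^ 2 ∂μ := by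
    rw [hH, lintegral_smul_measure, lintegral_map hm ofLp_meas]
    have := lintegral_withDensity_eq_lintegral_mul μ (f := fun x => (U x)⁻¹) hUm.inv
      (g := fun x : EE n => SQ volume Y0 F (WithLp.ofLp x)) (hm.comp ofLp_meas)
    rw [this]
    rfl
  rw [hI] at hcr
  have hcs := cs_lint μ hUm (g := fun x => (U x)⁻¹ * g x) (hUm.inv.mul hgm)
  have e1 : ∫⁻ x, U x * ((U x)⁻¹ * g x) ∂μ = ∫⁻ x, g x ∂μ := by
    apply lintegral_congr_ae
    filter_upwards [hUt] with x hx
    rw [← mul_assoc, ENNReal.mul_inv_cancel (hU0 x) hx.ne, one_mul]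
  have e2 : ∫⁻ x, U x * ((U x)⁻¹ * g x) ^ 2 ∂μ = ∫⁻ x, (U x)⁻¹ * g x ^ 2 ∂μ := by
    apply lintegral_congr_ae
    filter_upwards [hUt] with x hx
    calc U x * ((U x)⁻¹ * g x) ^ 2 = (U x * (U x)⁻¹) * ((U x)⁻¹ * g x ^ 2) := by ring
      _ = _ := by rw [ENNReal.mul_inv_cancel (hU0 x) hx.ne, one_mul]
  rw [e1, e2] at hcs
  have hfin : B ^ 2 ≤ EI s μ * (c⁻¹ * (C * ENNReal.ofReal ((1 / (3 * δ)) ^ (-κ)) * B)) := by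
    refine (pow_le_pow_left₀ zero_le hmass 2).trans (hcs.trans ?_)
    have : ∫⁻ x, (U x)⁻¹ * g x ^ 2 ∂μ ≤ c⁻¹ * (C * ENNReal.ofReal ((1 / (3 * δ)) ^ (-κ)) * B) := by
      calc ∫⁻ x, (U x)⁻¹ * g x ^ 2 ∂μ = c⁻¹ * (c * ∫⁻ x, (U x)⁻¹ * g x ^ 2 ∂μ) := by
            rw [← mul_assoc, ENNReal.inv_mul_cancel hc0 hct, one_mul]
        _ ≤ _ := mul_le_mul_right hcr _
    exact mul_le_mul_right this _
  by_cases hB0 : B = 0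
  · rw [hB0]; exact zero_le
  have hr : (1 / (3 * δ)) ^ (-κ) = 3 ^ κ * δ ^ κ := by
    rw [one_div, Real.inv_rpow (by positivity), Real.rpow_neg (by positivity), inv_inv, Real.mul_rpow (by norm_num) hδ.le]
  rw [hr, ENNReal.ofReal_mul (by positivity)] at hfin
  refine (ENNReal.mul_le_mul_iff_right hB0 hB).1 ?_
  calc B * B = B ^ 2 := by ring
    _ ≤ _ := hfin
    _ = _ := by ring

/-- scaling -/
theorem prop2 {s : ℝ} (hs : 0 < s) (hsn : s < n) (hn : 1 ≤ n) :
    ∃ (κ : ℝ) (C : ℝ≥0∞), 0 < κ ∧ C ≠ ⊤ ∧ ∀ (μ : Measure (EE n)), IsFiniteMeasure μ → EI s μ < ⊤ →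
      ∀ r δ : ℝ, 0 < r → 0 < δ → δ ≤ 1/3 →
      ∫⁻ ξ in {ξ : EE n | |‖ξ‖ - r| < δ * r}, ‖hat μ ξ‖ₑ ^ 2 ≤
        C * ENNReal.ofReal (δ ^ κ) * ENNReal.ofReal (r ^ ((n:ℝ) - s)) * EI s μ := by
  obtain ⟨κ, C, hκ, hC, h⟩ := prop1 hs hsn hn
  refine ⟨κ, C, hκ, hC, ?_⟩
  intro μ hμ hE r δ hr hδ hδ3
  have hmr : Measurable (fun x : EE n => r • x) := measurable_const_smul r
  set μr := μ.map (fun x : EE n => r • x) with hμr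
  have hfin : IsFiniteMeasure μr := by infer_instance
  have hhat : ∀ ξ, hat μr ξ = hat μ (r • ξ) := by
    intro ξ
    unfold hat
    have hc : Continuous (fun x : EE n => ee (-(inner ℝ x ξ))) := ee_continuous.comp (by fun_prop)
    rw [hμr, integral_map hmr.aemeasurable hc.aestronglyMeasurable]
    simp only [inner_smul_left, inner_smul_right]
    rfl
  have hEr : EI s μr = ENNReal.ofReal (r ^ (-s)) * EI s μ := by
    unfold EI
    rw [hμr, lintegral_map (by rw [← hμr]; exact U_meas s μr) hmr]
    have h1 : ∀ x : EE n, ∫⁻ y, edist (r • x) y ^ (-s) ∂(μ.map (fun x : EE n => r • x)) =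
        ENNReal.ofReal (r ^ (-s)) * ∫⁻ y, edist x y ^ (-s) ∂μ := by
      intro x
      rw [lintegral_map (by fun_prop) hmr, ← lintegral_const_mul _ (by fun_prop)]
      refine lintegral_congr fun y => ?_
      rw [edist_smul₀, ENNReal.smul_def, smul_eq_mul, ENNReal.mul_rpow_of_ne_top (by simp) (edist_ne_top _ _),
        ← ENNReal.ofReal_rpow_of_pos hr]
      congr 2
      rw [ENNReal.ofReal, ← norm_toNNReal, Real.norm_of_nonneg hr.le]
    simp_rw [h1]
    rw [lintegral_const_mul _ (U_meas s μ)]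
  have hEr' : EI s μr < ⊤ := by rw [hEr]; exact ENNReal.mul_lt_top ENNReal.ofReal_lt_top hE
  have h1 := h μr hfin hEr' δ hδ hδ3
  have hsc : ∫⁻ ξ in {ξ : EE n | |‖ξ‖ - r| < δ * r}, ‖hat μ ξ‖ₑ ^ 2 =
      ENNReal.ofReal (r ^ (n:ℝ)) * ∫⁻ ξ in shell n δ, ‖hat μr ξ‖ₑ ^ 2 := by
    have hms : MeasurableSet {ξ : EE n | |‖ξ‖ - r| < δ * r} :=
      (isOpen_lt (by fun_prop) continuous_const).measurableSet
    have hfm : Measurable (({ξ : EE n | |‖ξ‖ - r| < δ * r}).indicator (fun ξ => ‖hat μ ξ‖ₑ ^ 2)) :=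
      ((hat_continuous μ).measurable.enorm.pow_const 2).indicator hms
    have hmap := Measure.map_addHaar_smul (volume : Measure (EE n)) hr.ne'
    have e : ∫⁻ ξ, ({ξ : EE n | |‖ξ‖ - r| < δ * r}).indicator (fun ξ => ‖hat μ ξ‖ₑ ^ 2) ξ ∂(Measure.map (fun x : EE n => r • x) volume) = _ := congrArg (fun m : Measure (EE n) => ∫⁻ ξ, ({ξ : EE n | |‖ξ‖ - r| < δ * r}).indicator (fun ξ => ‖hat μ ξ‖ₑ ^ 2) ξ ∂m) hmap
    rw [lintegral_map hfm hmr, lintegral_smul_measure] at e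
    rw [← lintegral_indicator hms, ← lintegral_indicator (shell_meas δ)]
    have e3 : ∀ ξ : EE n, ({ξ : EE n | |‖ξ‖ - r| < δ * r}).indicator (fun ξ => ‖hat μ ξ‖ₑ ^ 2) (r • ξ) =
        (shell n δ).indicator (fun ξ => ‖hat μr ξ‖ₑ ^ 2) ξ := by
      intro ξ
      have : r • ξ ∈ {ξ : EE n | |‖ξ‖ - r| < δ * r} ↔ ξ ∈ shell n δ := by
        simp only [mem_setOf_eq, shell, norm_smul, Real.norm_of_nonneg hr.le]
        rw [show r * ‖ξ‖ - r = (‖ξ‖ - 1) * r by ring, abs_mul, abs_of_pos hr, mul_lt_mul_iff_left₀ hr]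
      by_cases hh : ξ ∈ shell n δ
      · rw [indicator_of_mem hh, indicator_of_mem (this.2 hh), hhat]
      · rw [indicator_of_notMem hh, indicator_of_notMem (fun h => hh (this.1 h))]
    simp only [e3] at e
    rw [e, smul_eq_mul, ← mul_assoc, ← ENNReal.ofReal_mul (by positivity)]
    have : r ^ (n:ℝ) * |(r ^ Module.finrank ℝ (EE n))⁻¹| = 1 := by
      rw [finrank_euclideanSpace_fin, abs_of_pos (by positivity), Real.rpow_natCast]
      exact mul_inv_cancel₀ (by positivity)
    rw [this]; simp
  rw [hsc]
  calc _ ≤ ENNReal.ofReal (r ^ (n:ℝ)) * (C * ENNReal.ofReal (δ ^ κ) * (ENNReal.ofReal (r ^ (-s)) * EI s μ)) := by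
        rw [← hEr]; exact mul_le_mul_right h1 _
    _ = _ := by
      rw [show (n:ℝ) - s = n + -s by ring, Real.rpow_add hr, ENNReal.ofReal_mul (by positivity)]
      ring

end S17

open MeasureTheory Metric Set
open scoped ENNReal
namespace S17
variable {n : ℕ}

noncomputable def RK (a : ℝ) : ℝ := Real.pi ^ (-(a/2)) * Real.Gamma (a/2)

theorem RK_pos {a : ℝ} (ha : 0 < a) : 0 < RK a := by
  unfold RK
  have := Real.Gamma_pos_of_pos (show 0 < a/2 by linarith)
  positivity

theorem RK_eq {a x : ℝ} (hx : 0 < x) : (1 / (Real.pi * x ^ 2)) ^ (a/2) * Real.Gamma (a/2) = RK a * x ^ (-a) := by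
  unfold RK
  rw [one_div, Real.inv_rpow (by positivity), ← Real.rpow_neg (by positivity), Real.mul_rpow Real.pi_pos.le (by positivity),
    ← Real.rpow_natCast x 2, ← Real.rpow_mul hx.le]
  rw [show ((2:ℕ):ℝ) * -(a/2) = -a by push_cast; ring]
  ring

theorem lint_of_int {f : ℝ → ℝ} {v : ℝ} (hf : ∀ x ∈ Ioi (0:ℝ), 0 ≤ f x) (hv : 0 < v) (h : ∫ x in Ioi 0, f x = v) :
    ∫⁻ x in Ioi 0, ENNReal.ofReal (f x) = ENNReal.ofReal v := by
  have hi : IntegrableOn f (Ioi 0) := by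
    by_contra hc
    rw [integral_undef hc] at h
    linarith
  rw [← h, ofReal_integral_eq_lintegral_ofReal hi]
  exact (ae_restrict_iff' measurableSet_Ioi).2 (Filter.Eventually.of_forall hf)

theorem subord1 {a : ℝ} (ha : 0 < a) {x : ℝ} (hx : 0 ≤ x) :
    ∫⁻ l in Ioi (0:ℝ), ENNReal.ofReal (l ^ (a/2 - 1) * Real.exp (-(Real.pi * x ^ 2 * l))) =
      ENNReal.ofReal (RK a) * ENNReal.ofReal x ^ (-a) := by
  rcases hx.eq_or_lt with rfl | hx
  · have h0 : ENNReal.ofReal (0:ℝ) ^ (-a) = ⊤ := by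
      rw [ENNReal.ofReal_zero, ENNReal.zero_rpow_of_neg (by linarith)]
    rw [h0, ENNReal.mul_top (by rw [Ne, ENNReal.ofReal_eq_zero, not_le]; exact RK_pos ha)]
    by_contra hc
    apply not_integrableOn_Ioi_rpow (a/2 - 1)
    refine ⟨(by fun_prop : Measurable fun x : ℝ => x ^ (a/2-1)).aestronglyMeasurable, ?_⟩
    rw [hasFiniteIntegral_iff_ofReal ((ae_restrict_iff' measurableSet_Ioi).2 (Filter.Eventually.of_forall
      fun x hx => Real.rpow_nonneg (le_of_lt hx) _))]
    refine lt_top_iff_ne_top.2 ?_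
    simpa using hc
  · rw [ENNReal.ofReal_rpow_of_pos hx, ← ENNReal.ofReal_mul (RK_pos ha).le]
    refine lint_of_int (fun l hl => ?_) (mul_pos (RK_pos ha) (by positivity)) ?_
    · have : 0 < l := hl
      positivity
    · rw [Real.integral_rpow_mul_exp_neg_mul_Ioi (by linarith) (by positivity), RK_eq hx]

theorem subord2 {a : ℝ} (ha : 0 < a) {x : ℝ} (hx : 0 < x) :
    ∫⁻ l in Ioi (0:ℝ), ENNReal.ofReal (l ^ (-(a/2) - 1) * Real.exp (-(Real.pi * x ^ 2 / l))) =
      ENNReal.ofReal (RK a) * ENNReal.ofReal x ^ (-a) := by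
  rw [ENNReal.ofReal_rpow_of_pos hx, ← ENNReal.ofReal_mul (RK_pos ha).le]
  refine lint_of_int (fun l hl => ?_) (mul_pos (RK_pos ha) (by positivity)) ?_
  · have : 0 < l := hl
    positivity
  · have h := integral_comp_rpow_Ioi (fun y : ℝ => y ^ (a/2 - 1) * Real.exp (-(Real.pi * x ^ 2 * y))) (p := -1) (by norm_num)
    rw [Real.integral_rpow_mul_exp_neg_mul_Ioi (by linarith) (by positivity), RK_eq hx] at h
    rw [← h]
    refine setIntegral_congr_fun measurableSet_Ioi fun l hl => ?_
    have hl : 0 < l := hl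
    simp only [smul_eq_mul]
    rw [Real.rpow_neg_one l, Real.inv_rpow hl.le, ← Real.rpow_neg hl.le, abs_neg, abs_one, one_mul, ← mul_assoc,
      ← Real.rpow_add hl]
    congr 2
    ring

theorem gauss_ft {l : ℝ} (hl : 0 < l) (x : EE n) :
    ∫ ξ : EE n, ((l ^ (-((n:ℝ)/2)) * Real.exp (-(Real.pi * ‖ξ‖ ^ 2 / l)) : ℝ) : ℂ) * ee (-(inner ℝ x ξ)) =
      (Real.exp (-(Real.pi * ‖x‖ ^ 2 * l)) : ℝ) := by
  have h := fourier_gaussian_innerProductSpace (V := EE n) (b := ((Real.pi / l : ℝ) : ℂ))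
    (by rw [Complex.ofReal_re]; positivity) x
  rw [Real.fourier_eq] at h
  simp only [fourierChar_smul] at h
  have e1 : ∀ ξ : EE n, ((l ^ (-((n:ℝ)/2)) * Real.exp (-(Real.pi * ‖ξ‖ ^ 2 / l)) : ℝ) : ℂ) * ee (-(inner ℝ x ξ)) =
      ((l ^ (-((n:ℝ)/2)) : ℝ) : ℂ) * (ee (-(inner ℝ ξ x)) * Complex.exp (-((Real.pi / l : ℝ) : ℂ) * ‖ξ‖ ^ 2)) := by
    intro ξ
    rw [real_inner_comm]
    push_cast
    rw [show (-((Real.pi:ℂ) / l) * (‖ξ‖:ℂ) ^ 2) = -(Real.pi * (‖ξ‖:ℂ) ^ 2 / l) by ring]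
    ring
  simp_rw [e1]
  rw [integral_const_mul, h, finrank_euclideanSpace_fin]
  have e2 : ((Real.pi : ℂ) / ((Real.pi / l : ℝ) : ℂ)) = ((l:ℝ):ℂ) := by
    push_cast
    have : (Real.pi:ℂ) ≠ 0 := by exact_mod_cast Real.pi_ne_zero
    have : (l:ℂ) ≠ 0 := by exact_mod_cast hl.ne'
    field_simp
  rw [e2]
  have e3 : ((l:ℝ):ℂ) ^ ((n:ℂ)/2) = ((l ^ ((n:ℝ)/2) : ℝ) : ℂ) := by
    rw [Complex.ofReal_cpow hl.le]; push_cast; rfl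
  have e4 : (-(Real.pi:ℂ) ^ 2 * (‖x‖:ℂ) ^ 2 / ((Real.pi / l : ℝ) : ℂ)) = ((-(Real.pi * ‖x‖ ^ 2 * l) : ℝ) : ℂ) := by
    push_cast
    have : (Real.pi:ℂ) ≠ 0 := by exact_mod_cast Real.pi_ne_zero
    have : (l:ℂ) ≠ 0 := by exact_mod_cast hl.ne'
    field_simp
  rw [e3, e4, ← Complex.ofReal_exp, ← mul_assoc, ← Complex.ofReal_mul, ← Real.rpow_add hl]
  simp

theorem gauss_int {l : ℝ} (hl : 0 < l) :
    Integrable (fun ξ : EE n => l ^ (-((n:ℝ)/2)) * Real.exp (-(Real.pi * ‖ξ‖ ^ 2 / l))) := by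
  refine Integrable.const_mul ?_ _
  have h := (GaussianFourier.integrable_cexp_neg_mul_sq_norm_add (V := EE n) (b := ((Real.pi / l : ℝ) : ℂ))
    (by rw [Complex.ofReal_re]; positivity) 0 0).norm
  refine h.congr (Filter.Eventually.of_forall fun ξ => ?_)
  simp only
  rw [Complex.norm_exp]
  congr 1
  simp
  norm_cast
  ring

theorem hat_sq (m : Measure (EE n)) [IsFiniteMeasure m] (ξ : EE n) :
    ((‖hat m ξ‖ ^ 2 : ℝ) : ℂ) = ∫ p : EE n × EE n, ee (-(inner ℝ (p.1 - p.2) ξ)) ∂(m.prod m) := by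
  rw [← Complex.normSq_eq_norm_sq, ← Complex.mul_conj]
  unfold hat
  rw [← integral_conj, ← integral_prod_mul]
  refine integral_congr_ae (Filter.Eventually.of_forall fun p => ?_)
  simp only
  rw [conj_ee, neg_neg, ← ee_add, inner_sub_left]
  congr 1
  ring

theorem gauss_energy (m : Measure (EE n)) [IsFiniteMeasure m] {l : ℝ} (hl : 0 < l) :
    ∫⁻ p : EE n × EE n, ENNReal.ofReal (Real.exp (-(Real.pi * ‖p.1 - p.2‖ ^ 2 * l))) ∂(m.prod m) =
    ∫⁻ ξ, ENNReal.ofReal (l ^ (-((n:ℝ)/2)) * Real.exp (-(Real.pi * ‖ξ‖ ^ 2 / l))) * ‖hat m ξ‖ₑ ^ 2 := by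
  set γ : EE n → ℝ := fun ξ => l ^ (-((n:ℝ)/2)) * Real.exp (-(Real.pi * ‖ξ‖ ^ 2 / l)) with hγ
  have hγi : Integrable γ := gauss_int hl
  have hγ0 : ∀ ξ, 0 ≤ γ ξ := fun ξ => by positivity
  have h1 : (∫ p : EE n × EE n, ((Real.exp (-(Real.pi * ‖p.1 - p.2‖ ^ 2 * l)) : ℝ) : ℂ) ∂(m.prod m)) =
      ∫ ξ, ((γ ξ * ‖hat m ξ‖ ^ 2 : ℝ) : ℂ) := by
    have e : ∀ p : EE n × EE n, ((Real.exp (-(Real.pi * ‖p.1 - p.2‖ ^ 2 * l)) : ℝ) : ℂ) =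
        ∫ ξ : EE n, ((γ ξ : ℝ) : ℂ) * ee (-(inner ℝ (p.1 - p.2) ξ)) := fun p => (gauss_ft hl (p.1 - p.2)).symm
    simp_rw [e]
    rw [integral_integral_swap]
    · refine integral_congr_ae (Filter.Eventually.of_forall fun ξ => ?_)
      simp only
      rw [integral_const_mul, ← hat_sq]
      push_cast; rfl
    · have hFp : Integrable (fun p : (EE n × EE n) × EE n => ((γ p.2 : ℝ) : ℂ)) ((m.prod m).prod volume) :=
        Integrable.comp_snd (f := fun ξ => ((γ ξ : ℝ) : ℂ)) hγi.ofReal _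
      refine hFp.mul_bdd (c := 1) ?_ ?_
      · exact (ee_continuous.comp (by fun_prop)).aestronglyMeasurable
      · exact Filter.Eventually.of_forall fun x => (norm_ee _).le
  rw [integral_complex_ofReal, integral_complex_ofReal] at h1
  have h2 := Complex.ofReal_injective h1
  have hb : Integrable (fun ξ => γ ξ * ‖hat m ξ‖ ^ 2) := by
    refine hγi.mul_bdd (c := (m.real univ) ^ 2) ?_ ?_
    · exact ((hat_continuous m).norm.pow 2).aestronglyMeasurable
    · refine Filter.Eventually.of_forall fun ξ => ?_
      rw [Real.norm_of_nonneg (by positivity)]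
      exact pow_le_pow_left₀ (norm_nonneg _) (hat_norm_le m ξ) 2
  have ha : Integrable (fun p : EE n × EE n => Real.exp (-(Real.pi * ‖p.1 - p.2‖ ^ 2 * l))) (m.prod m) := by
    refine Integrable.of_bound (C := 1) ?_ ?_
    · exact (Continuous.aestronglyMeasurable (by fun_prop))
    · refine Filter.Eventually.of_forall fun p => ?_
      rw [Real.norm_of_nonneg (by positivity), Real.exp_le_one_iff]
      have : 0 ≤ Real.pi * ‖p.1 - p.2‖ ^ 2 * l := by positivity
      linarith
  have h3 := congrArg ENNReal.ofReal h2
  rw [ofReal_integral_eq_lintegral_ofReal ha (Filter.Eventually.of_forall fun p => (Real.exp_pos _).le),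
    ofReal_integral_eq_lintegral_ofReal hb (Filter.Eventually.of_forall fun ξ => mul_nonneg (hγ0 ξ) (sq_nonneg _))] at h3
  rw [h3]
  refine lintegral_congr fun ξ => ?_
  rw [ENNReal.ofReal_mul (hγ0 ξ), ENNReal.ofReal_pow (norm_nonneg _), ofReal_norm]

theorem energy_id (hn : 1 ≤ n) {a : ℝ} (ha : 0 < a) (han : a < n) (m : Measure (EE n)) [IsFiniteMeasure m] :
    ENNReal.ofReal (RK a) * EI a m =
      ENNReal.ofReal (RK (n - a)) * ∫⁻ ξ, ‖hat m ξ‖ₑ ^ 2 * ‖ξ‖ₑ ^ (-((n:ℝ) - a)) := by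
  have hNE : Nonempty (Fin n) := ⟨⟨0, hn⟩⟩
  have hL : ENNReal.ofReal (RK a) * EI a m =
      ∫⁻ p : EE n × EE n, (∫⁻ l in Ioi (0:ℝ), ENNReal.ofReal (l ^ (a/2 - 1) * Real.exp (-(Real.pi * ‖p.1 - p.2‖ ^ 2 * l)))) ∂(m.prod m) := by
    have e : ∀ p : EE n × EE n, ∫⁻ l in Ioi (0:ℝ), ENNReal.ofReal (l ^ (a/2 - 1) * Real.exp (-(Real.pi * ‖p.1 - p.2‖ ^ 2 * l))) =
        ENNReal.ofReal (RK a) * edist p.1 p.2 ^ (-a) := by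
      intro p
      rw [subord1 ha (norm_nonneg _), edist_dist, dist_eq_norm]
    simp_rw [e]
    rw [lintegral_const_mul _ (kern_meas a), lintegral_prod _ (kern_meas a).aemeasurable]
    rfl
  have hsw : ∫⁻ p : EE n × EE n, (∫⁻ l in Ioi (0:ℝ), ENNReal.ofReal (l ^ (a/2 - 1) * Real.exp (-(Real.pi * ‖p.1 - p.2‖ ^ 2 * l)))) ∂(m.prod m)
      = ∫⁻ l in Ioi (0:ℝ), ENNReal.ofReal (l ^ (a/2 - 1)) *
        ∫⁻ ξ, ENNReal.ofReal (l ^ (-((n:ℝ)/2)) * Real.exp (-(Real.pi * ‖ξ‖ ^ 2 / l))) * ‖hat m ξ‖ₑ ^ 2 := by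
    rw [lintegral_lintegral_swap (Measurable.aemeasurable (by unfold Function.uncurry; fun_prop))]
    refine setLIntegral_congr_fun measurableSet_Ioi fun l hl => ?_
    have hl : 0 < l := hl
    rw [← gauss_energy m hl, ← lintegral_const_mul _ (by fun_prop)]
    refine lintegral_congr fun p => ?_
    rw [ENNReal.ofReal_mul (by positivity)]
  have hR : ∫⁻ l in Ioi (0:ℝ), ENNReal.ofReal (l ^ (a/2 - 1)) *
        ∫⁻ ξ, ENNReal.ofReal (l ^ (-((n:ℝ)/2)) * Real.exp (-(Real.pi * ‖ξ‖ ^ 2 / l))) * ‖hat m ξ‖ₑ ^ 2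
      = ∫⁻ l in Ioi (0:ℝ), ∫⁻ ξ, ENNReal.ofReal (l ^ (-(((n:ℝ) - a)/2) - 1) * Real.exp (-(Real.pi * ‖ξ‖ ^ 2 / l))) * ‖hat m ξ‖ₑ ^ 2 := by
    refine setLIntegral_congr_fun measurableSet_Ioi fun l hl => ?_
    have hl : 0 < l := hl
    have hm := (hat_continuous m).measurable
    rw [← lintegral_const_mul _ (by fun_prop)]
    refine lintegral_congr fun ξ => ?_
    rw [← mul_assoc, ← ENNReal.ofReal_mul (by positivity), ← mul_assoc, ← Real.rpow_add hl]
    congr 4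
    ring
  rw [hL, hsw, hR, lintegral_lintegral_swap, ← lintegral_const_mul]
  · apply lintegral_congr_ae
    have h0 : ∀ᵐ ξ : EE n, ξ ≠ 0 := by
      exact (measure_eq_zero_iff_ae_notMem (s := {(0 : EE n)})).1 (measure_singleton 0)
    filter_upwards [h0] with ξ hξ
    rw [lintegral_mul_const _ (by fun_prop), subord2 (by linarith) (norm_pos_iff.2 hξ), ofReal_norm]
    ring
  · have hm := (hat_continuous m).measurable
    fun_prop
  · have hm := (hat_continuous m).measurable
    exact Measurable.aemeasurable (by unfold Function.uncurry; fun_prop)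

end S17

open MeasureTheory Metric Set
open scoped ENNReal
namespace S17
variable {n : ℕ}

noncomputable def kq (μ : Measure (EE n)) (ρ : EE n → ℝ) (g : EE n ≃ₗᵢ[ℝ] EE n) (ξ z : EE n) : ℂ :=
  ∫ x, (ρ (g.symm x - z) : ℂ) * ee (-(inner ℝ x ξ)) ∂μ

section
variable (μ : Measure (EE n)) [IsFiniteMeasure μ] {ρ : EE n → ℝ} {M : ℝ} (g : EE n ≃ₗᵢ[ℝ] EE n)

theorem kq_norm_le (h0 : ∀ x, 0 ≤ ρ x) (hM : ∀ x, ρ x ≤ M) (ξ z : EE n) :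
    ‖kq μ ρ g ξ z‖ ≤ M * μ.real univ := by
  unfold kq
  refine norm_integral_le_of_norm_le_const (Filter.Eventually.of_forall fun x => ?_)
  rw [norm_mul, norm_ee, mul_one, Complex.norm_real, Real.norm_of_nonneg (h0 _)]
  exact hM _

theorem kq_continuous (hc : Continuous ρ) (h0 : ∀ x, 0 ≤ ρ x) (hM : ∀ x, ρ x ≤ M) :
    Continuous (fun p : EE n × EE n => kq μ ρ g p.1 p.2) := by
  unfold kq
  refine continuous_of_dominated (bound := fun _ => M) ?_ ?_ (integrable_const _) ?_
  · intro p
    refine Continuous.aestronglyMeasurable ?_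
    have : Continuous (fun x : EE n => ee (-(inner ℝ x p.1))) := ee_continuous.comp (by fun_prop)
    fun_prop
  · intro p
    refine Filter.Eventually.of_forall fun x => ?_
    rw [norm_mul, norm_ee, mul_one, Complex.norm_real, Real.norm_of_nonneg (h0 _)]
    exact hM _
  · refine Filter.Eventually.of_forall fun x => ?_
    have : Continuous (fun p : EE n × EE n => ee (-(inner ℝ x p.1))) := ee_continuous.comp (by fun_prop)
    fun_prop

theorem kq_int0 (hc : Continuous ρ) (hi : Integrable ρ) (ξ : EE n) :
    Integrable (fun p : EE n × EE n => (ρ (g.symm p.1 - p.2) : ℂ) * ee (-(inner ℝ p.1 ξ))) (μ.prod volume) := by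
  have h1 : Integrable (fun p : EE n × EE n => ρ (g.symm p.1 - p.2)) (μ.prod volume) := by
    rw [integrable_prod_iff (Continuous.aestronglyMeasurable (by fun_prop))]
    refine ⟨Filter.Eventually.of_forall fun x => hi.comp_sub_left (g.symm x), ?_⟩
    have : ∀ x : EE n, ∫ z, ‖ρ (g.symm x - z)‖ = ∫ z, ‖ρ z‖ := fun x =>
      integral_sub_left_eq_self (fun z => ‖ρ z‖) volume (g.symm x)
    simp only [this]
    exact integrable_const _
  refine h1.ofReal.mul_bdd (c := 1) ?_ (Filter.Eventually.of_forall fun x => (norm_ee _).le)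
  exact (ee_continuous.comp (by fun_prop)).aestronglyMeasurable

theorem kq_integrable (hc : Continuous ρ) (hi : Integrable ρ) (ξ : EE n) :
    Integrable (kq μ ρ g ξ) := (kq_int0 μ g hc hi ξ).integral_prod_right

open FourierTransform in
theorem kq_fourier (hc : Continuous ρ) (hi : Integrable ρ) (ξ η : EE n) :
    𝓕 (kq μ ρ g ξ) η = hat μ (ξ + g η) * ∫ w, (ρ w : ℂ) * ee (inner ℝ w η) := by
  rw [Real.fourier_eq]
  simp only [fourierChar_smul]
  unfold kq hat
  have e1 : ∀ z : EE n, ee (-(inner ℝ z η)) * ∫ x, (ρ (g.symm x - z) : ℂ) * ee (-(inner ℝ x ξ)) ∂μ =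
      ∫ x, (ρ (g.symm x - z) : ℂ) * ee (-(inner ℝ x ξ)) * ee (-(inner ℝ z η)) ∂μ := by
    intro z
    rw [integral_mul_const, mul_comm]
  simp_rw [e1]
  rw [integral_integral_swap, ← integral_mul_const]
  · refine integral_congr_ae (Filter.Eventually.of_forall fun x => ?_)
    simp only
    have h := integral_sub_left_eq_self (fun w => (ρ w : ℂ) * ee (-(inner ℝ x ξ)) * ee (-(inner ℝ (g.symm x - w) η))) volume (g.symm x)
    simp only [sub_sub_cancel] at h
    rw [h, ← integral_const_mul]
    refine integral_congr_ae (Filter.Eventually.of_forall fun w => ?_)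
    simp only
    have h2 : inner ℝ (g.symm x) η = inner ℝ x (g η) := by
      rw [LinearIsometryEquiv.inner_map_eq_flip]; simp
    rw [inner_sub_left, h2, inner_add_right, show -(inner ℝ x ξ + inner ℝ x (g η)) = -inner ℝ x ξ + -inner ℝ x (g η) by ring,
      show -(inner ℝ x (g η) - inner ℝ w η) = -inner ℝ x (g η) + inner ℝ w η by ring, ee_add, ee_add]
    ring
  · have h := (kq_int0 μ g hc hi ξ).swap
    refine h.mul_bdd (c := 1) ?_ (Filter.Eventually.of_forall fun x => (norm_ee _).le)
    exact (ee_continuous.comp (by fun_prop)).aestronglyMeasurable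

theorem kq_planch (hc : Continuous ρ) (h0 : ∀ x, 0 ≤ ρ x) (hM : ∀ x, ρ x ≤ M) (hi : Integrable ρ) (ξ : EE n) :
    ∫⁻ z, ‖kq μ ρ g ξ z‖ₑ ^ 2 = ∫⁻ η, ‖hat μ (ξ + g η)‖ₑ ^ 2 * ‖∫ w, (ρ w : ℂ) * ee (inner ℝ w η)‖ₑ ^ 2 := by
  have hI := kq_integrable μ g hc hi ξ
  have hfin : ∫⁻ z, ‖kq μ ρ g ξ z‖ₑ ^ 2 ≠ ⊤ := by
    have : ∀ z, ‖kq μ ρ g ξ z‖ₑ ^ 2 ≤ ENNReal.ofReal (M * μ.real univ) * ‖kq μ ρ g ξ z‖ₑ := by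
      intro z
      rw [pow_two]
      refine mul_le_mul_left ?_ _
      rw [← ofReal_norm]
      exact ENNReal.ofReal_le_ofReal (kq_norm_le μ g h0 hM ξ z)
    refine ((lintegral_mono this).trans_lt ?_).ne
    rw [lintegral_const_mul' _ _ ENNReal.ofReal_ne_top]
    exact ENNReal.mul_lt_top ENNReal.ofReal_lt_top hI.2
  rw [← plancherel _ hI (memLp2 hI hfin)]
  refine lintegral_congr fun η => ?_
  rw [kq_fourier μ g hc hi, enorm_mul, mul_pow]

theorem kq_hat (hc : Continuous ρ) (h0 : ∀ x, 0 ≤ ρ x) (ξ z : EE n) :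
    hat (μ.withDensity fun w => ENNReal.ofReal (ρ (g.symm w - z))) ξ = kq μ ρ g ξ z := by
  unfold hat kq
  rw [integral_withDensity_eq_integral_toReal_smul (by fun_prop) (Filter.Eventually.of_forall fun _ => ENNReal.ofReal_lt_top)]
  refine integral_congr_ae (Filter.Eventually.of_forall fun x => ?_)
  simp only
  rw [ENNReal.toReal_ofReal (h0 _), Complex.real_smul]

theorem Jg_le (hn : 1 ≤ n) {u : ℝ} (hu : 0 < u) (hun : u < n) (ν : Measure (EE n)) [IsFiniteMeasure ν]
    (hc : Continuous ρ) (h0 : ∀ x, 0 ≤ ρ x) (hM : ∀ x, ρ x ≤ M) (hi : Integrable ρ)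
    (hν : ∀ η : EE n, ‖∫ w, (ρ w : ℂ) * ee (inner ℝ w η)‖ ≤ ‖hat ν η‖) :
    ENNReal.ofReal (RK u) * ∫⁻ z, EI u (μ.withDensity fun w => ENNReal.ofReal (ρ (g.symm w - z))) ≤
    ENNReal.ofReal (RK (n - u)) * ∫⁻ η, ∫⁻ ξ, ‖hat ν η‖ₑ ^ 2 * (‖hat μ ξ‖ₑ ^ 2 * ‖ξ - g η‖ₑ ^ (-((n:ℝ) - u))) := by
  have hμm := (hat_continuous μ).measurable
  have hνm := (hat_continuous ν).measurable
  have hkm : Measurable (fun p : EE n × EE n => kq μ ρ g p.1 p.2) := (kq_continuous μ g hc h0 hM).measurable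
  have e1 : ENNReal.ofReal (RK u) * ∫⁻ z, EI u (μ.withDensity fun w => ENNReal.ofReal (ρ (g.symm w - z))) =
      ∫⁻ z, ENNReal.ofReal (RK (n - u)) * ∫⁻ ξ, ‖kq μ ρ g ξ z‖ₑ ^ 2 * ‖ξ‖ₑ ^ (-((n:ℝ) - u)) := by
    rw [← lintegral_const_mul' _ _ ENNReal.ofReal_ne_top]
    refine lintegral_congr fun z => ?_
    have hfin : IsFiniteMeasure (μ.withDensity fun w => ENNReal.ofReal (ρ (g.symm w - z))) := by
      apply isFiniteMeasure_withDensity_ofReal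
      refine (Integrable.of_bound (C := M) (Continuous.aestronglyMeasurable (by fun_prop)) (Filter.Eventually.of_forall fun x => ?_)).2
      rw [Real.norm_of_nonneg (h0 _)]; exact hM _
    rw [energy_id hn hu hun]
    simp only [kq_hat μ g hc h0]
  rw [e1, lintegral_const_mul' _ _ ENNReal.ofReal_ne_top]
  refine mul_le_mul_right ?_ _
  have hm1 : Measurable (Function.uncurry fun (z ξ : EE n) => ‖kq μ ρ g ξ z‖ₑ ^ 2 * ‖ξ‖ₑ ^ (-((n:ℝ) - u))) := by
    have : Measurable (fun p : EE n × EE n => kq μ ρ g p.2 p.1) := hkm.comp measurable_swap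
    unfold Function.uncurry
    fun_prop
  rw [lintegral_lintegral_swap hm1.aemeasurable]
  have e2 : ∀ ξ : EE n, ∫⁻ z, ‖kq μ ρ g ξ z‖ₑ ^ 2 * ‖ξ‖ₑ ^ (-((n:ℝ) - u)) ≤
      ∫⁻ η, ‖hat ν η‖ₑ ^ 2 * (‖hat μ (ξ + g η)‖ₑ ^ 2 * ‖ξ‖ₑ ^ (-((n:ℝ) - u))) := by
    intro ξ
    have hk2 : Measurable (fun z => kq μ ρ g ξ z) := hkm.comp (by fun_prop : Measurable fun z : EE n => (ξ, z))
    have hg : Measurable (fun η => hat μ (ξ + g η)) := hμm.comp (by fun_prop)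
    rw [lintegral_mul_const _ (by fun_prop), kq_planch μ g hc h0 hM hi, ← lintegral_mul_const'' _ ]
    · refine lintegral_mono fun η => ?_
      have : ‖∫ w, (ρ w : ℂ) * ee (inner ℝ w η)‖ₑ ≤ ‖hat ν η‖ₑ := by
        rw [← ofReal_norm, ← ofReal_norm]; exact ENNReal.ofReal_le_ofReal (hν η)
      calc _ ≤ ‖hat μ (ξ + g η)‖ₑ ^ 2 * ‖hat ν η‖ₑ ^ 2 * ‖ξ‖ₑ ^ (-((n:ℝ) - u)) := by
            refine mul_le_mul_left (mul_le_mul_right (pow_le_pow_left₀ zero_le this 2) _) _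
        _ = _ := by ring
    · have hR : Continuous (fun η : EE n => ∫ w, (ρ w : ℂ) * ee (inner ℝ w η)) := by
        refine continuous_of_dominated (bound := ρ) ?_ ?_ hi ?_
        · intro η
          exact (Complex.continuous_ofReal.comp hc).mul (ee_continuous.comp (by fun_prop)) |>.aestronglyMeasurable
        · intro η
          refine Filter.Eventually.of_forall fun x => ?_
          rw [norm_mul, norm_ee, mul_one, Complex.norm_real, Real.norm_of_nonneg (h0 _)]
        · exact Filter.Eventually.of_forall fun x => continuous_const.mul (ee_continuous.comp (by fun_prop))
      have := hR.measurable
      exact Measurable.aemeasurable (by fun_prop)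
  refine (lintegral_mono e2).trans ?_
  have hgm : Measurable (fun p : EE n × EE n => hat μ (p.1 + g p.2)) := hμm.comp (by fun_prop)
  rw [lintegral_lintegral_swap (Measurable.aemeasurable (by unfold Function.uncurry; fun_prop))]
  refine (lintegral_congr fun η => ?_).le
  have h := lintegral_add_right_eq_self (μ := (volume : Measure (EE n)))
    (fun ξ => ‖hat ν η‖ₑ ^ 2 * (‖hat μ ξ‖ₑ ^ 2 * ‖ξ - g η‖ₑ ^ (-((n:ℝ) - u)))) (g η)
  simp only [add_sub_cancel_right] at h
  exact h
end
end S17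

open MeasureTheory Metric Set
open scoped ENNReal
namespace S17
variable {n : ℕ}

theorem mollify (ν : Measure (EE n)) [IsFiniteMeasure ν] {ψ : EE n → ℝ} (hψ : Continuous ψ)
    (hsupp : Function.support ψ ⊆ closedBall 0 1) (h0 : ∀ x, 0 ≤ ψ x) (h1 : ∫ x, ψ x = 1) {ε : ℝ} (hε : 0 < ε)
    (ρ : EE n → ℝ) (hρ : ρ = fun w => ∫ y, ε ^ (-(n : ℝ)) * ψ (ε⁻¹ • (w - y)) ∂ν) :
    Continuous ρ ∧ (∀ x, 0 ≤ ρ x) ∧ (∃ M, ∀ x, ρ x ≤ M) ∧ Integrable ρ ∧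
    (∀ η : EE n, ‖∫ w, (ρ w : ℂ) * ee (inner ℝ w η)‖ ≤ ‖hat ν η‖) := by
  set φ : EE n → ℝ := fun w => ε ^ (-(n : ℝ)) * ψ (ε⁻¹ • w) with hφ
  have hφc : Continuous φ := by fun_prop
  have hφ0 : ∀ w, 0 ≤ φ w := fun w => mul_nonneg (by positivity) (h0 _)
  have hψs : HasCompactSupport ψ := HasCompactSupport.of_support_subset_isCompact (isCompact_closedBall 0 1) hsupp
  obtain ⟨M0, hM0⟩ := hψs.exists_bound_of_continuous hψ
  have hφM : ∀ w, φ w ≤ ε ^ (-(n : ℝ)) * M0 := fun w =>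
    mul_le_mul_of_nonneg_left ((le_abs_self _).trans (hM0 _)) (by positivity)
  have hψi : Integrable ψ := hψ.integrable_of_hasCompactSupport hψs
  have hφi : Integrable φ := (hψi.comp_smul (inv_ne_zero hε.ne')).const_mul _
  have hφ1 : ∫ w, φ w = 1 := by
    rw [hφ, integral_const_mul, Measure.integral_comp_inv_smul, h1, finrank_euclideanSpace_fin,
      abs_of_pos (by positivity), Real.rpow_neg hε.le, Real.rpow_natCast, smul_eq_mul, mul_one,
      inv_mul_cancel₀ (by positivity)]
  have hρ' : ∀ w, ρ w = ∫ y, φ (w - y) ∂ν := fun w => by rw [hρ]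
  have hρ0 : ∀ x, 0 ≤ ρ x := fun x => by rw [hρ']; exact integral_nonneg fun y => hφ0 _
  have hint0 : Integrable (fun p : EE n × EE n => φ (p.2 - p.1)) (ν.prod volume) := by
    rw [integrable_prod_iff (Continuous.aestronglyMeasurable (by fun_prop))]
    refine ⟨Filter.Eventually.of_forall fun x => hφi.comp_sub_right x, ?_⟩
    have : ∀ x : EE n, ∫ z, ‖φ (z - x)‖ = ∫ z, ‖φ z‖ := fun x =>
      integral_sub_right_eq_self (fun z => ‖φ z‖) x
    simp only [this]
    exact integrable_const _
  refine ⟨?_, hρ0, ⟨ε ^ (-(n : ℝ)) * M0 * ν.real univ, fun x => ?_⟩, ?_, ?_⟩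
  · have : ρ = fun w => ∫ y, φ (w - y) ∂ν := funext hρ'
    rw [this]
    refine continuous_of_dominated (bound := fun _ => ε ^ (-(n : ℝ)) * M0) ?_ ?_ (integrable_const _) ?_
    · intro w
      exact (Continuous.aestronglyMeasurable (by fun_prop))
    · intro w
      refine Filter.Eventually.of_forall fun x => ?_
      rw [Real.norm_of_nonneg (hφ0 _)]; exact hφM _
    · exact Filter.Eventually.of_forall fun x => by fun_prop
  · have h := norm_integral_le_of_norm_le_const (μ := ν) (f := fun y => φ (x - y)) (C := ε ^ (-(n : ℝ)) * M0)
      (Filter.Eventually.of_forall fun y => by rw [Real.norm_of_nonneg (hφ0 _)]; exact hφM _)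
    rw [← hρ', Real.norm_of_nonneg (hρ0 x)] at h
    exact h
  · have : ρ = fun w => ∫ y, φ (w - y) ∂ν := funext hρ'
    rw [this]
    exact hint0.integral_prod_right
  · intro η
    have e1 : ∀ w, (ρ w : ℂ) * ee (inner ℝ w η) = ∫ y, (φ (w - y) : ℂ) * ee (inner ℝ w η) ∂ν := by
      intro w
      rw [integral_mul_const, hρ', integral_complex_ofReal]
    simp_rw [e1]
    rw [integral_integral_swap]
    · have e2 : ∀ y : EE n, ∫ w, (φ (w - y) : ℂ) * ee (inner ℝ w η) = ee (inner ℝ y η) * ∫ w, (φ w : ℂ) * ee (inner ℝ w η) := by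
        intro y
        have h := integral_sub_right_eq_self (μ := (volume : Measure (EE n))) (fun w => (φ w : ℂ) * ee (inner ℝ (w + y) η)) y
        simp only [sub_add_cancel] at h
        rw [h, ← integral_const_mul]
        refine integral_congr_ae (Filter.Eventually.of_forall fun w => ?_)
        simp only
        rw [inner_add_left, ee_add]; ring
      simp_rw [e2]
      rw [integral_mul_const, norm_mul]
      have e3 : ‖∫ y : EE n, ee (inner ℝ y η) ∂ν‖ = ‖hat ν η‖ := by
        rw [← RCLike.norm_conj (hat ν η)]
        unfold hat
        rw [← integral_conj]
        simp only [conj_ee, neg_neg]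
      rw [e3]
      refine mul_le_of_le_one_right (norm_nonneg _) ?_
      refine (norm_integral_le_integral_norm _).trans ?_
      rw [← hφ1]
      refine (integral_congr_ae (Filter.Eventually.of_forall fun w => ?_)).le
      rw [norm_mul, norm_ee, mul_one, Complex.norm_real, Real.norm_of_nonneg (hφ0 _)]
    · refine hint0.swap.ofReal.mul_bdd (c := 1) ?_ (Filter.Eventually.of_forall fun x => (norm_ee _).le)
      exact (ee_continuous.comp (by fun_prop)).aestronglyMeasurable

end S17

open MeasureTheory Metric Set
open scoped ENNReal
namespace S17
variable {n : ℕ}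

noncomputable def Dj (j : ℕ) : ℝ := 1/3 * (1/2) ^ j
theorem Dj_pos (j : ℕ) : 0 < Dj j := by unfold Dj; positivity
theorem Dj_le (j : ℕ) : Dj j ≤ 1/3 := by
  unfold Dj
  have : ((1:ℝ)/2) ^ j ≤ 1 := pow_le_one₀ (by norm_num) (by norm_num)
  linarith

noncomputable def wj (b : ℝ) (j : ℕ) (η : EE n) : ℝ≥0∞ := (ENNReal.ofReal (3/8 * Dj j) * ‖η‖ₑ) ^ (-b)

theorem pt_bound {b1 b2 : ℝ} (hb1 : 0 < b1) (hb2 : 0 < b2) {ξ y η : EE n} (hy : ‖y‖ = ‖η‖) (hξ : ξ ≠ 0) (hη : η ≠ 0) (hd : ξ ≠ y) :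
    ‖ξ - y‖ₑ ^ (-(b1 + b2)) ≤ ENNReal.ofReal 5 ^ b1 * ENNReal.ofReal 4 ^ b2 * (‖ξ‖ₑ ^ (-b1) * ‖η‖ₑ ^ (-b2)) +
      ∑' j, {p : EE n × EE n | ‖p.2 - p.1‖ < Dj j * ‖η‖}.indicator (fun _ => wj (b1 + b2) j η) (y, ξ) := by
  have hd0 : 0 < ‖ξ - y‖ := norm_pos_iff.2 (sub_ne_zero.2 hd)
  have hη0 : 0 < ‖η‖ := norm_pos_iff.2 hη
  have hξ0 : 0 < ‖ξ‖ := norm_pos_iff.2 hξ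
  by_cases hfar : ‖η‖ / 4 ≤ ‖ξ - y‖
  · refine le_trans ?_ (le_self_add)
    have hx : ‖ξ‖ ≤ 5 * ‖ξ - y‖ := by
      have : ‖ξ‖ ≤ ‖ξ - y‖ + ‖y‖ := by simpa using norm_add_le (ξ - y) y
      linarith
    have hy4 : ‖η‖ ≤ 4 * ‖ξ - y‖ := by linarith
    rw [← ofReal_norm, ← ofReal_norm, ← ofReal_norm]
    rw [ENNReal.ofReal_rpow_of_pos hd0, ENNReal.ofReal_rpow_of_pos hη0, ENNReal.ofReal_rpow_of_pos hξ0,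
      ENNReal.ofReal_rpow_of_pos (by norm_num), ENNReal.ofReal_rpow_of_pos (by norm_num), ← ENNReal.ofReal_mul (by positivity),
      ← ENNReal.ofReal_mul (by positivity), ← ENNReal.ofReal_mul (by positivity)]
    apply ENNReal.ofReal_le_ofReal
    have h1 : ‖ξ - y‖ ^ (-b1) ≤ 5 ^ b1 * ‖ξ‖ ^ (-b1) := by
      have := Real.rpow_le_rpow_of_nonpos hξ0 hx (show -b1 ≤ 0 by linarith)
      rw [Real.mul_rpow (by norm_num) hd0.le] at this
      calc ‖ξ - y‖ ^ (-b1) = 5 ^ b1 * (5 ^ (-b1) * ‖ξ - y‖ ^ (-b1)) := by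
            rw [← mul_assoc, ← Real.rpow_add (by norm_num)]; simp
        _ ≤ _ := by gcongr
    have h2 : ‖ξ - y‖ ^ (-b2) ≤ 4 ^ b2 * ‖η‖ ^ (-b2) := by
      have := Real.rpow_le_rpow_of_nonpos hη0 hy4 (show -b2 ≤ 0 by linarith)
      rw [Real.mul_rpow (by norm_num) hd0.le] at this
      calc ‖ξ - y‖ ^ (-b2) = 4 ^ b2 * (4 ^ (-b2) * ‖ξ - y‖ ^ (-b2)) := by
            rw [← mul_assoc, ← Real.rpow_add (by norm_num)]; simp
        _ ≤ _ := by gcongr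
    rw [neg_add, Real.rpow_add hd0]
    calc _ ≤ (5 ^ b1 * ‖ξ‖ ^ (-b1)) * (4 ^ b2 * ‖η‖ ^ (-b2)) := by gcongr
      _ = _ := by ring
  · push Not at hfar
    obtain ⟨j, hj1, hj2⟩ := exists_nat_pow_near_of_lt_one (x := 4 * ‖ξ - y‖ / ‖η‖) (y := (1/2 : ℝ))
      (by positivity) (by rw [div_le_one hη0]; linarith) (by norm_num) (by norm_num)
    rw [div_le_iff₀ hη0] at hj2
    rw [lt_div_iff₀ hη0] at hj1
    have hD : (1/2:ℝ) ^ j = 3 * Dj j := by unfold Dj; ring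
    rw [pow_succ, hD] at hj1
    rw [hD] at hj2
    have hDp := mul_pos (Dj_pos j) hη0
    refine le_trans ?_ (le_add_self)
    refine le_trans ?_ (ENNReal.le_tsum j)
    rw [indicator_of_mem (show (y, ξ) ∈ {p : EE n × EE n | ‖p.2 - p.1‖ < Dj j * ‖η‖} by
      show ‖ξ - y‖ < Dj j * ‖η‖
      linarith)]
    unfold wj
    refine rpow_anti (by linarith) ?_
    rw [← ofReal_norm, ← ofReal_norm, ← ENNReal.ofReal_mul (by have := Dj_pos j; positivity)]
    apply ENNReal.ofReal_le_ofReal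
    linarith

theorem exists_idx {e : ℝ} (he : 0 < e) : ∃ c : EE n → ℕ, Measurable c ∧
    ∀ x, x ≠ 0 → ‖TopologicalSpace.denseSeq (EE n) (c x) - x‖ < e * ‖x‖ := by
  classical
  have hp : ∀ x : EE n, ∃ N, ‖TopologicalSpace.denseSeq (EE n) N - x‖ < e * ‖x‖ ∨ x = 0 := by
    intro x
    by_cases hx : x = 0
    · exact ⟨0, Or.inr hx⟩
    · obtain ⟨N, hN⟩ := (TopologicalSpace.denseRange_denseSeq (EE n)).exists_dist_lt x
        (show 0 < e * ‖x‖ from mul_pos he (norm_pos_iff.2 hx))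
      exact ⟨N, Or.inl (by rwa [dist_comm, dist_eq_norm] at hN)⟩
  refine ⟨fun x => Nat.find (hp x), measurable_find hp fun k => ?_, fun x hx => ?_⟩
  · have h1 : IsOpen {x : EE n | ‖TopologicalSpace.denseSeq (EE n) k - x‖ < e * ‖x‖} :=
      isOpen_lt (by fun_prop) (by fun_prop)
    exact h1.measurableSet.union (measurableSet_singleton 0)
  · exact (Nat.find_spec (hp x)).resolve_right hx

theorem disc {D : ℝ} (hD0 : 0 < D) (hD : D ≤ 1/3) {ξ η p q : EE n} (g : EE n ≃ₗᵢ[ℝ] EE n) (hη : η ≠ 0) 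
    (hp : ‖p - ξ‖ < D/4 * ‖ξ‖) (hq : ‖q - η‖ < D/4 * ‖η‖) (hd : ‖ξ - g η‖ < D * ‖η‖) :
    ‖p - g q‖ < 2 * D * ‖q‖ := by
  have hη0 : 0 < ‖η‖ := norm_pos_iff.2 hη
  have h1 : ‖p - g q‖ ≤ ‖p - ξ‖ + ‖ξ - g η‖ + ‖q - η‖ := by
    have e : p - g q = (p - ξ) + (ξ - g η) + (- g (q - η)) := by rw [map_sub]; abel
    rw [e]
    refine (norm_add₃_le).trans ?_
    rw [norm_neg, g.norm_map]
  have h2 : ‖ξ‖ ≤ ‖ξ - g η‖ + ‖η‖ := by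
    have := norm_add_le (ξ - g η) (g η)
    rw [g.norm_map] at this
    simpa using this
  have h3 : ‖η‖ ≤ ‖q - η‖ + ‖q‖ := by
    have := norm_sub_le q (q - η)
    simp only [sub_sub_cancel] at this
    linarith
  have h4 : D * ‖η‖ ≤ 1/3 * ‖η‖ := by gcongr
  have h5 : ‖η‖ ≤ 12/11 * ‖q‖ := by linarith
  have h6 : D/4 * ‖ξ‖ ≤ D/4 * (4/3 * ‖η‖) := by gcongr; linarith
  have h7 : D * ‖η‖ ≤ D * (12/11 * ‖q‖) := by gcongr
  nlinarith [mul_pos hD0 hη0]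

end S17

open MeasureTheory Metric Set
open scoped ENNReal
namespace S17
variable {n : ℕ}

theorem ae_ne [Nonempty (Fin n)] (a : EE n) : ∀ᵐ ξ : EE n, ξ ≠ a :=
  (measure_eq_zero_iff_ae_notMem (s := {a})).1 (measure_singleton a)

theorem near_j (hn : 1 ≤ n) [MeasurableSpace (EE n ≃ₗᵢ[ℝ] EE n)] (θ : Measure (EE n ≃ₗᵢ[ℝ] EE n)) [IsFiniteMeasure θ]
    {b β : ℝ} (hβ : b < β) (hθ : ∀ x z : EE n, x ≠ 0 → z ≠ 0 → ∀ r : ℝ, 0 < r →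
          θ {g | ‖x - g z‖ < r} ≤ ENNReal.ofReal ((r / ‖z‖) ^ β))
    {D : ℝ} (hD0 : 0 < D) (hD : D ≤ 1/3) {f h w : EE n → ℝ≥0∞} (hf : Measurable f) (hh : Measurable h) (hw : Measurable w) :
    ∃ Φ : (EE n ≃ₗᵢ[ℝ] EE n) → ℝ≥0∞, Measurable Φ ∧
    (∀ g : EE n ≃ₗᵢ[ℝ] EE n, ∫⁻ η, ∫⁻ ξ, h η * (f ξ * {p : EE n × EE n | ‖p.2 - p.1‖ < D * ‖η‖}.indicator (fun _ => w η) (g η, ξ)) ≤ Φ g) ∧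
    ∫⁻ g, Φ g ∂θ ≤ ENNReal.ofReal ((2 * D) ^ b) *
      ∫⁻ η, ∫⁻ ξ, h η * (f ξ * {p : EE n × EE n | |‖p.2‖ - ‖p.1‖| < D * ‖p.1‖}.indicator (fun p => w p.1) (η, ξ)) := by
  have hNE : Nonempty (Fin n) := ⟨⟨0, hn⟩⟩
  obtain ⟨c, hcm, hc⟩ := exists_idx (n := n) (e := D/4) (by positivity)
  set P := TopologicalSpace.denseSeq (EE n)
  obtain ⟨S, hS⟩ : ∃ S : ℕ → ℕ → Set (EE n ≃ₗᵢ[ℝ] EE n), S = fun i k => toMeasurable θ {g | ‖P i - g (P k)‖ < 2 * D * ‖P k‖} := ⟨_, rfl⟩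
  have hSm : ∀ i k, MeasurableSet (S i k) := fun i k => by rw [hS]; exact measurableSet_toMeasurable _ _
  set Sh : Set (EE n × EE n) := {p : EE n × EE n | |‖p.2‖ - ‖p.1‖| < D * ‖p.1‖} with hSh
  have hShm : MeasurableSet Sh := (isOpen_lt (by fun_prop) (by fun_prop)).measurableSet
  set W : EE n × EE n → ℝ≥0∞ := fun p => h p.1 * (f p.2 * Sh.indicator (fun p => w p.1) p) with hW
  have hWm : Measurable W := by
    have : Measurable (Sh.indicator (fun p : EE n × EE n => w p.1)) := (hw.comp measurable_fst).indicator hShm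
    fun_prop
  set I : Set ((EE n ≃ₗᵢ[ℝ] EE n) × (EE n × EE n)) := {q | q.1 ∈ S (c q.2.2) (c q.2.1)} with hI
  have hIm : MeasurableSet I := by
    have : I = ⋃ i, ⋃ k, (S i k) ×ˢ {p : EE n × EE n | c p.2 = i ∧ c p.1 = k} := by
      ext q
      simp only [hI, mem_setOf_eq, mem_iUnion, mem_prod]
      constructor
      · intro hq
        exact ⟨_, _, hq, rfl, rfl⟩
      · rintro ⟨i, k, hq, rfl, rfl⟩
        exact hq
    rw [this]
    refine MeasurableSet.iUnion fun i => MeasurableSet.iUnion fun k => ?_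
    refine (hSm i k).prod ?_
    exact ((hcm.comp measurable_snd) (measurableSet_singleton i)).inter ((hcm.comp measurable_fst) (measurableSet_singleton k))
  have hIi : Measurable (I.indicator (fun _ => (1:ℝ≥0∞))) := measurable_const.indicator hIm
  have s1 : ∀ g : EE n ≃ₗᵢ[ℝ] EE n,
      ∫⁻ η, ∫⁻ ξ, h η * (f ξ * {p : EE n × EE n | ‖p.2 - p.1‖ < D * ‖η‖}.indicator (fun _ => w η) (g η, ξ)) ≤
      ∫⁻ p, W p * I.indicator (fun _ => (1:ℝ≥0∞)) (g, p) ∂(volume.prod volume) := by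
    intro g
    rw [lintegral_prod _ (Measurable.aemeasurable (by fun_prop))]
    refine lintegral_mono_ae ?_
    filter_upwards [ae_ne (n := n) 0] with η hη
    refine lintegral_mono_ae ?_
    filter_upwards [ae_ne (n := n) 0] with ξ hξ
    by_cases hd : ‖ξ - g η‖ < D * ‖η‖
    · have m1 : (η, ξ) ∈ Sh := by
        show |‖ξ‖ - ‖η‖| < D * ‖η‖
        refine lt_of_le_of_lt ?_ hd
        rw [← g.norm_map η]
        exact abs_norm_sub_norm_le _ _
      have m2 : (g, (η, ξ)) ∈ I := by
        show g ∈ S (c ξ) (c η)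
        rw [hS]
        refine subset_toMeasurable _ _ ?_
        exact disc hD0 hD g hη (hc ξ hξ) (hc η hη) hd
      rw [indicator_of_mem m2, mul_one, hW]
      simp only
      rw [indicator_of_mem m1, indicator_of_mem (show (g η, ξ) ∈ {p : EE n × EE n | ‖p.2 - p.1‖ < D * ‖η‖} from hd)]
    · rw [indicator_of_notMem (show (g η, ξ) ∉ {p : EE n × EE n | ‖p.2 - p.1‖ < D * ‖η‖} from hd)]
      simp
  have hΦm : Measurable (fun q : (EE n ≃ₗᵢ[ℝ] EE n) × (EE n × EE n) => W q.2 * I.indicator (fun _ => (1:ℝ≥0∞)) q) :=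
    (hWm.comp measurable_snd).mul hIi
  refine ⟨fun g => ∫⁻ p, W p * I.indicator (fun _ => (1:ℝ≥0∞)) (g, p) ∂(volume.prod volume), hΦm.lintegral_prod_right', s1, ?_⟩
  rw [lintegral_lintegral_swap (Measurable.aemeasurable (by unfold Function.uncurry; fun_prop))]
  have s2 : ∀ p : EE n × EE n, ∫⁻ g, W p * I.indicator (fun _ => (1:ℝ≥0∞)) (g, p) ∂θ = W p * θ (S (c p.2) (c p.1)) := by
    intro p
    have hm : Measurable (fun g => I.indicator (fun _ => (1:ℝ≥0∞)) (g, p)) := hIi.comp measurable_prodMk_right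
    rw [lintegral_const_mul _ hm]
    congr 1
    have : (fun g => I.indicator (fun _ => (1:ℝ≥0∞)) (g, p)) = (S (c p.2) (c p.1)).indicator (fun _ => 1) := by
      funext g
      rfl
    rw [this, lintegral_indicator (hSm _ _), setLIntegral_const, one_mul]
  have hθm : Measurable (fun p : EE n × EE n => θ (S (c p.2) (c p.1))) := by
    have h1 : Measurable (fun q : ℕ × ℕ => θ (S q.1 q.2)) := measurable_of_countable _
    exact h1.comp ((hcm.comp measurable_snd).prodMk (hcm.comp measurable_fst))
  rw [lintegral_congr s2]
  have hpm : Measurable (fun p : EE n × EE n => W p * θ (S (c p.2) (c p.1))) := hWm.mul hθm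
  rw [lintegral_prod _ hpm.aemeasurable, ← lintegral_const_mul' _ _ ENNReal.ofReal_ne_top]
  refine lintegral_mono_ae ?_
  filter_upwards [ae_ne (n := n) 0] with η hη
  rw [← lintegral_const_mul' _ _ ENNReal.ofReal_ne_top]
  refine lintegral_mono_ae ?_
  filter_upwards [ae_ne (n := n) 0] with ξ hξ
  rw [mul_comm]
  refine mul_le_mul_left ?_ _
  have hne : ∀ x : EE n, x ≠ 0 → P (c x) ≠ 0 := by
    intro x hx h0
    have := hc x hx
    rw [h0, zero_sub, norm_neg] at this
    have hx0 := norm_pos_iff.2 hx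
    nlinarith
  simp only [hS]
  rw [measure_toMeasurable]
  have hq0 := norm_pos_iff.2 (hne η hη)
  refine (hθ _ _ (hne ξ hξ) (hne η hη) (2 * D * ‖P (c η)‖) (by positivity)).trans ?_
  apply ENNReal.ofReal_le_ofReal
  rw [mul_div_cancel_right₀ _ hq0.ne']
  exact Real.rpow_le_rpow_of_exponent_ge (by positivity) (by linarith) hβ.le

end S17

open MeasureTheory Metric Set
open scoped ENNReal
namespace S17
variable {n : ℕ}

theorem wj_meas (b : ℝ) (j : ℕ) : Measurable (wj (n := n) b j) := by
  unfold wj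
  exact ((measurable_enorm.const_mul _).pow_const _)

/-- the near part for one scale -/
theorem near_val (hn : 1 ≤ n) {b1 b2 κ : ℝ} {A B : ℝ≥0∞}
    {f h : EE n → ℝ≥0∞} (hf : Measurable f) (hh : Measurable h)
    (ha : ∀ r δ : ℝ, 0 < r → 0 < δ → δ ≤ 1/3 → ∫⁻ ξ in {ξ : EE n | |‖ξ‖ - r| < δ * r}, f ξ ≤
      A * ENNReal.ofReal (δ ^ κ) * ENNReal.ofReal (r ^ b1))
    (hB : ∫⁻ η, h η * ‖η‖ₑ ^ (-b2) ≤ B) (j : ℕ) :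
    ENNReal.ofReal ((2 * Dj j) ^ (b1 + b2)) *
      ∫⁻ η, ∫⁻ ξ, h η * (f ξ * {p : EE n × EE n | |‖p.2‖ - ‖p.1‖| < Dj j * ‖p.1‖}.indicator (fun p => wj (b1 + b2) j p.1) (η, ξ))
      ≤ ENNReal.ofReal ((16/3) ^ (b1 + b2)) * ENNReal.ofReal (Dj j ^ κ) * A * B := by
  have hNE : Nonempty (Fin n) := ⟨⟨0, hn⟩⟩
  have hD := Dj_pos j
  have key : ∀ η : EE n, η ≠ 0 →
      ∫⁻ ξ, h η * (f ξ * {p : EE n × EE n | |‖p.2‖ - ‖p.1‖| < Dj j * ‖p.1‖}.indicator (fun p => wj (b1 + b2) j p.1) (η, ξ)) ≤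
      (ENNReal.ofReal ((3/8 * Dj j) ^ (-(b1+b2))) * ENNReal.ofReal (Dj j ^ κ) * A) * (h η * ‖η‖ₑ ^ (-b2)) := by
    intro η hη
    have hη0 := norm_pos_iff.2 hη
    have hSm : MeasurableSet {ξ : EE n | |‖ξ‖ - ‖η‖| < Dj j * ‖η‖} := (isOpen_lt (by fun_prop) (by fun_prop)).measurableSet
    have e1 : ∀ ξ, h η * (f ξ * {p : EE n × EE n | |‖p.2‖ - ‖p.1‖| < Dj j * ‖p.1‖}.indicator (fun p => wj (b1 + b2) j p.1) (η, ξ))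
        = (h η * wj (b1+b2) j η) * {ξ : EE n | |‖ξ‖ - ‖η‖| < Dj j * ‖η‖}.indicator f ξ := by
      intro ξ
      by_cases hm : |‖ξ‖ - ‖η‖| < Dj j * ‖η‖
      · rw [indicator_of_mem (show (η, ξ) ∈ {p : EE n × EE n | |‖p.2‖ - ‖p.1‖| < Dj j * ‖p.1‖} from hm),
          indicator_of_mem (show ξ ∈ {ξ : EE n | |‖ξ‖ - ‖η‖| < Dj j * ‖η‖} from hm)]
        ring
      · rw [indicator_of_notMem (show (η, ξ) ∉ {p : EE n × EE n | |‖p.2‖ - ‖p.1‖| < Dj j * ‖p.1‖} from hm),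
          indicator_of_notMem (show ξ ∉ {ξ : EE n | |‖ξ‖ - ‖η‖| < Dj j * ‖η‖} from hm)]
        simp
    rw [lintegral_congr e1, lintegral_const_mul _ (hf.indicator hSm), lintegral_indicator hSm]
    refine (mul_le_mul_right (ha _ _ hη0 hD (Dj_le j)) _).trans (le_of_eq ?_)
    have e2 : wj (b1+b2) j η * ENNReal.ofReal (‖η‖ ^ b1) = ENNReal.ofReal ((3/8 * Dj j) ^ (-(b1+b2))) * ‖η‖ₑ ^ (-b2) := by
      unfold wj
      rw [← ofReal_norm, ← ENNReal.ofReal_mul (by positivity), ENNReal.ofReal_rpow_of_pos (by positivity),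
        ENNReal.ofReal_rpow_of_pos hη0, ← ENNReal.ofReal_mul (by positivity), ← ENNReal.ofReal_mul (by positivity),
        Real.mul_rpow (by positivity) hη0.le, mul_assoc, ← Real.rpow_add hη0]
      congr 3
      ring
    calc _ = (wj (b1+b2) j η * ENNReal.ofReal (‖η‖ ^ b1)) * (h η * (A * ENNReal.ofReal (Dj j ^ κ))) := by ring
      _ = _ := by rw [e2]; ring
  have s1 : ∫⁻ η, ∫⁻ ξ, h η * (f ξ * {p : EE n × EE n | |‖p.2‖ - ‖p.1‖| < Dj j * ‖p.1‖}.indicator (fun p => wj (b1 + b2) j p.1) (η, ξ)) ≤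
      (ENNReal.ofReal ((3/8 * Dj j) ^ (-(b1+b2))) * ENNReal.ofReal (Dj j ^ κ) * A) * B := by
    refine le_trans ?_ (mul_le_mul_right hB _)
    have k2 : Measurable (fun x : EE n => h x * ‖x‖ₑ ^ (-b2)) := hh.mul (measurable_enorm.pow_const _)
    rw [← lintegral_const_mul _ k2]
    refine lintegral_mono_ae ?_
    filter_upwards [ae_ne (n := n) 0] with η hη
    exact key η hη
  refine (mul_le_mul_right s1 _).trans (le_of_eq ?_)
  have e3 : ENNReal.ofReal ((2 * Dj j) ^ (b1 + b2)) * ENNReal.ofReal ((3/8 * Dj j) ^ (-(b1+b2))) = ENNReal.ofReal ((16/3) ^ (b1 + b2)) := by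
    rw [← ENNReal.ofReal_mul (by positivity), Real.rpow_neg (by positivity), ← div_eq_mul_inv, ← Real.div_rpow (by positivity) (by positivity)]
    congr 2
    field_simp
    norm_num
  rw [← e3]
  ring

theorem Dj_sum {κ : ℝ} (hκ : 0 < κ) : ∑' j, ENNReal.ofReal (Dj j ^ κ) ≠ ⊤ := by
  have e : ∀ j, Dj j ^ κ = (1/3) ^ κ * ((1/2) ^ κ) ^ j := by
    intro j
    unfold Dj
    rw [Real.mul_rpow (by norm_num) (by positivity), ← Real.rpow_natCast, ← Real.rpow_natCast, ← Real.rpow_mul (by norm_num),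
      ← Real.rpow_mul (by norm_num), mul_comm κ]
  have hs : Summable (fun j => Dj j ^ κ) := by
    simp_rw [e]
    refine (summable_geometric_of_lt_one (by positivity) ?_).mul_left _
    exact Real.rpow_lt_one (by norm_num) (by norm_num) hκ
  exact hs.tsum_ofReal_ne_top

theorem combined (hn : 1 ≤ n) [MeasurableSpace (EE n ≃ₗᵢ[ℝ] EE n)] (θ : Measure (EE n ≃ₗᵢ[ℝ] EE n)) (hθ1 : θ univ ≤ 1)
    {b1 b2 κ β : ℝ} (hb1 : 0 < b1) (hb2 : 0 < b2) (hβ : b1 + b2 < β) (hθ : ∀ x z : EE n, x ≠ 0 → z ≠ 0 → ∀ r : ℝ, 0 < r →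
          θ {g | ‖x - g z‖ < r} ≤ ENNReal.ofReal ((r / ‖z‖) ^ β))
    {A A' B : ℝ≥0∞} {f h : EE n → ℝ≥0∞} (hf : Measurable f) (hh : Measurable h)
    (ha : ∀ r δ : ℝ, 0 < r → 0 < δ → δ ≤ 1/3 → ∫⁻ ξ in {ξ : EE n | |‖ξ‖ - r| < δ * r}, f ξ ≤
      A * ENNReal.ofReal (δ ^ κ) * ENNReal.ofReal (r ^ b1))
    (hA : ∫⁻ ξ, f ξ * ‖ξ‖ₑ ^ (-b1) ≤ A') (hB : ∫⁻ η, h η * ‖η‖ₑ ^ (-b2) ≤ B) :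
    ∫⁻ g, ∫⁻ η, ∫⁻ ξ, h η * (f ξ * ‖ξ - g η‖ₑ ^ (-(b1 + b2))) ∂volume ∂volume ∂θ ≤
      ENNReal.ofReal 5 ^ b1 * ENNReal.ofReal 4 ^ b2 * A' * B +
        ENNReal.ofReal ((16/3) ^ (b1 + b2)) * (∑' j, ENNReal.ofReal (Dj j ^ κ)) * A * B := by
  have hNE : Nonempty (Fin n) := ⟨⟨0, hn⟩⟩
  have hfin : IsFiniteMeasure θ := ⟨lt_of_le_of_lt hθ1 ENNReal.one_lt_top⟩
  have hΦ := fun j => near_j hn θ hβ hθ (Dj_pos j) (Dj_le j) hf hh (wj_meas (n := n) (b1 + b2) j)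
  choose Φ hΦm hΦ1 hΦ2 using hΦ
  set F : ℝ≥0∞ := ENNReal.ofReal 5 ^ b1 * ENNReal.ofReal 4 ^ b2 * A' * B with hF
  set c : ℝ≥0∞ := ENNReal.ofReal 5 ^ b1 * ENNReal.ofReal 4 ^ b2 with hc
  have pg : ∀ g : EE n ≃ₗᵢ[ℝ] EE n, ∫⁻ η, ∫⁻ ξ, h η * (f ξ * ‖ξ - g η‖ₑ ^ (-(b1 + b2))) ≤ F + ∑' j, Φ j g := by
    intro g
    have mj : ∀ j, Measurable (fun p : EE n × EE n => h p.1 * (f p.2 *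
        {q : EE n × EE n | ‖q.2 - q.1‖ < Dj j * ‖p.1‖}.indicator (fun _ => wj (b1 + b2) j p.1) (g p.1, p.2))) := by
      intro j
      have hS : MeasurableSet {p : EE n × EE n | ‖p.2 - g p.1‖ < Dj j * ‖p.1‖} :=
        (isOpen_lt (by fun_prop) (by fun_prop)).measurableSet
      have := ((wj_meas (n := n) (b1 + b2) j).comp (measurable_fst (β := EE n))).indicator hS
      exact (hh.comp measurable_fst).mul ((hf.comp measurable_snd).mul this)
    have m1 : Measurable (fun p : EE n × EE n => h p.1 * (f p.2 * (c * (‖p.2‖ₑ ^ (-b1) * ‖p.1‖ₑ ^ (-b2))))) := by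
      have k1 : Measurable (fun x : EE n => ‖x‖ₑ ^ (-b1)) := measurable_enorm.pow_const _
      have k2 : Measurable (fun x : EE n => ‖x‖ₑ ^ (-b2)) := measurable_enorm.pow_const _
      fun_prop
    have st : ∫⁻ η, ∫⁻ ξ, h η * (f ξ * ‖ξ - g η‖ₑ ^ (-(b1 + b2))) ≤
        ∫⁻ η, ((∫⁻ ξ, h η * (f ξ * (c * (‖ξ‖ₑ ^ (-b1) * ‖η‖ₑ ^ (-b2))))) + ∑' j, ∫⁻ ξ, h η * (f ξ *
        {q : EE n × EE n | ‖q.2 - q.1‖ < Dj j * ‖η‖}.indicator (fun _ => wj (b1 + b2) j η) (g η, ξ))) := by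
      refine lintegral_mono_ae ?_
      filter_upwards [ae_ne (n := n) 0] with η hη
      have mj' : ∀ j, Measurable (fun ξ : EE n => h η * (f ξ *
        {q : EE n × EE n | ‖q.2 - q.1‖ < Dj j * ‖η‖}.indicator (fun _ => wj (b1 + b2) j η) (g η, ξ))) :=
        fun j => (mj j).comp (measurable_prodMk_left (x := η))
      have m1' : Measurable (fun ξ : EE n => h η * (f ξ * (c * (‖ξ‖ₑ ^ (-b1) * ‖η‖ₑ ^ (-b2))))) :=
        m1.comp (measurable_prodMk_left (x := η))
      rw [← lintegral_tsum (fun j => (mj' j).aemeasurable), ← lintegral_add_left m1']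
      refine lintegral_mono_ae ?_
      filter_upwards [ae_ne (n := n) 0, ae_ne (n := n) (g η)] with ξ hξ hd
      rw [ENNReal.tsum_mul_left, ENNReal.tsum_mul_left, ← mul_add, ← mul_add]
      refine mul_le_mul_right (mul_le_mul_right ?_ _) _
      exact pt_bound hb1 hb2 (g.norm_map η) hξ hη hd
    refine st.trans ?_
    rw [lintegral_add_left m1.lintegral_prod_right', lintegral_tsum (fun j => (mj j).lintegral_prod_right'.aemeasurable)]
    refine add_le_add ?_ (ENNReal.tsum_le_tsum fun j => hΦ1 j g)
    have e : ∀ η : EE n, ∫⁻ ξ, h η * (f ξ * (c * (‖ξ‖ₑ ^ (-b1) * ‖η‖ₑ ^ (-b2)))) =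
        (c * ∫⁻ ξ, f ξ * ‖ξ‖ₑ ^ (-b1)) * (h η * ‖η‖ₑ ^ (-b2)) := by
      intro η
      have k1 : Measurable (fun x : EE n => f x * ‖x‖ₑ ^ (-b1)) := hf.mul (measurable_enorm.pow_const _)
      calc _ = ∫⁻ ξ, (c * (h η * ‖η‖ₑ ^ (-b2))) * (f ξ * ‖ξ‖ₑ ^ (-b1)) := lintegral_congr fun ξ => by ring
        _ = _ := by rw [lintegral_const_mul _ k1]; ring
    have k2 : Measurable (fun x : EE n => h x * ‖x‖ₑ ^ (-b2)) := hh.mul (measurable_enorm.pow_const _)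
    rw [lintegral_congr e, lintegral_const_mul _ k2, hF]
    gcongr
  refine (lintegral_mono pg).trans ?_
  rw [lintegral_add_left measurable_const, lintegral_const, lintegral_tsum (fun j => (hΦm j).aemeasurable)]
  refine add_le_add ?_ ?_
  · calc F * θ univ ≤ F * 1 := by gcongr
      _ = F := mul_one _
  · rw [← ENNReal.tsum_mul_left, ← ENNReal.tsum_mul_right, ← ENNReal.tsum_mul_right]
    exact ENNReal.tsum_le_tsum fun j => (hΦ2 j).trans (near_val hn hf hh ha hB j)

end S17

open MeasureTheory Metric Set
open scoped ENNReal
namespace S17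
variable {n : ℕ}

theorem energy_le (hn : 1 ≤ n) {a : ℝ} (ha : 0 < a) (han : a < n) (m : Measure (EE n)) [IsFiniteMeasure m] :
    ∫⁻ ξ, ‖hat m ξ‖ₑ ^ 2 * ‖ξ‖ₑ ^ (-((n:ℝ) - a)) ≤ ENNReal.ofReal (RK a / RK (n - a)) * EI a m := by
  have h := energy_id hn ha han m
  have hp := RK_pos (show 0 < (n:ℝ) - a by linarith)
  rw [ENNReal.ofReal_div_of_pos hp, ENNReal.mul_comm_div, ← ENNReal.mul_comm_div, mul_comm, ← mul_div_assoc, ENNReal.le_div_iff_mul_le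
    (Or.inl (by simpa using hp)) (Or.inl ENNReal.ofReal_ne_top), mul_comm, ← h, mul_comm]

theorem main (hn : 1 ≤ n) {s t : ℝ} (hs : 0 < s) (hsn : s < n) (ht : 0 < t) (htn : t < n)
    (hu : 0 < s + t - n) [MeasurableSpace (EE n ≃ₗᵢ[ℝ] EE n)] :
    ∃ C : ℝ≥0∞, C ≠ ⊤ ∧
      ∀ (θ : Measure (EE n ≃ₗᵢ[ℝ] EE n)) (β : ℝ),
        (n : ℝ) - (s + t - n) < β →
        θ Set.univ ≤ 1 →
        (∀ x z : EE n, x ≠ 0 → z ≠ 0 → ∀ r : ℝ, 0 < r →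
          θ {g | ‖x - g z‖ < r} ≤ ENNReal.ofReal ((r / ‖z‖) ^ β)) →
      ∀ (μ ν : Measure (EE n)),
        IsFiniteMeasure μ → IsFiniteMeasure ν →
        EI s μ < ⊤ →
      ∀ (ψ : EE n → ℝ), Continuous ψ →
        Function.support ψ ⊆ Metric.closedBall 0 1 → (∀ x, 0 ≤ ψ x) → (∫ x, ψ x) = 1 →
      ∀ ε : ℝ, 0 < ε →
      ∀ νε : EE n → ℝ,
        (νε = fun w => ∫ y, ε ^ (-(n : ℝ)) * ψ (ε⁻¹ • (w - y)) ∂ν) →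
        (∫⁻ g, ∫⁻ z, EI (s + t - n) (μ.withDensity fun w => ENNReal.ofReal (νε (LinearIsometryEquiv.symm g w - z))) ∂volume ∂θ)
          ≤ C * EI s μ * EI t ν := by
  obtain ⟨κ, C0, hκ, hC0, hP⟩ := prop2 hs hsn hn
  obtain ⟨S, hS⟩ : ∃ S, S = ∑' j, ENNReal.ofReal (Dj j ^ κ) := ⟨_, rfl⟩
  have hSf : S ≠ ⊤ := hS ▸ Dj_sum hκ
  have hpu := RK_pos hu
  obtain ⟨q1, hq1⟩ : ∃ q, q = ENNReal.ofReal (RK s / RK (n - s)) := ⟨_, rfl⟩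
  obtain ⟨q2, hq2⟩ : ∃ q, q = ENNReal.ofReal (RK t / RK (n - t)) := ⟨_, rfl⟩
  obtain ⟨q3, hq3⟩ : ∃ q, q = ENNReal.ofReal (RK (n - (s + t - n)) / RK (s + t - n)) := ⟨_, rfl⟩
  have hq1f : q1 ≠ ⊤ := hq1 ▸ ENNReal.ofReal_ne_top
  have hq2f : q2 ≠ ⊤ := hq2 ▸ ENNReal.ofReal_ne_top
  have hq3f : q3 ≠ ⊤ := hq3 ▸ ENNReal.ofReal_ne_top
  obtain ⟨c, hc⟩ : ∃ c, c = ENNReal.ofReal 5 ^ ((n:ℝ) - s) * ENNReal.ofReal 4 ^ ((n:ℝ) - t) := ⟨_, rfl⟩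
  have hcf : c ≠ ⊤ := by
    rw [hc]
    exact ENNReal.mul_ne_top (ENNReal.rpow_ne_top_of_nonneg (by linarith) ENNReal.ofReal_ne_top)
      (ENNReal.rpow_ne_top_of_nonneg (by linarith) ENNReal.ofReal_ne_top)
  obtain ⟨d, hd⟩ : ∃ d, d = ENNReal.ofReal ((16/3) ^ (((n:ℝ) - s) + ((n:ℝ) - t))) := ⟨_, rfl⟩
  have hdf : d ≠ ⊤ := hd ▸ ENNReal.ofReal_ne_top
  refine ⟨q3 * (c * q1 * q2 + d * S * C0 * q2), ?_, ?_⟩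
  · exact ENNReal.mul_ne_top hq3f (ENNReal.add_ne_top.2 ⟨ENNReal.mul_ne_top (ENNReal.mul_ne_top hcf hq1f) hq2f,
      ENNReal.mul_ne_top (ENNReal.mul_ne_top (ENNReal.mul_ne_top hdf hSf) hC0) hq2f⟩)
  intro θ β hβ hθ1 hθ μ ν hμ hν hE ψ hψ hsupp h0 h1 ε hε νε hνε
  obtain ⟨m1, m2, ⟨M, m3⟩, m4, m5⟩ := mollify ν hψ hsupp h0 h1 hε νε hνε
  have hb : ((n:ℝ) - s) + ((n:ℝ) - t) = (n:ℝ) - (s + t - n) := by ring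
  have comb := combined hn θ hθ1 (b1 := (n:ℝ) - s) (b2 := (n:ℝ) - t) (κ := κ) (β := β) (by linarith) (by linarith)
    (by rw [hb]; exact hβ) hθ (A := C0 * EI s μ) (A' := q1 * EI s μ) (B := q2 * EI t ν)
    (f := fun ξ => ‖hat μ ξ‖ₑ ^ 2) (h := fun ξ => ‖hat ν ξ‖ₑ ^ 2)
    ((hat_continuous μ).measurable.enorm.pow_const _) ((hat_continuous ν).measurable.enorm.pow_const _)
    (fun r δ hr hδ hδ3 => (hP μ hμ hE r δ hr hδ hδ3).trans (le_of_eq (by ring)))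
    (hq1 ▸ energy_le hn hs hsn μ) (hq2 ▸ energy_le hn ht htn ν)
  rw [← hc, ← hd, ← hS, hb] at comb
  have pg : ∀ g : EE n ≃ₗᵢ[ℝ] EE n,
      ∫⁻ z, EI (s + t - n) (μ.withDensity fun w => ENNReal.ofReal (νε (g.symm w - z))) ≤
      q3 * ∫⁻ η, ∫⁻ ξ, ‖hat ν η‖ₑ ^ 2 * (‖hat μ ξ‖ₑ ^ 2 * ‖ξ - g η‖ₑ ^ (-((n:ℝ) - (s + t - n)))) := by
    intro g
    have h := Jg_le μ g hn hu (by linarith) ν m1 m2 m3 m4 m5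
    rw [hq3, ENNReal.ofReal_div_of_pos hpu, ENNReal.mul_comm_div, ← mul_div_assoc, ENNReal.le_div_iff_mul_le
      (Or.inl (by simpa using hpu)) (Or.inl ENNReal.ofReal_ne_top), mul_comm]
    exact h
  refine (lintegral_mono pg).trans ?_
  rw [lintegral_const_mul' _ _ hq3f]
  refine (mul_le_mul_right comb _).trans (le_of_eq (by ring))

end S17

theorem stmt17 (n : ℕ) (s t : ℝ) (hs : 0 < s) (hsn : s < n) (ht : 0 < t) (htn : t < n)
    (hu : 0 < s + t - n)
    [MeasurableSpace (EuclideanSpace ℝ (Fin n) ≃ₗᵢ[ℝ] EuclideanSpace ℝ (Fin n))] :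
    ∃ C : ℝ, 0 < C ∧
      ∀ (θ : Measure (EuclideanSpace ℝ (Fin n) ≃ₗᵢ[ℝ] EuclideanSpace ℝ (Fin n))) (β : ℝ),
        (n : ℝ) - (s + t - n) < β →
        θ Set.univ ≤ 1 →
        (∀ x z : EuclideanSpace ℝ (Fin n), x ≠ 0 → z ≠ 0 → ∀ r : ℝ, 0 < r →
          θ {g | ‖x - g z‖ < r} ≤ ENNReal.ofReal ((r / ‖z‖) ^ β)) →
      ∀ (μ ν : Measure (EuclideanSpace ℝ (Fin n))),
        IsFiniteMeasure μ → IsFiniteMeasure ν →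
        (∃ K : Set (EuclideanSpace ℝ (Fin n)), IsCompact K ∧ μ Kᶜ = 0) →
        (∃ K : Set (EuclideanSpace ℝ (Fin n)), IsCompact K ∧ ν Kᶜ = 0) →
        (∫⁻ x, ∫⁻ y, edist x y ^ (-s) ∂μ ∂μ) < ⊤ →
        (∫⁻ x, ∫⁻ y, edist x y ^ (-t) ∂ν ∂ν) < ⊤ →
      ∀ (ψ : EuclideanSpace ℝ (Fin n) → ℝ), ContDiff ℝ (⊤ : ℕ∞) ψ →
        Function.support ψ ⊆ Metric.closedBall 0 1 → (∀ x, 0 ≤ ψ x) → (∫ x, ψ x) = 1 →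
      ∀ ε : ℝ, 0 < ε →
      ∀ νε : EuclideanSpace ℝ (Fin n) → ℝ,
        (νε = fun w => ∫ y, ε ^ (-(n : ℝ)) * ψ (ε⁻¹ • (w - y)) ∂ν) →
        (∫⁻ g, ∫⁻ z,
            (∫⁻ x, ∫⁻ y, edist x y ^ (-(s + t - n))
              ∂(μ.withDensity fun w => ENNReal.ofReal (νε (g.symm w - z)))
              ∂(μ.withDensity fun w => ENNReal.ofReal (νε (g.symm w - z))))
            ∂volume ∂θ)
          ≤ ENNReal.ofReal C * (∫⁻ x, ∫⁻ y, edist x y ^ (-s) ∂μ ∂μ) *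
              (∫⁻ x, ∫⁻ y, edist x y ^ (-t) ∂ν ∂ν) := by
  have hn : 1 ≤ n := by
    have h : (0:ℝ) < n := lt_trans hs hsn
    exact_mod_cast h
  obtain ⟨C, hC, H⟩ := S17.main hn hs hsn ht htn hu
  refine ⟨C.toReal + 1, by positivity, ?_⟩
  intro θ β hβ hθ1 hθ μ ν hμ hν _ _ hE _ ψ hψ hsupp h0 h1 ε hε νε hνε
  refine (H θ β hβ hθ1 hθ μ ν hμ hν hE ψ hψ.continuous hsupp h0 h1 ε hε νε hνε).trans ?_
  have hle : C ≤ ENNReal.ofReal (C.toReal + 1) := by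
    rw [ENNReal.le_ofReal_iff_toReal_le hC (by positivity)]
    linarith
  exact mul_le_mul_left (mul_le_mul_left hle _) _
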